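/- arXiv:2107.03118 — 2 statements merged into one kernel-verified Lean document; each statement's English description precedes it below -/
import Mathlib

section
/- There exists a positive constant C depending only on β and the initial data such that for every T > 0: ∫₀¹ θ^{β+2}(x,T) dx + ∫₀ᵀ ∫₀¹ θ^{2β} θ_x² dx dt ≤ C. -/
open MeasureTheory Real Set Filter Topology

/-- A classical solution on `[0,1] × [0,∞)` of the rescaled stress-free
one-dimensional compressible Navier–Stokes system
`u_t + u = v_x`, `v_t = ((v_x - θ)/u)_x`,
`θ_t = -θ v_x/u + v_x²/u + (θ^β θ_x/u)_x` (β > 0),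
with stress-free, thermally insulated boundary conditions and positive data. -/
structure NSSol where
  β : ℝ
  hβ : 0 < β
  u : ℝ → ℝ → ℝ
  v : ℝ → ℝ → ℝ
  θ : ℝ → ℝ → ℝ
  ux : ℝ → ℝ → ℝ
  ut : ℝ → ℝ → ℝ
  vx : ℝ → ℝ → ℝ
  vt : ℝ → ℝ → ℝ
  vxx : ℝ → ℝ → ℝ
  θx : ℝ → ℝ → ℝ
  θt : ℝ → ℝ → ℝ
  θxx : ℝ → ℝ → ℝ
  hu_pos : ∀ x ∈ Icc (0:ℝ) 1, ∀ t ∈ Ici (0:ℝ), 0 < u x t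
  hθ_pos : ∀ x ∈ Icc (0:ℝ) 1, ∀ t ∈ Ici (0:ℝ), 0 < θ x t
  hux : ∀ x ∈ Icc (0:ℝ) 1, ∀ t ∈ Ici (0:ℝ),
    HasDerivWithinAt (fun y => u y t) (ux x t) (Icc 0 1) x
  hut : ∀ x ∈ Icc (0:ℝ) 1, ∀ t ∈ Ici (0:ℝ),
    HasDerivWithinAt (fun s => u x s) (ut x t) (Ici 0) t
  hvx : ∀ x ∈ Icc (0:ℝ) 1, ∀ t ∈ Ici (0:ℝ),
    HasDerivWithinAt (fun y => v y t) (vx x t) (Icc 0 1) x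
  hvt : ∀ x ∈ Icc (0:ℝ) 1, ∀ t ∈ Ici (0:ℝ),
    HasDerivWithinAt (fun s => v x s) (vt x t) (Ici 0) t
  hvxx : ∀ x ∈ Icc (0:ℝ) 1, ∀ t ∈ Ici (0:ℝ),
    HasDerivWithinAt (fun y => vx y t) (vxx x t) (Icc 0 1) x
  hθx : ∀ x ∈ Icc (0:ℝ) 1, ∀ t ∈ Ici (0:ℝ),
    HasDerivWithinAt (fun y => θ y t) (θx x t) (Icc 0 1) x
  hθt : ∀ x ∈ Icc (0:ℝ) 1, ∀ t ∈ Ici (0:ℝ),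
    HasDerivWithinAt (fun s => θ x s) (θt x t) (Ici 0) t
  hθxx : ∀ x ∈ Icc (0:ℝ) 1, ∀ t ∈ Ici (0:ℝ),
    HasDerivWithinAt (fun y => θx y t) (θxx x t) (Icc 0 1) x
  hu_cont : ContinuousOn (Function.uncurry u) (Icc 0 1 ×ˢ Ici 0)
  hv_cont : ContinuousOn (Function.uncurry v) (Icc 0 1 ×ˢ Ici 0)
  hθ_cont : ContinuousOn (Function.uncurry θ) (Icc 0 1 ×ˢ Ici 0)
  hux_cont : ContinuousOn (Function.uncurry ux) (Icc 0 1 ×ˢ Ici 0)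
  hut_cont : ContinuousOn (Function.uncurry ut) (Icc 0 1 ×ˢ Ici 0)
  hvx_cont : ContinuousOn (Function.uncurry vx) (Icc 0 1 ×ˢ Ici 0)
  hvt_cont : ContinuousOn (Function.uncurry vt) (Icc 0 1 ×ˢ Ici 0)
  hvxx_cont : ContinuousOn (Function.uncurry vxx) (Icc 0 1 ×ˢ Ici 0)
  hθx_cont : ContinuousOn (Function.uncurry θx) (Icc 0 1 ×ˢ Ici 0)
  hθt_cont : ContinuousOn (Function.uncurry θt) (Icc 0 1 ×ˢ Ici 0)
  hθxx_cont : ContinuousOn (Function.uncurry θxx) (Icc 0 1 ×ˢ Ici 0)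
  mass : ∀ x ∈ Icc (0:ℝ) 1, ∀ t ∈ Ici (0:ℝ), ut x t + u x t = vx x t
  momentum : ∀ x ∈ Icc (0:ℝ) 1, ∀ t ∈ Ici (0:ℝ),
    HasDerivWithinAt (fun y => (vx y t - θ y t) / u y t) (vt x t) (Icc 0 1) x
  energyEq : ∀ x ∈ Icc (0:ℝ) 1, ∀ t ∈ Ici (0:ℝ),
    HasDerivWithinAt (fun y => θ y t ^ β * θx y t / u y t)
      (θt x t + θ x t * vx x t / u x t - (vx x t) ^ 2 / u x t) (Icc 0 1) x
  bc0 : ∀ t ∈ Ici (0:ℝ), (vx 0 t - θ 0 t) / u 0 t = 0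
  bc1 : ∀ t ∈ Ici (0:ℝ), (vx 1 t - θ 1 t) / u 1 t = 0
  bcθ0 : ∀ t ∈ Ici (0:ℝ), θx 0 t = 0
  bcθ1 : ∀ t ∈ Ici (0:ℝ), θx 1 t = 0

namespace NSSol

/-- The initial energy `E₀ = ∫₀¹ (v₀²/2 + θ₀) dx`. -/
noncomputable def E₀ (S : NSSol) : ℝ := ∫ x in (0:ℝ)..1, ((S.v x 0) ^ 2 / 2 + S.θ x 0)

/-- The dissipation functional
`V(t) = ∫₀¹ (θ^β θ_x²/(uθ²) + (v_x − θ)²/(uθ)) dx`. -/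
noncomputable def V (S : NSSol) (t : ℝ) : ℝ :=
  ∫ x in (0:ℝ)..1,
    (S.θ x t ^ S.β * (S.θx x t) ^ 2 / (S.u x t * (S.θ x t) ^ 2)
      + (S.vx x t - S.θ x t) ^ 2 / (S.u x t * S.θ x t))

/-- The auxiliary velocity
`w(x,t) = v(x,t) − ∫₀¹ v₀ dξ − ∫₀ˣ u(ξ,t) dξ + ∫₀¹∫₀^ξ u(η,t) dη dξ`,
which satisfies `w_x = v_x − u` and `∫₀¹ w dx = 0`. -/
noncomputable def w (S : NSSol) (x t : ℝ) : ℝ :=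
  S.v x t - (∫ ξ in (0:ℝ)..1, S.v ξ 0) - (∫ ξ in (0:ℝ)..x, S.u ξ t)
    + ∫ ξ in (0:ℝ)..1, ∫ η in (0:ℝ)..ξ, S.u η t

/-- The asymptotic state `A = 2√(36 + 3(2E₀ − (∫₀¹ v₀ dx)²)) − 12`. -/
noncomputable def A (S : NSSol) : ℝ :=
  2 * Real.sqrt (36 + 3 * (2 * S.E₀ - (∫ x in (0:ℝ)..1, S.v x 0) ^ 2)) - 12

end NSSol

section Calculus

lemma integral_eq_sub_of_hasDerivWithinAt_Icc {f f' : ℝ → ℝ} {a b c d : ℝ}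
    (hf : ∀ x ∈ Icc c d, HasDerivWithinAt f (f' x) (Icc c d) x) (hf' : Continuous f')
    (ha : a ∈ Icc c d) (hb : b ∈ Icc c d) : ∫ x in a..b, f' x = f b - f a := by
  have hsub : uIcc a b ⊆ Icc c d := uIcc_subset_Icc ha hb
  refine intervalIntegral.integral_eq_sub_of_hasDeriv_right
    (fun x hx => ((hf x (hsub hx)).continuousWithinAt).mono hsub) (fun x hx => ?_)
    (hf'.intervalIntegrable _ _)
  have hx' : x ∈ Ioo c d :=
    ⟨(le_min ha.1 hb.1).trans_lt hx.1, hx.2.trans_le (max_le ha.2 hb.2)⟩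
  exact ((hf x (Ioo_subset_Icc_self hx')).hasDerivAt
    (Icc_mem_nhds hx'.1 hx'.2)).hasDerivWithinAt

lemma integral_mono_Icc {f g : ℝ → ℝ} {a b : ℝ} (hab : a ≤ b) (hf : Continuous f)
    (hg : Continuous g) (h : ∀ x ∈ Icc a b, f x ≤ g x) :
    ∫ x in a..b, f x ≤ ∫ x in a..b, g x :=
  intervalIntegral.integral_mono_on hab (hf.intervalIntegrable _ _) (hg.intervalIntegrable _ _) h

/-- A weighted form of the Cauchy–Schwarz inequality. -/
lemma sq_integral_le_mul {f b c : ℝ → ℝ} (hf : Continuous f) (hb : Continuous b)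
    (hc : Continuous c) (hb0 : ∀ x, 0 ≤ b x) (hc0 : ∀ x, 0 ≤ c x)
    (h : ∀ x, f x ^ 2 ≤ b x * c x) :
    (∫ x in (0:ℝ)..1, f x) ^ 2 ≤ (∫ x in (0:ℝ)..1, b x) * ∫ x in (0:ℝ)..1, c x := by
  have key : ∀ r : ℝ, 0 ≤ (∫ x in (0:ℝ)..1, c x) * (r * r) + (2 * ∫ x in (0:ℝ)..1, f x) * r
      + ∫ x in (0:ℝ)..1, b x := by
    intro r
    have h1 : ∫ x in (0:ℝ)..1, (c x * (r * r) + (2 * f x) * r + b x)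
        = (∫ x in (0:ℝ)..1, c x) * (r * r) + (2 * ∫ x in (0:ℝ)..1, f x) * r
          + ∫ x in (0:ℝ)..1, b x := by
      rw [intervalIntegral.integral_add, intervalIntegral.integral_add,
        intervalIntegral.integral_mul_const, intervalIntegral.integral_mul_const,
        intervalIntegral.integral_const_mul]
      all_goals exact Continuous.intervalIntegrable (by fun_prop) _ _
    rw [← h1]
    refine intervalIntegral.integral_nonneg zero_le_one fun x _ => ?_
    have h2 : (2 * f x * r) ^ 2 ≤ (c x * (r * r) + b x) ^ 2 := by
      nlinarith [sq_nonneg (c x * (r * r) - b x), mul_le_mul_of_nonneg_left (h x) (sq_nonneg r)]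
    have h3 : 0 ≤ c x * (r * r) + b x :=
      add_nonneg (mul_nonneg (hc0 x) (mul_self_nonneg r)) (hb0 x)
    linarith [(abs_le.1 (abs_le_of_sq_le_sq h2 h3)).1]
  have := discrim_le_zero key
  rw [discrim] at this
  nlinarith

/-- The square of the oscillation of a function is controlled by a weighted norm of its
derivative. -/
lemma sq_sub_le_integral_mul_integral {f f' b c : ℝ → ℝ}
    (hf : ∀ x ∈ Icc (0:ℝ) 1, HasDerivWithinAt f (f' x) (Icc 0 1) x) (hf' : Continuous f')
    (hb : Continuous b) (hc : Continuous c) (hb0 : ∀ x, 0 ≤ b x) (hc0 : ∀ x, 0 ≤ c x)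
    (h : ∀ x, f' x ^ 2 ≤ b x * c x) {x y : ℝ} (hx : x ∈ Icc (0:ℝ) 1) (hy : y ∈ Icc (0:ℝ) 1) :
    (f x - f y) ^ 2 ≤ (∫ x in (0:ℝ)..1, b x) * ∫ x in (0:ℝ)..1, c x := by
  have h1 : |f x - f y| ≤ ∫ z in (0:ℝ)..1, |f' z| := by
    rw [← integral_eq_sub_of_hasDerivWithinAt_Icc hf hf' hy hx]
    rw [← Real.norm_eq_abs]
    refine intervalIntegral.norm_integral_le_integral_norm_uIoc.trans ?_
    rw [intervalIntegral.integral_of_le zero_le_one]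
    refine setIntegral_mono_set (hf'.abs.integrableOn_Ioc) (ae_of_all _ fun _ => abs_nonneg _) ?_
    rw [← uIoc_of_le (zero_le_one' ℝ)]
    refine (uIoc_subset_uIoc_of_uIcc_subset_uIcc ?_).eventuallyLE
    rw [uIcc_of_le (zero_le_one' ℝ)]
    exact uIcc_subset_Icc hy hx
  calc (f x - f y) ^ 2 = |f x - f y| ^ 2 := (sq_abs _).symm
    _ ≤ (∫ z in (0:ℝ)..1, |f' z|) ^ 2 := by gcongr
    _ ≤ _ := sq_integral_le_mul hf'.abs hb hc hb0 hc0 (by simpa only [sq_abs] using h)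

lemma exists_eq_integral {f : ℝ → ℝ} (hf : Continuous f) :
    ∃ y ∈ Icc (0:ℝ) 1, f y = ∫ x in (0:ℝ)..1, f x := by
  obtain ⟨y, hy, h⟩ := exists_hasDerivAt_eq_slope (fun z => ∫ x in (0:ℝ)..z, f x) f zero_lt_one
    (intervalIntegral.continuous_primitive (fun a b => hf.intervalIntegrable a b) 0).continuousOn
    (fun x _ => (hf.integral_hasStrictDerivAt 0 x).hasDerivAt)
  exact ⟨y, Ioo_subset_Icc_self hy, by simpa using h⟩

lemma continuous_integral_left {f : ℝ → ℝ → ℝ} (hf : Continuous fun p : ℝ × ℝ => f p.1 p.2)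
    (a b : ℝ) : Continuous fun t => ∫ x in a..b, f x t :=
  intervalIntegral.continuous_parametric_intervalIntegral_of_continuous'
    (f := fun t x => f x t) (hf.comp continuous_swap) a b

/-- Differentiation under the integral sign on the half-line of nonnegative times. -/
lemma hasDerivWithinAt_integral_param {f f' : ℝ → ℝ → ℝ} {a : ℝ} (ha : a ∈ Icc (0:ℝ) 1)
    (hf : Continuous fun p : ℝ × ℝ => f p.1 p.2) (hf' : Continuous fun p : ℝ × ℝ => f' p.1 p.2)
    (h : ∀ x ∈ Icc (0:ℝ) 1, ∀ t ∈ Ici (0:ℝ), HasDerivWithinAt (f x) (f' x t) (Ici 0) t)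
    {t : ℝ} (ht : t ∈ Ici (0:ℝ)) :
    HasDerivWithinAt (fun s => ∫ x in (0:ℝ)..a, f x s) (∫ x in (0:ℝ)..a, f' x t) (Ici 0) t := by
  have hG := continuous_integral_left hf' 0 a
  have hrep : ∀ s ∈ Ici (0:ℝ), ∫ x in (0:ℝ)..a, f x s
      = (∫ x in (0:ℝ)..a, f x 0) + ∫ r in (0:ℝ)..s, ∫ x in (0:ℝ)..a, f' x r := by
    intro s hs
    have h1 : ∀ x ∈ Icc (0:ℝ) 1, ∫ r in (0:ℝ)..s, f' x r = f x s - f x 0 := fun x hx =>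
      integral_eq_sub_of_hasDerivWithinAt_Icc (c := 0) (d := s)
        (fun r hr => (h x hx r hr.1).mono Icc_subset_Ici_self)
        (hf'.comp (by fun_prop : Continuous fun r : ℝ => (x, r))) ⟨le_rfl, hs⟩ ⟨hs, le_rfl⟩
    have h2 : ∫ r in (0:ℝ)..s, ∫ x in (0:ℝ)..a, f' x r
        = ∫ x in (0:ℝ)..a, ∫ r in (0:ℝ)..s, f' x r :=
      intervalIntegral_intervalIntegral_swap (F := fun r x => f' x r)
        (((hf'.comp continuous_swap).continuousOn.integrableOn_compact
          (isCompact_uIcc.prod isCompact_uIcc)).mono_set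
            (prod_mono uIoc_subset_uIcc uIoc_subset_uIcc))
    rw [h2, intervalIntegral.integral_congr
      (f := fun x => ∫ r in (0:ℝ)..s, f' x r) (g := fun x => f x s - f x 0)]
    · rw [intervalIntegral.integral_sub]
      · ring
      all_goals
        exact (hf.comp (by fun_prop : Continuous fun x : ℝ => (x, _))).intervalIntegrable _ _
    · intro x hx
      rw [uIcc_of_le ha.1] at hx
      exact h1 x ⟨hx.1, hx.2.trans ha.2⟩
  refine HasDerivWithinAt.congr ?_ hrep (hrep t ht)
  exact ((hG.integral_hasStrictDerivAt 0 t).hasDerivAt.hasDerivWithinAt).const_add _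

lemma sub_le_integral_of_hasDerivWithinAt_Ici {f f' g : ℝ → ℝ}
    (hf : ∀ t ∈ Ici (0:ℝ), HasDerivWithinAt f (f' t) (Ici 0) t) (hg : Continuous g)
    (h : ∀ t ∈ Ici (0:ℝ), f' t ≤ g t) {a b : ℝ} (ha : 0 ≤ a) (hab : a ≤ b) :
    f b - f a ≤ ∫ t in a..b, g t := by
  refine intervalIntegral.sub_le_integral_of_hasDeriv_right_of_le hab
    (fun t ht => ((hf t (ha.trans ht.1)).continuousWithinAt).mono
      fun s hs => ha.trans hs.1)
    (fun t ht => (hf t (ha.trans ht.1.le)).mono fun s hs => (ha.trans ht.1.le).trans (le_of_lt hs))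
    hg.integrableOn_Icc (fun t ht => h t (ha.trans ht.1.le))

/-- Grönwall's inequality in integral form. -/
lemma le_mul_exp_integral_of_le {N V : ℝ → ℝ} (hN : Continuous N) (hV : Continuous V)
    (hV0 : ∀ t, 0 ≤ V t) {a : ℝ} (h : ∀ t ∈ Ici (0:ℝ), N t ≤ a + ∫ s in (0:ℝ)..t, V s * N s)
    {t : ℝ} (ht : 0 ≤ t) : N t ≤ a * exp (∫ s in (0:ℝ)..t, V s) := by
  set I : ℝ → ℝ := fun t => ∫ s in (0:ℝ)..t, V s with hI
  set G : ℝ → ℝ := fun t => a + ∫ s in (0:ℝ)..t, V s * N s with hG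
  have dI : ∀ t, HasDerivAt I (V t) t := fun t => (hV.integral_hasStrictDerivAt 0 t).hasDerivAt
  have dG : ∀ t, HasDerivAt G (V t * N t) t := fun t =>
    (((hV.mul hN).integral_hasStrictDerivAt 0 t).hasDerivAt).const_add a
  have h1 := sub_le_integral_of_hasDerivWithinAt_Ici (f := fun t => G t * exp (-I t))
    (g := fun _ => 0) (fun t _ => ((dG t).mul ((dI t).neg.exp)).hasDerivWithinAt) continuous_const
    (fun t ht => by
      have := mul_le_mul_of_nonneg_left (h t ht) (mul_nonneg (hV0 t) (exp_pos (-I t)).le)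
      simp only [hG, Pi.neg_apply] at this ⊢
      nlinarith) le_rfl ht
  have h2 : G 0 * exp (-I 0) = a := by simp [hG, hI]
  simp only [h2, intervalIntegral.integral_zero] at h1
  calc N t ≤ G t := h t ht
    _ = G t * exp (-I t) * exp (I t) := by rw [mul_assoc, ← exp_add]; simp
    _ ≤ a * exp (I t) := by gcongr; linarith

/-- Derivative at `t` of `s ↦ ∫ k m` when `k` vanishes at time `t`: the second factor only needs
to be continuous. -/
lemma hasDerivWithinAt_integral_mul_of_eq_zero {k k' m : ℝ → ℝ → ℝ}
    (hk : Continuous fun p : ℝ × ℝ => k p.1 p.2) (hk' : Continuous fun p : ℝ × ℝ => k' p.1 p.2)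
    (hm : Continuous fun p : ℝ × ℝ => m p.1 p.2)
    (h : ∀ x ∈ Icc (0:ℝ) 1, ∀ t ∈ Ici (0:ℝ), HasDerivWithinAt (k x) (k' x t) (Ici 0) t)
    {t : ℝ} (ht : t ∈ Ici (0:ℝ)) (hkt : ∀ x ∈ Icc (0:ℝ) 1, k x t = 0) :
    HasDerivWithinAt (fun s => ∫ x in (0:ℝ)..1, k x s * m x s)
      (∫ x in (0:ℝ)..1, k' x t * m x t) (Ici 0) t := by
  have hmt : Continuous fun p : ℝ × ℝ => m p.1 t :=
    hm.comp (by fun_prop : Continuous fun p : ℝ × ℝ => (p.1, t))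
  have h1 := hasDerivWithinAt_integral_param (f := fun x s => k x s * m x t)
    (f' := fun x s => k' x s * m x t) (a := 1) ⟨zero_le_one, le_rfl⟩ (hk.mul hmt) (hk'.mul hmt)
    (fun x hx s hs => (h x hx s hs).mul_const _) ht
  have hd : Continuous fun p : ℝ × ℝ => k p.1 p.2 * (m p.1 p.2 - m p.1 t) := hk.mul (hm.sub hmt)
  have h2 : HasDerivWithinAt (fun s => ∫ x in (0:ℝ)..1, k x s * (m x s - m x t)) 0 (Ici 0) t := by
    obtain ⟨K, hK⟩ : ∃ K, ∀ p ∈ Icc (0:ℝ) 1 ×ˢ Icc (0:ℝ) (t + 1), ‖k' p.1 p.2‖ ≤ K :=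
      (isCompact_Icc.prod isCompact_Icc).exists_bound_of_continuousOn hk'.continuousOn
    have hK0 : 0 ≤ K :=
      (norm_nonneg _).trans (hK (0, t) ⟨⟨le_rfl, zero_le_one⟩, ⟨ht, by simp⟩⟩)
    have hkb : ∀ x ∈ Icc (0:ℝ) 1, ∀ s ∈ Icc (0:ℝ) (t + 1), |k x s| ≤ K * |s - t| := by
      intro x hx s hs
      have := (convex_Icc (0:ℝ) (t + 1)).norm_image_sub_le_of_norm_hasDerivWithin_le
        (f := k x) (f' := k' x) (C := K) (x := t) (y := s)
        (fun r hr => (h x hx r hr.1).mono Icc_subset_Ici_self) (fun r hr => hK (x, r) ⟨hx, hr⟩)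
        ⟨ht, by simp⟩ hs
      simpa [hkt x hx] using this
    have hM : Tendsto (fun s => K * ∫ x in (0:ℝ)..1, |m x s - m x t|) (𝓝[Ici 0] t) (𝓝 0) := by
      have hc : Continuous fun s => K * ∫ x in (0:ℝ)..1, |m x s - m x t| :=
        continuous_const.mul (continuous_integral_left (f := fun x s => |m x s - m x t|)
          (hm.sub hmt).abs 0 1)
      simpa using (hc.tendsto t).mono_left nhdsWithin_le_nhds
    rw [hasDerivWithinAt_iff_isLittleO, Asymptotics.isLittleO_iff]
    intro c hc
    have hnear : ∀ᶠ s in 𝓝[Ici 0] t, s < t + 1 :=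
      nhdsWithin_le_nhds (Iio_mem_nhds (by linarith))
    filter_upwards [hM.eventually (Iio_mem_nhds hc), self_mem_nhdsWithin, hnear] with s hs hs0 hs1
    have hz : ∫ x in (0:ℝ)..1, k x t * (m x t - m x t) = 0 := by simp
    have hms : Continuous fun x => |m x s - m x t| :=
      ((hm.sub hmt).abs).comp (by fun_prop : Continuous fun x : ℝ => (x, s))
    rw [hz]
    simp only [sub_zero, smul_zero, norm_eq_abs]
    calc |∫ x in (0:ℝ)..1, k x s * (m x s - m x t)|
        ≤ ∫ x in (0:ℝ)..1, |k x s * (m x s - m x t)| :=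
          intervalIntegral.abs_integral_le_integral_abs zero_le_one
      _ ≤ ∫ x in (0:ℝ)..1, K * |s - t| * |m x s - m x t| := by
          refine integral_mono_Icc zero_le_one
            (hd.abs.comp (by fun_prop : Continuous fun x : ℝ => (x, s)))
            (continuous_const.mul hms) fun x hx => ?_
          rw [abs_mul]
          gcongr
          exact hkb x hx s ⟨hs0, hs1.le⟩
      _ = (K * ∫ x in (0:ℝ)..1, |m x s - m x t|) * |s - t| := by
          rw [intervalIntegral.integral_const_mul]; ring
      _ ≤ c * |s - t| := by
          have hs' : K * ∫ x in (0:ℝ)..1, |m x s - m x t| ≤ c := le_of_lt hs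
          gcongr
  have h3 := h1.add h2
  rw [add_zero] at h3
  refine h3.congr_of_mem (fun s _ => ?_) ht
  rw [Pi.add_apply, ← intervalIntegral.integral_add]
  · exact intervalIntegral.integral_congr fun x _ => by ring
  · exact ((hk.mul hmt).comp (by fun_prop : Continuous fun x : ℝ => (x, s))).intervalIntegrable _ _
  · exact (hd.comp (by fun_prop : Continuous fun x : ℝ => (x, s))).intervalIntegrable _ _

end Calculus

/-- A solution of the rescaled stress-free system whose data are extended to continuous functions
on the whole plane; `σ = (v_x - θ)/u` is the stress and `q = θ^β θ_x/u` the heat flux. -/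
structure StressFreeFlow where
  β : ℝ
  β_pos : 0 < β
  u : C(ℝ × ℝ, ℝ)
  v : C(ℝ × ℝ, ℝ)
  θ : C(ℝ × ℝ, ℝ)
  vx : C(ℝ × ℝ, ℝ)
  vt : C(ℝ × ℝ, ℝ)
  θx : C(ℝ × ℝ, ℝ)
  θt : C(ℝ × ℝ, ℝ)
  σ : C(ℝ × ℝ, ℝ)
  q : C(ℝ × ℝ, ℝ)
  u_pos : ∀ p, 0 < u p
  θ_pos : ∀ p, 0 < θ p
  vx_eq : ∀ p, vx p = u p * σ p + θ p
  q_eq : ∀ p, q p = θ p ^ β * θx p / u p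
  deriv_u : ∀ x ∈ Icc (0:ℝ) 1, ∀ t ∈ Ici (0:ℝ),
    HasDerivWithinAt (fun s => u (x, s)) (vx (x, t) - u (x, t)) (Ici 0) t
  deriv_v : ∀ x ∈ Icc (0:ℝ) 1, ∀ t ∈ Ici (0:ℝ),
    HasDerivWithinAt (fun s => v (x, s)) (vt (x, t)) (Ici 0) t
  deriv_θ : ∀ x ∈ Icc (0:ℝ) 1, ∀ t ∈ Ici (0:ℝ),
    HasDerivWithinAt (fun s => θ (x, s)) (θt (x, t)) (Ici 0) t
  derivx_v : ∀ x ∈ Icc (0:ℝ) 1, ∀ t ∈ Ici (0:ℝ),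
    HasDerivWithinAt (fun y => v (y, t)) (vx (x, t)) (Icc 0 1) x
  derivx_θ : ∀ x ∈ Icc (0:ℝ) 1, ∀ t ∈ Ici (0:ℝ),
    HasDerivWithinAt (fun y => θ (y, t)) (θx (x, t)) (Icc 0 1) x
  derivx_σ : ∀ x ∈ Icc (0:ℝ) 1, ∀ t ∈ Ici (0:ℝ),
    HasDerivWithinAt (fun y => σ (y, t)) (vt (x, t)) (Icc 0 1) x
  derivx_q : ∀ x ∈ Icc (0:ℝ) 1, ∀ t ∈ Ici (0:ℝ),
    HasDerivWithinAt (fun y => q (y, t)) (θt (x, t) - σ (x, t) * vx (x, t)) (Icc 0 1) x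
  σ_zero : ∀ t ∈ Ici (0:ℝ), σ (0, t) = 0
  σ_one : ∀ t ∈ Ici (0:ℝ), σ (1, t) = 0
  q_zero : ∀ t ∈ Ici (0:ℝ), q (0, t) = 0
  q_one : ∀ t ∈ Ici (0:ℝ), q (1, t) = 0

namespace StressFreeFlow

variable (F : StressFreeFlow)

@[simp] lemma u_ne_zero (p : ℝ × ℝ) : F.u p ≠ 0 := (F.u_pos p).ne'

@[simp] lemma θ_ne_zero (p : ℝ × ℝ) : F.θ p ≠ 0 := (F.θ_pos p).ne'

@[fun_prop] lemma continuous_θ_rpow (a : ℝ) {X : Type*} [TopologicalSpace X] {f : X → ℝ × ℝ}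
    (hf : Continuous f) : Continuous fun x => F.θ (f x) ^ a :=
  (F.θ.continuous.comp hf).rpow_const fun _ => Or.inl (F.θ_ne_zero _)

/-- The mean temperature. -/
noncomputable def temp (t : ℝ) : ℝ := ∫ x in (0:ℝ)..1, F.θ (x, t)

/-- The entropy dissipation. -/
noncomputable def diss (t : ℝ) : ℝ :=
  ∫ x in (0:ℝ)..1, (F.θ (x, t) ^ F.β * F.θx (x, t) ^ 2 / (F.u (x, t) * F.θ (x, t) ^ 2)
    + F.u (x, t) * F.σ (x, t) ^ 2 / F.θ (x, t))

/-- The weighted square norm of the stress. -/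
noncomputable def stress (t : ℝ) : ℝ := ∫ x in (0:ℝ)..1, F.u (x, t) * F.σ (x, t) ^ 2

/-- The square norm of the gradient of `θ^(β+1)/(β+1)`. -/
noncomputable def heat (t : ℝ) : ℝ :=
  ∫ x in (0:ℝ)..1, F.θ (x, t) ^ (2 * F.β) * F.θx (x, t) ^ 2

/-- The conserved total energy. -/
noncomputable def energy : ℝ := ∫ x in (0:ℝ)..1, (F.v (x, 0) ^ 2 / 2 + F.θ (x, 0))

/-- The weighted first moment of the velocity. -/
noncomputable def moment (t : ℝ) : ℝ := ∫ x in (0:ℝ)..1, (1 - x) * F.v (x, t)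

noncomputable def weight (t : ℝ) : ℝ := ∫ x in (0:ℝ)..1, F.u (x, t) * (1 + F.θ (x, t))

@[fun_prop] lemma continuous_temp : Continuous F.temp :=
  continuous_integral_left (f := fun x t => F.θ (x, t)) (by fun_prop) 0 1

@[fun_prop] lemma continuous_diss : Continuous F.diss :=
  continuous_integral_left (f := fun x t =>
    F.θ (x, t) ^ F.β * F.θx (x, t) ^ 2 / (F.u (x, t) * F.θ (x, t) ^ 2)
      + F.u (x, t) * F.σ (x, t) ^ 2 / F.θ (x, t)) (by fun_prop (disch := simp)) 0 1

@[fun_prop] lemma continuous_stress : Continuous F.stress :=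
  continuous_integral_left (f := fun x t => F.u (x, t) * F.σ (x, t) ^ 2) (by fun_prop) 0 1

@[fun_prop] lemma continuous_heat : Continuous F.heat :=
  continuous_integral_left (f := fun x t => F.θ (x, t) ^ (2 * F.β) * F.θx (x, t) ^ 2)
    (by fun_prop (disch := simp)) 0 1

@[fun_prop] lemma continuous_weight : Continuous F.weight :=
  continuous_integral_left (f := fun x t => F.u (x, t) * (1 + F.θ (x, t))) (by fun_prop) 0 1

lemma temp_pos (t : ℝ) : 0 < F.temp t :=
  intervalIntegral.intervalIntegral_pos_of_pos (Continuous.intervalIntegrable (by fun_prop) _ _)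
    (fun _ => F.θ_pos _) zero_lt_one

lemma diss_nonneg (t : ℝ) : 0 ≤ F.diss t :=
  intervalIntegral.integral_nonneg zero_le_one fun x _ => by
    have := F.u_pos (x, t); have := F.θ_pos (x, t); positivity

lemma stress_nonneg (t : ℝ) : 0 ≤ F.stress t :=
  intervalIntegral.integral_nonneg zero_le_one fun x _ => by
    have := F.u_pos (x, t); positivity

lemma heat_nonneg (t : ℝ) : 0 ≤ F.heat t :=
  intervalIntegral.integral_nonneg zero_le_one fun x _ => by
    have := F.θ_pos (x, t); positivity

lemma weight_nonneg (t : ℝ) : 0 ≤ F.weight t :=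
  intervalIntegral.integral_nonneg zero_le_one fun x _ => by
    have := F.u_pos (x, t); have := F.θ_pos (x, t); positivity

lemma integral_energy {t : ℝ} (ht : 0 ≤ t) :
    ∫ x in (0:ℝ)..1, (F.v (x, t) ^ 2 / 2 + F.θ (x, t)) = F.energy := by
  have hd : ∀ t ∈ Ici (0:ℝ), HasDerivWithinAt
      (fun t => ∫ x in (0:ℝ)..1, (F.v (x, t) ^ 2 / 2 + F.θ (x, t))) 0 (Ici 0) t := by
    intro t ht
    have h1 := hasDerivWithinAt_integral_param (a := 1) ⟨zero_le_one, le_rfl⟩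
      (f := fun x s => F.v (x, s) ^ 2 / 2 + F.θ (x, s))
      (f' := fun x s => F.v (x, s) * F.vt (x, s) + F.θt (x, s)) (by fun_prop) (by fun_prop)
      (fun x hx s hs => ((((F.deriv_v x hx s hs).pow 2).div_const 2).add
        (F.deriv_θ x hx s hs)).congr_deriv (by simp; ring)) ht
    have h2 := integral_eq_sub_of_hasDerivWithinAt_Icc (a := 0) (b := 1)
      (f := fun y => F.v (y, t) * F.σ (y, t) + F.q (y, t))
      (f' := fun x => F.v (x, t) * F.vt (x, t) + F.θt (x, t))
      (fun x hx => (((F.derivx_v x hx t ht).mul (F.derivx_σ x hx t ht)).add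
        (F.derivx_q x hx t ht)).congr_deriv (by ring)) (by fun_prop)
        ⟨le_rfl, zero_le_one⟩ ⟨zero_le_one, le_rfl⟩
    rw [h2] at h1
    simpa [F.σ_zero t ht, F.σ_one t ht, F.q_zero t ht, F.q_one t ht] using h1
  have h1 := sub_le_integral_of_hasDerivWithinAt_Ici hd continuous_zero (fun _ _ => le_rfl)
    le_rfl ht
  have h2 := sub_le_integral_of_hasDerivWithinAt_Ici (fun t ht => (hd t ht).neg) continuous_zero
    (fun _ _ => neg_zero.le) le_rfl ht
  simp only [Pi.zero_apply, intervalIntegral.integral_zero, Pi.neg_apply] at h1 h2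
  rw [energy]
  linarith

lemma temp_le_energy {t : ℝ} (ht : 0 ≤ t) : F.temp t ≤ F.energy := by
  rw [← F.integral_energy ht]
  exact integral_mono_Icc zero_le_one (by fun_prop) (by fun_prop)
    fun x _ => by nlinarith [sq_nonneg (F.v (x, t))]

lemma energy_pos : 0 < F.energy := (F.temp_pos 0).trans_le (F.temp_le_energy le_rfl)

lemma integral_abs_v_le {t : ℝ} (ht : 0 ≤ t) :
    ∫ x in (0:ℝ)..1, |F.v (x, t)| ≤ 1 / 2 + F.energy := by
  have h : ∫ x in (0:ℝ)..1, (1 / 2 + (F.v (x, t) ^ 2 / 2 + F.θ (x, t))) = 1 / 2 + F.energy := by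
    rw [intervalIntegral.integral_add (by simp) (Continuous.intervalIntegrable (by fun_prop) _ _),
      F.integral_energy ht]
    simp
  rw [← h]
  refine integral_mono_Icc zero_le_one (by fun_prop) (by fun_prop) fun x _ => ?_
  have := F.θ_pos (x, t)
  nlinarith [sq_nonneg (|F.v (x, t)| - 1), sq_abs (F.v (x, t))]

lemma abs_moment_le {t : ℝ} (ht : 0 ≤ t) : |F.moment t| ≤ 1 / 2 + F.energy := by
  refine (intervalIntegral.abs_integral_le_integral_abs zero_le_one).trans
    (le_trans ?_ (F.integral_abs_v_le ht))
  refine integral_mono_Icc zero_le_one (by fun_prop) (by fun_prop) fun x hx => ?_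
  rw [abs_mul, abs_of_nonneg (by linarith [hx.2])]
  exact mul_le_of_le_one_left (abs_nonneg _) (by linarith [hx.1])

lemma abs_integral_v_le {x t : ℝ} (hx : x ∈ Icc (0:ℝ) 1) (ht : 0 ≤ t) :
    |∫ y in (0:ℝ)..x, F.v (y, t)| ≤ 1 / 2 + F.energy := by
  refine (intervalIntegral.abs_integral_le_integral_abs hx.1).trans
    (le_trans ?_ (F.integral_abs_v_le ht))
  exact intervalIntegral.integral_mono_interval le_rfl hx.1 hx.2 (ae_of_all _ fun _ => abs_nonneg _)
    (Continuous.intervalIntegrable (by fun_prop) _ _)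

/-- The entropy identity. -/
lemma hasDerivWithinAt_entropy {t : ℝ} (ht : t ∈ Ici (0:ℝ)) :
    HasDerivWithinAt (fun t => ∫ x in (0:ℝ)..1, (log (F.θ (x, t)) - (1 - x) * F.v (x, t)))
      (F.diss t) (Ici 0) t := by
  have h1 := hasDerivWithinAt_integral_param (a := 1) ⟨zero_le_one, le_rfl⟩
    (f := fun x s => log (F.θ (x, s)) - (1 - x) * F.v (x, s))
    (f' := fun x s => F.θt (x, s) / F.θ (x, s) - (1 - x) * F.vt (x, s))
    (by fun_prop (disch := simp)) (by fun_prop (disch := simp))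
    (fun x hx s hs => ((F.deriv_θ x hx s hs).log (F.θ_ne_zero _)).sub
      ((F.deriv_v x hx s hs).const_mul (1 - x))) ht
  refine h1.congr_deriv ?_
  have h2 := integral_eq_sub_of_hasDerivWithinAt_Icc (a := 0) (b := 1)
    (f := fun y => F.q (y, t) / F.θ (y, t) - (1 - y) * F.σ (y, t))
    (f' := fun x => ((F.θt (x, t) - F.σ (x, t) * F.vx (x, t)) * F.θ (x, t)
      - F.q (x, t) * F.θx (x, t)) / F.θ (x, t) ^ 2
      - (-1 * F.σ (x, t) + (1 - x) * F.vt (x, t)))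
    (fun x hx => ((F.derivx_q x hx t ht).div (F.derivx_θ x hx t ht) (F.θ_ne_zero _)).sub
      (((hasDerivWithinAt_id x _).const_sub 1).mul (F.derivx_σ x hx t ht)))
      (by fun_prop (disch := simp)) ⟨le_rfl, zero_le_one⟩ ⟨zero_le_one, le_rfl⟩
  simp only [F.σ_zero t ht, F.q_zero t ht, F.q_one t ht, zero_div, sub_self, zero_mul, mul_zero]
    at h2
  rw [diss, ← sub_eq_zero, ← intervalIntegral.integral_sub]
  · refine (intervalIntegral.integral_congr fun x _ => ?_).trans h2
    simp only [F.q_eq, F.vx_eq]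
    have := F.u_ne_zero (x, t)
    have := F.θ_ne_zero (x, t)
    field_simp
    ring
  all_goals exact Continuous.intervalIntegrable (by fun_prop (disch := simp)) _ _

lemma integral_log_le {t a : ℝ} (ha : 0 < a) :
    ∫ x in (0:ℝ)..1, log (F.θ (x, t)) ≤ F.temp t / a - 1 + log a := by
  have h : ∫ x in (0:ℝ)..1, (F.θ (x, t) / a + (log a - 1)) = F.temp t / a - 1 + log a := by
    rw [intervalIntegral.integral_add (Continuous.intervalIntegrable (by fun_prop) _ _) (by simp),
      intervalIntegral.integral_div, temp]
    simp
    ring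
  rw [← h]
  refine integral_mono_Icc zero_le_one (by fun_prop (disch := simp)) (by fun_prop) fun x _ => ?_
  have := log_le_sub_one_of_pos (div_pos (F.θ_pos (x, t)) ha)
  rw [log_div (F.θ_ne_zero _) ha.ne'] at this
  linarith

lemma integral_entropy (t : ℝ) :
    ∫ x in (0:ℝ)..1, (log (F.θ (x, t)) - (1 - x) * F.v (x, t))
      = (∫ x in (0:ℝ)..1, log (F.θ (x, t))) - F.moment t :=
  intervalIntegral.integral_sub (Continuous.intervalIntegrable (by fun_prop (disch := simp)) _ _)
    (Continuous.intervalIntegrable (by fun_prop) _ _)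

lemma exists_integral_diss_le : ∃ K, ∀ t, 0 ≤ t → ∫ s in (0:ℝ)..t, F.diss s ≤ K := by
  refine ⟨F.energy - 1 + (1 / 2 + F.energy)
    - ∫ x in (0:ℝ)..1, (log (F.θ (x, 0)) - (1 - x) * F.v (x, 0)), fun t ht => ?_⟩
  have h1 := sub_le_integral_of_hasDerivWithinAt_Ici
    (fun t ht => (F.hasDerivWithinAt_entropy ht).neg) F.continuous_diss.neg
    (fun _ _ => le_rfl) le_rfl ht
  have h2 := F.integral_log_le (t := t) zero_lt_one
  have h3 := F.temp_le_energy ht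
  have h4 := abs_le.1 (F.abs_moment_le ht)
  simp only [Pi.neg_apply, intervalIntegral.integral_neg, F.integral_entropy t, div_one,
    log_one] at h1 h2
  linarith [h4.1]

lemma exists_le_temp : ∃ c > 0, ∀ t, 0 ≤ t → c ≤ F.temp t := by
  set L := ∫ x in (0:ℝ)..1, (log (F.θ (x, 0)) - (1 - x) * F.v (x, 0)) with hL
  refine ⟨exp (L - (1 / 2 + F.energy)), exp_pos _, fun t ht => ?_⟩
  have h1 := sub_le_integral_of_hasDerivWithinAt_Ici
    (fun t ht => (F.hasDerivWithinAt_entropy ht).neg) continuous_zero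
    (fun t _ => neg_nonpos.2 (F.diss_nonneg t)) le_rfl ht
  have h2 := F.integral_log_le (t := t) (F.temp_pos t)
  have h4 := abs_le.1 (F.abs_moment_le ht)
  simp only [Pi.neg_apply, Pi.zero_apply, intervalIntegral.integral_zero, F.integral_entropy t,
    div_self (F.temp_pos t).ne'] at h1 h2
  rw [← le_log_iff_exp_le (F.temp_pos t)]
  linarith [h4.1]

end StressFreeFlow

lemma rpow_le_one_add {a r : ℝ} (ha : 0 < a) (hr0 : 0 ≤ r) (hr1 : r ≤ 1) : a ^ r ≤ 1 + a := by
  rcases le_total a 1 with h | h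
  · linarith [rpow_le_one ha.le h hr0]
  · calc a ^ r ≤ a ^ (1 : ℝ) := rpow_le_rpow_of_exponent_le h hr1
      _ ≤ 1 + a := by rw [rpow_one]; linarith

lemma sq_rpow_mul_sq_sub_le {a b s : ℝ} (ha : 0 < a) (hb : 0 < b) (hs : 1 ≤ s) :
    (b ^ (s - 1)) ^ 2 * (a - b) ^ 2 ≤ (a ^ s - b ^ s) ^ 2 := by
  have ea : a ^ s = a * a ^ (s - 1) := by rw [mul_comm, ← rpow_add_one ha.ne', sub_add_cancel]
  have eb : b ^ s = b * b ^ (s - 1) := by rw [mul_comm, ← rpow_add_one hb.ne', sub_add_cancel]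
  have hb' : 0 < b ^ (s - 1) := rpow_pos_of_pos hb _
  rw [← mul_pow, ea, eb, sq_le_sq]
  rcases le_total b a with h | h
  · have h1 : b ^ (s - 1) ≤ a ^ (s - 1) := rpow_le_rpow hb.le h (by linarith)
    have h2 := mul_le_mul_of_nonneg_left h1 ha.le
    rw [abs_of_nonneg (mul_nonneg hb'.le (sub_nonneg.2 h))]
    exact le_trans (by linarith) (le_abs_self _)
  · have h1 : a ^ (s - 1) ≤ b ^ (s - 1) := rpow_le_rpow ha.le h (by linarith)
    have h2 := mul_le_mul_of_nonneg_left h1 ha.le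
    rw [abs_of_nonpos (mul_nonpos_of_nonneg_of_nonpos hb'.le (sub_nonpos.2 h))]
    exact le_trans (by linarith) (neg_le_abs _)

namespace StressFreeFlow

variable (F : StressFreeFlow)

lemma exists_sq_sqrt_sub_le : ∃ K > 0, ∀ x ∈ Icc (0:ℝ) 1, ∀ t, 0 ≤ t →
    (√(F.θ (x, t)) - √(F.temp t)) ^ 2 ≤ K * (F.diss t * F.weight t) := by
  obtain ⟨c, hc, hct⟩ := F.exists_le_temp
  set s := max 1 F.β with hs
  have hs1 : 1 ≤ s := le_max_left _ _
  have hsβ : F.β ≤ s := le_max_right _ _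
  have hsβ' : s - F.β ≤ 1 := by
    rw [hs, sub_le_iff_le_add]; exact max_le (by linarith [F.β_pos]) (by linarith)
  have hcs : 0 < c ^ (s - 1) := rpow_pos_of_pos hc _
  refine ⟨(s / 2) ^ 2 / c ^ (s - 1), by positivity, fun x hx t ht => ?_⟩
  obtain ⟨y, hy, hyt⟩ := exists_eq_integral (f := fun x => F.θ (x, t)) (by fun_prop)
  change F.θ (y, t) = F.temp t at hyt
  have key := sq_sub_le_integral_mul_integral (f := fun x => F.θ (x, t) ^ (s / 2))
    (f' := fun x => F.θx (x, t) * (s / 2) * F.θ (x, t) ^ (s / 2 - 1))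
    (b := fun x => F.θ (x, t) ^ F.β * F.θx (x, t) ^ 2 / (F.u (x, t) * F.θ (x, t) ^ 2)
      + F.u (x, t) * F.σ (x, t) ^ 2 / F.θ (x, t))
    (c := fun x => (s / 2) ^ 2 * (F.u (x, t) * (1 + F.θ (x, t))))
    (fun x hx => (F.derivx_θ x hx t ht).rpow_const (Or.inl (F.θ_ne_zero _)))
    (by fun_prop) (by fun_prop (disch := simp)) (by fun_prop)
    (fun x => by have := F.u_pos (x, t); have := F.θ_pos (x, t); positivity)
    (fun x => by have := F.u_pos (x, t); have := F.θ_pos (x, t); positivity)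
    (fun x => by
      have hu := F.u_pos (x, t)
      have hθ := F.θ_pos (x, t)
      set u := F.u (x, t)
      set θ := F.θ (x, t)
      have e1 : (θ ^ (s / 2 - 1)) ^ 2 = θ ^ F.β * θ ^ (s - F.β) / θ ^ 2 := by
        rw [← rpow_natCast, ← rpow_mul hθ.le, ← rpow_add hθ, ← rpow_natCast, ← rpow_sub hθ]
        congr 1
        push_cast
        ring
      have e2 := rpow_le_one_add hθ (sub_nonneg.2 hsβ) hsβ'
      have e3 : 0 ≤ θ ^ F.β * F.θx (x, t) ^ 2 / θ ^ 2 * (s / 2) ^ 2 := by positivity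
      have e4 : 0 ≤ u * F.σ (x, t) ^ 2 / θ * ((s / 2) ^ 2 * (u * (1 + θ))) := by positivity
      calc (F.θx (x, t) * (s / 2) * θ ^ (s / 2 - 1)) ^ 2
          = θ ^ F.β * F.θx (x, t) ^ 2 / θ ^ 2 * (s / 2) ^ 2 * θ ^ (s - F.β) := by
            rw [mul_pow, e1]; ring
        _ ≤ θ ^ F.β * F.θx (x, t) ^ 2 / θ ^ 2 * (s / 2) ^ 2 * (1 + θ) := by gcongr
        _ = θ ^ F.β * F.θx (x, t) ^ 2 / (u * θ ^ 2) * ((s / 2) ^ 2 * (u * (1 + θ))) := by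
            field_simp
        _ ≤ _ := by rw [add_mul]; linarith)
    hx hy
  rw [intervalIntegral.integral_const_mul] at key
  change _ ≤ F.diss t * ((s / 2) ^ 2 * F.weight t) at key
  have hθ := F.θ_pos (x, t)
  have hT := F.temp_pos t
  have h1 := sq_rpow_mul_sq_sub_le (sqrt_pos.2 hθ) (sqrt_pos.2 hT) hs1
  have e (z r : ℝ) (hz : 0 < z) : √z ^ r = z ^ (r / 2) := by
    rw [sqrt_eq_rpow, ← rpow_mul hz.le]; congr 1; ring
  rw [e _ _ hθ, e _ _ hT, e _ _ hT, ← rpow_natCast, ← rpow_mul hT.le] at h1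
  have h2 : c ^ (s - 1) ≤ F.temp t ^ ((s - 1) / 2 * (2 : ℕ)) := by
    rw [show (s - 1) / 2 * (2 : ℕ) = s - 1 by push_cast; ring]
    exact rpow_le_rpow hc.le (hct t ht) (by linarith)
  simp only [hyt] at key
  rw [div_mul_eq_mul_div, le_div_iff₀ hcs]
  have h3 := mul_le_mul_of_nonneg_right h2 (sq_nonneg (√(F.θ (x, t)) - √(F.temp t)))
  linarith

lemma exists_abs_θ_le : ∃ K > 0, ∀ x ∈ Icc (0:ℝ) 1, ∀ t, 0 ≤ t →
    F.θ (x, t) ≤ 2 * F.energy + K * (F.diss t * F.weight t) ∧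
    F.temp t / 2 - K * (F.diss t * F.weight t) ≤ F.θ (x, t) ∧
    (F.θ (x, t) - F.temp t) ^ 2 ≤ K * (F.diss t * F.weight t) * (F.θ (x, t) + F.temp t) := by
  obtain ⟨K, hK, h⟩ := F.exists_sq_sqrt_sub_le
  refine ⟨2 * K, by positivity, fun x hx t ht => ?_⟩
  have h1 := h x hx t ht
  have hE := F.temp_le_energy ht
  have e1 := sq_sqrt (F.θ_pos (x, t)).le
  have e2 := sq_sqrt (F.temp_pos t).le
  set a := √(F.θ (x, t))
  set b := √(F.temp t)
  have hW : 0 ≤ F.diss t * F.weight t := mul_nonneg (F.diss_nonneg t) (F.weight_nonneg t)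
  refine ⟨?_, ?_, ?_⟩
  · nlinarith [sq_nonneg (a - 2 * b)]
  · nlinarith [sq_nonneg (2 * a - b)]
  · rw [← e1, ← e2, show a ^ 2 - b ^ 2 = (a - b) * (a + b) by ring, mul_pow]
    calc (a - b) ^ 2 * (a + b) ^ 2 ≤ K * (F.diss t * F.weight t) * (2 * (a ^ 2 + b ^ 2)) := by
          gcongr
          nlinarith [sq_nonneg (a - b)]
      _ = _ := by ring

/-- Integrated form of the equation for the specific volume. -/
lemma integral_exp_mul_θ {x : ℝ} (hx : x ∈ Icc (0:ℝ) 1) {r t : ℝ} (hr : 0 ≤ r) (hrt : r ≤ t) :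
    ∫ s in r..t, exp (s - ∫ y in (0:ℝ)..x, F.v (y, s)) * F.θ (x, s)
      = exp (t - ∫ y in (0:ℝ)..x, F.v (y, t)) * F.u (x, t)
        - exp (r - ∫ y in (0:ℝ)..x, F.v (y, r)) * F.u (x, r) := by
  have hY : Continuous fun s => ∫ y in (0:ℝ)..x, F.v (y, s) :=
    continuous_integral_left (f := fun y s => F.v (y, s)) (by fun_prop) 0 x
  refine integral_eq_sub_of_hasDerivWithinAt_Icc (c := r) (d := t)
    (f := fun t => exp (t - ∫ y in (0:ℝ)..x, F.v (y, t)) * F.u (x, t))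
    (fun s hs => ?_) (by fun_prop) ⟨le_rfl, hrt⟩ ⟨hrt, le_rfl⟩
  have hs0 : s ∈ Ici (0:ℝ) := hr.trans hs.1
  have h1 := hasDerivWithinAt_integral_param hx (f := fun y s => F.v (y, s))
    (f' := fun y s => F.vt (y, s)) (by fun_prop) (by fun_prop) F.deriv_v hs0
  rw [integral_eq_sub_of_hasDerivWithinAt_Icc (fun y hy => F.derivx_σ y hy s hs0) (by fun_prop)
    ⟨le_rfl, zero_le_one⟩ hx, F.σ_zero s hs0, sub_zero] at h1
  refine HasDerivWithinAt.mono (t := Ici 0) ?_ fun z hz => hr.trans hz.1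
  refine ((((hasDerivWithinAt_id s _).sub h1).exp).mul (F.deriv_u x hx s hs0)).congr_deriv ?_
  simp only [F.vx_eq, Pi.sub_apply, id]
  ring

/-- The specific volume and the weighted mass are bounded uniformly in time. -/
lemma exists_u_le : ∃ M > 0, ∀ x ∈ Icc (0:ℝ) 1, ∀ t, 0 ≤ t →
    F.u (x, t) ≤ M ∧ F.weight t ≤ M := by
  obtain ⟨K, hK, hθ⟩ := F.exists_abs_θ_le
  obtain ⟨I, hI⟩ := F.exists_integral_diss_le
  obtain ⟨U, hU⟩ := (isCompact_Icc (a := (0:ℝ)) (b := 1)).exists_bound_of_continuousOn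
    (f := fun x => F.u (x, 0)) (Continuous.continuousOn (by fun_prop))
  have hE := F.energy_pos
  set b := 1 / 2 + F.energy with hb
  have hU0 : 0 ≤ U := (norm_nonneg _).trans (hU 0 ⟨le_rfl, zero_le_one⟩)
  have hVN : Continuous fun s => F.diss s * F.weight s := by fun_prop
  have hu : ∀ x ∈ Icc (0:ℝ) 1, ∀ t, 0 ≤ t → F.u (x, t)
      ≤ exp (2 * b) * (U + 2 * F.energy + K * ∫ s in (0:ℝ)..t, F.diss s * F.weight s) := by
    intro x hx t ht
    have h1 := F.integral_exp_mul_θ hx le_rfl ht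
    have hY : Continuous fun s => ∫ y in (0:ℝ)..x, F.v (y, s) :=
      continuous_integral_left (f := fun y s => F.v (y, s)) (by fun_prop) 0 x
    have h2 : ∫ s in (0:ℝ)..t, exp (s - ∫ y in (0:ℝ)..x, F.v (y, s)) * F.θ (x, s)
        ≤ ∫ s in (0:ℝ)..t, (exp b * (2 * F.energy) * exp s
          + exp (t + b) * K * (F.diss s * F.weight s)) := by
      refine integral_mono_Icc ht (by fun_prop) (by fun_prop) fun s hs => ?_
      have hv := abs_le.1 (F.abs_integral_v_le hx hs.1)
      have hw : 0 ≤ F.diss s * F.weight s := mul_nonneg (F.diss_nonneg s) (F.weight_nonneg s)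
      calc exp (s - ∫ y in (0:ℝ)..x, F.v (y, s)) * F.θ (x, s)
          ≤ exp (s + b) * (2 * F.energy + K * (F.diss s * F.weight s)) := by
            gcongr
            · exact (F.θ_pos _).le
            · linarith [hv.1]
            · exact (hθ x hx s hs.1).1
        _ = exp b * (2 * F.energy) * exp s + exp (s + b) * K * (F.diss s * F.weight s) := by
            rw [exp_add]; ring
        _ ≤ _ := by gcongr; exact hs.2
    rw [h1, intervalIntegral.integral_add (Continuous.intervalIntegrable (by fun_prop) _ _)
      (Continuous.intervalIntegrable (by fun_prop) _ _), intervalIntegral.integral_const_mul,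
      intervalIntegral.integral_const_mul, integral_exp, exp_zero] at h2
    have hv := abs_le.1 (F.abs_integral_v_le hx ht)
    have hv0 := abs_le.1 (F.abs_integral_v_le hx le_rfl)
    have h3 : exp (t - b) * F.u (x, t)
        ≤ exp (t - ∫ y in (0:ℝ)..x, F.v (y, t)) * F.u (x, t) := by
      gcongr
      · exact (F.u_pos _).le
      · linarith [hv.2]
    have h4 : exp (0 - ∫ y in (0:ℝ)..x, F.v (y, 0)) * F.u (x, 0) ≤ exp b * U * exp t := by
      calc _ ≤ exp b * U := by
            gcongr
            · exact (F.u_pos _).le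
            · linarith [hv0.1]
            · exact (le_abs_self _).trans (hU x hx)
        _ ≤ exp b * U * exp t := le_mul_of_one_le_right (by positivity) (one_le_exp ht)
    have h5 : exp (t - b) * F.u (x, t) ≤ exp (t - b) * (exp (2 * b)
        * (U + 2 * F.energy + K * ∫ s in (0:ℝ)..t, F.diss s * F.weight s)) := by
      rw [← mul_assoc, ← exp_add, show t - b + 2 * b = t + b by ring]
      have : 0 ≤ exp b * (2 * F.energy) := by positivity
      rw [exp_add t b] at h2 ⊢
      linarith
    exact le_of_mul_le_mul_left h5 (exp_pos _)
  set a := exp (2 * b) * (U + 2 * F.energy) * (1 + F.energy) with ha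
  set k := exp (2 * b) * K * (1 + F.energy) with hk
  have hN : ∀ t ∈ Ici (0:ℝ), F.weight t ≤ a + ∫ s in (0:ℝ)..t, k * F.diss s * F.weight s := by
    intro t ht
    set J := ∫ s in (0:ℝ)..t, F.diss s * F.weight s with hJ
    have hJ0 : 0 ≤ J := intervalIntegral.integral_nonneg ht fun s _ =>
      mul_nonneg (F.diss_nonneg s) (F.weight_nonneg s)
    have h1 : F.weight t ≤ ∫ x in (0:ℝ)..1,
        exp (2 * b) * (U + 2 * F.energy + K * J) * (1 + F.θ (x, t)) := by
      refine integral_mono_Icc zero_le_one (by fun_prop) (by fun_prop) fun x hx => ?_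
      have := F.θ_pos (x, t)
      gcongr
      exact hu x hx t ht
    have h2 : ∫ x in (0:ℝ)..1, (1 + F.θ (x, t)) = 1 + F.temp t := by
      rw [intervalIntegral.integral_add (by simp)
        (Continuous.intervalIntegrable (by fun_prop) _ _), temp]
      simp
    have h3 : ∫ s in (0:ℝ)..t, k * F.diss s * F.weight s = k * J := by
      simp_rw [mul_assoc]
      rw [intervalIntegral.integral_const_mul]
    rw [intervalIntegral.integral_const_mul, h2] at h1
    rw [h3]
    calc F.weight t ≤ _ := h1
      _ ≤ exp (2 * b) * (U + 2 * F.energy + K * J) * (1 + F.energy) := by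
        gcongr; exact F.temp_le_energy ht
      _ = _ := by rw [ha, hk]; ring
  have ha0 : 0 ≤ a := by positivity
  have hk0 : 0 ≤ k := by positivity
  set N := a * exp (k * I) with hNdef
  have hN' : ∀ t, 0 ≤ t → F.weight t ≤ N := by
    intro t ht
    have h1 := le_mul_exp_integral_of_le F.continuous_weight
      (V := fun s => k * F.diss s) (by fun_prop) (fun s => mul_nonneg hk0 (F.diss_nonneg s)) hN ht
    rw [intervalIntegral.integral_const_mul] at h1
    exact h1.trans (by rw [hNdef]; gcongr; exact hI t ht)
  have hN0 : 0 ≤ N := by positivity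
  refine ⟨exp (2 * b) * (U + 2 * F.energy + K * (N * |I|)) + N, by positivity,
    fun x hx t ht => ⟨?_, ?_⟩⟩
  · have h1 : ∫ s in (0:ℝ)..t, F.diss s * F.weight s ≤ N * |I| := by
      calc _ ≤ ∫ s in (0:ℝ)..t, N * F.diss s :=
            integral_mono_Icc ht hVN (by fun_prop) fun s hs => by
              rw [mul_comm]
              exact mul_le_mul_of_nonneg_right (hN' s hs.1) (F.diss_nonneg s)
        _ ≤ N * |I| := by
            rw [intervalIntegral.integral_const_mul]
            gcongr
            exact (hI t ht).trans (le_abs_self I)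
    calc F.u (x, t) ≤ _ := hu x hx t ht
      _ ≤ exp (2 * b) * (U + 2 * F.energy + K * (N * |I|)) := by gcongr
      _ ≤ _ := by linarith
  · have : 0 ≤ exp (2 * b) * (U + 2 * F.energy + K * (N * |I|)) := by positivity
    linarith [hN' t ht]

end StressFreeFlow

lemma exists_forall_integral_le_of_bounded {V : ℝ → ℝ} {K δ : ℝ} (hV : Continuous V)
    (hK : ∀ t, 0 ≤ t → ∫ s in (0:ℝ)..t, V s ≤ K) (hδ : 0 < δ) :
    ∃ r, 0 ≤ r ∧ ∀ t, r ≤ t → ∫ s in r..t, V s ≤ δ := by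
  set S := (fun t => ∫ s in (0:ℝ)..t, V s) '' Ici 0 with hS
  have hne : S.Nonempty := ⟨_, 0, self_mem_Ici, rfl⟩
  have hbd : BddAbove S := ⟨K, by rintro _ ⟨t, ht, rfl⟩; exact hK t ht⟩
  obtain ⟨_, ⟨r, hr, rfl⟩, h⟩ := exists_lt_of_lt_csSup hne (sub_lt_self (sSup S) hδ)
  refine ⟨r, hr, fun t ht => ?_⟩
  have h1 := le_csSup hbd ⟨t, (show t ∈ Ici (0:ℝ) from le_trans hr ht), rfl⟩
  have h2 := intervalIntegral.integral_add_adjacent_intervals (μ := volume)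
    (hV.intervalIntegrable 0 r) (hV.intervalIntegrable r t)
  dsimp only at h h1
  linarith

namespace StressFreeFlow

variable (F : StressFreeFlow)

/-- The specific volume is bounded away from zero uniformly in time. -/
lemma exists_le_u : ∃ m > 0, ∀ x ∈ Icc (0:ℝ) 1, ∀ t, 0 ≤ t → m ≤ F.u (x, t) := by
  obtain ⟨c, hc, hct⟩ := F.exists_le_temp
  obtain ⟨K, hK, hθ⟩ := F.exists_abs_θ_le
  obtain ⟨M, hM, huM⟩ := F.exists_u_le
  obtain ⟨I, hI⟩ := F.exists_integral_diss_le
  obtain ⟨r, hr, hrt⟩ := exists_forall_integral_le_of_bounded F.continuous_diss hI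
    (δ := c / (8 * (K * M))) (by positivity)
  set b := 1 / 2 + F.energy with hb
  have hlate : ∀ x ∈ Icc (0:ℝ) 1, ∀ t, r + 1 ≤ t → exp (-(2 * b)) * (c / 8) ≤ F.u (x, t) := by
    intro x hx t ht
    have hrt' : r ≤ t := by linarith
    have h1 := F.integral_exp_mul_θ hx hr hrt'
    have hY : Continuous fun s => ∫ y in (0:ℝ)..x, F.v (y, s) :=
      continuous_integral_left (f := fun y s => F.v (y, s)) (by fun_prop) 0 x
    have h2 : ∫ s in r..t, (exp (-b) * (c / 2) * exp s - exp (t - b) * (K * M) * F.diss s)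
        ≤ ∫ s in r..t, exp (s - ∫ y in (0:ℝ)..x, F.v (y, s)) * F.θ (x, s) := by
      refine integral_mono_Icc hrt' (by fun_prop) (by fun_prop) fun s hs => ?_
      have hs0 : 0 ≤ s := hr.trans hs.1
      have hv := abs_le.1 (F.abs_integral_v_le hx hs0)
      have hd := F.diss_nonneg s
      have h3 : c / 2 - K * M * F.diss s ≤ F.θ (x, s) := by
        have e1 := (hθ x hx s hs0).2.1
        have e2 := mul_le_mul_of_nonneg_left
          (mul_le_mul_of_nonneg_left (huM x hx s hs0).2 hd) hK.le
        linarith [hct s hs0]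
      calc exp (-b) * (c / 2) * exp s - exp (t - b) * (K * M) * F.diss s
          ≤ exp (-b) * (c / 2) * exp s - exp (s - b) * (K * M) * F.diss s := by
            gcongr; exact hs.2
        _ = exp (s - b) * (c / 2 - K * M * F.diss s) := by
            rw [sub_eq_add_neg s b, exp_add]; ring
        _ ≤ exp (s - b) * F.θ (x, s) := by gcongr
        _ ≤ _ := by
            gcongr
            · exact (F.θ_pos _).le
            · linarith [hv.2]
    rw [h1, intervalIntegral.integral_sub (Continuous.intervalIntegrable (by fun_prop) _ _)
      (Continuous.intervalIntegrable (by fun_prop) _ _), intervalIntegral.integral_const_mul,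
      intervalIntegral.integral_const_mul, integral_exp] at h2
    have hv := abs_le.1 (F.abs_integral_v_le hx (hr.trans hrt'))
    have h3 : exp (t - ∫ y in (0:ℝ)..x, F.v (y, t)) * F.u (x, t) ≤ exp (t + b) * F.u (x, t) := by
      gcongr
      · exact (F.u_pos _).le
      · linarith [hv.1]
    have h4 : 0 ≤ exp (r - ∫ y in (0:ℝ)..x, F.v (y, r)) * F.u (x, r) :=
      mul_nonneg (exp_pos _).le (F.u_pos _).le
    have h5 : exp (t - b) * (K * M) * ∫ s in r..t, F.diss s ≤ exp (t - b) * (c / 8) := by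
      calc _ ≤ exp (t - b) * (K * M) * (c / (8 * (K * M))) := by gcongr; exact hrt t hrt'
        _ = _ := by field_simp
    have h6 : 2 * exp r ≤ exp t := by
      calc 2 * exp r ≤ exp 1 * exp r := by
            gcongr
            linarith [add_one_le_exp (1:ℝ)]
        _ = exp (r + 1) := by rw [← exp_add, add_comm]
        _ ≤ exp t := exp_le_exp.2 ht
    have h7 : exp (-b) * (c / 2) * exp r ≤ exp (t - b) * (c / 4) := by
      rw [sub_eq_add_neg t b, exp_add]
      have := mul_le_mul_of_nonneg_left h6 (mul_nonneg (exp_pos (-b)).le (half_pos hc).le)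
      linarith
    have h8 : exp (-b) * (c / 2) * exp t = exp (t - b) * (c / 2) := by
      rw [sub_eq_add_neg t b, exp_add]; ring
    have h9 : exp (t + b) * (exp (-(2 * b)) * (c / 8)) ≤ exp (t + b) * F.u (x, t) := by
      rw [← mul_assoc, ← exp_add, show t + b + -(2 * b) = t - b by ring]
      linarith
    exact le_of_mul_le_mul_left h9 (exp_pos _)
  obtain ⟨p, -, hp⟩ := (isCompact_Icc.prod isCompact_Icc).exists_isMinOn
    (s := Icc (0:ℝ) 1 ×ˢ Icc (0:ℝ) (r + 1))
    ⟨(0, 0), ⟨le_rfl, zero_le_one⟩, le_rfl, by linarith⟩ F.u.continuous.continuousOn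
  refine ⟨min (F.u p) (exp (-(2 * b)) * (c / 8)), lt_min (F.u_pos p) (by positivity),
    fun x hx t ht => ?_⟩
  rcases le_total t (r + 1) with h | h
  · exact (min_le_left _ _).trans (hp (show (x, t) ∈ _ from ⟨hx, ht, h⟩))
  · exact (min_le_right _ _).trans (hlate x hx t h)

lemma exists_integral_sq_sub_temp_le : ∃ C > 0, ∀ t, 0 ≤ t →
    ∫ x in (0:ℝ)..1, (F.θ (x, t) - F.temp t) ^ 2 ≤ C * F.diss t := by
  obtain ⟨K, hK, hθ⟩ := F.exists_abs_θ_le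
  obtain ⟨M, hM, huM⟩ := F.exists_u_le
  have hE := F.energy_pos
  refine ⟨K * M * (2 * F.energy), by positivity, fun t ht => ?_⟩
  have hd := F.diss_nonneg t
  calc ∫ x in (0:ℝ)..1, (F.θ (x, t) - F.temp t) ^ 2
      ≤ ∫ x in (0:ℝ)..1, K * (F.diss t * M) * (F.θ (x, t) + F.temp t) := by
        refine integral_mono_Icc zero_le_one (by fun_prop) (by fun_prop) fun x hx => ?_
        have := F.θ_pos (x, t)
        have := F.temp_pos t
        refine (hθ x hx t ht).2.2.trans ?_
        gcongr
        exact (huM x hx t ht).2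
    _ = K * (F.diss t * M) * (F.temp t + F.temp t) := by
        rw [intervalIntegral.integral_const_mul, intervalIntegral.integral_add
          (Continuous.intervalIntegrable (by fun_prop) _ _) (by simp)]
        simp [temp]
    _ ≤ K * (F.diss t * M) * (F.energy + F.energy) := by
        gcongr <;> exact F.temp_le_energy ht
    _ = _ := by ring

lemma hasDerivWithinAt_moment {t : ℝ} (ht : t ∈ Ici (0:ℝ)) :
    HasDerivWithinAt F.moment (∫ x in (0:ℝ)..1, F.σ (x, t)) (Ici 0) t := by
  have h1 := hasDerivWithinAt_integral_param (a := 1) ⟨zero_le_one, le_rfl⟩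
    (f := fun x s => (1 - x) * F.v (x, s)) (f' := fun x s => (1 - x) * F.vt (x, s))
    (by fun_prop) (by fun_prop) (fun x hx s hs => (F.deriv_v x hx s hs).const_mul (1 - x)) ht
  refine h1.congr_deriv ?_
  have h2 := integral_eq_sub_of_hasDerivWithinAt_Icc (a := 0) (b := 1)
    (f := fun y => (1 - y) * F.σ (y, t))
    (f' := fun x => -1 * F.σ (x, t) + (1 - x) * F.vt (x, t))
    (fun x hx => ((hasDerivWithinAt_id x _).const_sub 1).mul (F.derivx_σ x hx t ht))
    (by fun_prop) ⟨le_rfl, zero_le_one⟩ ⟨zero_le_one, le_rfl⟩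
  rw [intervalIntegral.integral_add (Continuous.intervalIntegrable (by fun_prop) _ _)
    (Continuous.intervalIntegrable (by fun_prop) _ _), intervalIntegral.integral_const_mul] at h2
  simp only [F.σ_zero t ht] at h2
  linarith

lemma hasDerivWithinAt_temp {t : ℝ} (ht : t ∈ Ici (0:ℝ)) :
    HasDerivWithinAt F.temp (∫ x in (0:ℝ)..1, F.σ (x, t) * F.vx (x, t)) (Ici 0) t := by
  refine (hasDerivWithinAt_integral_param (a := 1) ⟨zero_le_one, le_rfl⟩
    (f := fun x s => F.θ (x, s)) (f' := fun x s => F.θt (x, s))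
    (by fun_prop) (by fun_prop) F.deriv_θ ht).congr_deriv ?_
  have h2 := integral_eq_sub_of_hasDerivWithinAt_Icc (a := 0) (b := 1)
    (fun x hx => F.derivx_q x hx t ht) (by fun_prop) ⟨le_rfl, zero_le_one⟩ ⟨zero_le_one, le_rfl⟩
  rw [intervalIntegral.integral_sub (Continuous.intervalIntegrable (by fun_prop) _ _)
    (Continuous.intervalIntegrable (by fun_prop) _ _), F.q_zero t ht, F.q_one t ht] at h2
  linarith

/-- The square norm of the stress is integrable in time. -/
lemma exists_integral_stress_le : ∃ K, ∀ t, 0 ≤ t → ∫ s in (0:ℝ)..t, F.stress s ≤ K := by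
  obtain ⟨C, hC, hθ⟩ := F.exists_integral_sq_sub_temp_le
  obtain ⟨m, hm, hu⟩ := F.exists_le_u
  obtain ⟨I, hI⟩ := F.exists_integral_diss_le
  set b := 1 / 2 + F.energy with hb
  have hE := F.energy_pos
  have hderiv : ∀ t ∈ Ici (0:ℝ), HasDerivWithinAt (fun s => -(exp (-F.moment s) * F.temp s))
      (-(exp (-F.moment t) * ∫ x in (0:ℝ)..1,
        F.σ (x, t) * (F.u (x, t) * F.σ (x, t) + (F.θ (x, t) - F.temp t)))) (Ici 0) t := by
    intro t ht
    refine (((F.hasDerivWithinAt_moment ht).neg.exp).mul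
      (F.hasDerivWithinAt_temp ht)).neg.congr_deriv ?_
    have : ∫ x in (0:ℝ)..1, F.σ (x, t) * (F.u (x, t) * F.σ (x, t) + (F.θ (x, t) - F.temp t))
        = (∫ x in (0:ℝ)..1, F.σ (x, t) * F.vx (x, t))
          - F.temp t * ∫ x in (0:ℝ)..1, F.σ (x, t) := by
      rw [← intervalIntegral.integral_const_mul, ← intervalIntegral.integral_sub
        (Continuous.intervalIntegrable (by fun_prop) _ _)
        (Continuous.intervalIntegrable (by fun_prop) _ _)]
      exact intervalIntegral.integral_congr fun x _ => by simp only [F.vx_eq]; ring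
    rw [this]
    simp only [Pi.neg_apply]
    ring
  have hbound : ∀ t ∈ Ici (0:ℝ), -(exp (-F.moment t) * ∫ x in (0:ℝ)..1,
        F.σ (x, t) * (F.u (x, t) * F.σ (x, t) + (F.θ (x, t) - F.temp t)))
      ≤ exp b * (C / (2 * m)) * F.diss t - exp (-b) / 2 * F.stress t := by
    intro t ht
    have hM := abs_le.1 (F.abs_moment_le ht)
    have h1 : ∫ x in (0:ℝ)..1, (1 / 2 * (F.u (x, t) * F.σ (x, t) ^ 2)
          - 1 / (2 * m) * (F.θ (x, t) - F.temp t) ^ 2)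
        ≤ ∫ x in (0:ℝ)..1,
          F.σ (x, t) * (F.u (x, t) * F.σ (x, t) + (F.θ (x, t) - F.temp t)) := by
      refine integral_mono_Icc zero_le_one (by fun_prop) (by fun_prop) fun x hx => ?_
      have h2 := hu x hx t ht
      set σ := F.σ (x, t)
      set u := F.u (x, t)
      set w := F.θ (x, t) - F.temp t
      have h3 : m * σ ^ 2 ≤ u * σ ^ 2 := by gcongr
      have h4 : 0 ≤ 1 / (2 * m) * (m * σ + w) ^ 2 := by positivity
      have h5 : 1 / (2 * m) * (m * σ + w) ^ 2
          = m * σ ^ 2 / 2 + σ * w + 1 / (2 * m) * w ^ 2 := by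
        field_simp; ring
      nlinarith
    rw [intervalIntegral.integral_sub (Continuous.intervalIntegrable (by fun_prop) _ _)
      (Continuous.intervalIntegrable (by fun_prop) _ _), intervalIntegral.integral_const_mul,
      intervalIntegral.integral_const_mul] at h1
    change 1 / 2 * F.stress t - _ ≤ _ at h1
    have h2 : 1 / (2 * m) * ∫ x in (0:ℝ)..1, (F.θ (x, t) - F.temp t) ^ 2
        ≤ C / (2 * m) * F.diss t := by
      calc _ ≤ 1 / (2 * m) * (C * F.diss t) := by gcongr; exact hθ t ht
        _ = _ := by ring
    have h3 : exp (-b) * F.stress t ≤ exp (-F.moment t) * F.stress t := by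
      have := F.stress_nonneg t
      gcongr
      exact hM.2
    have h4 : exp (-F.moment t) * (C / (2 * m) * F.diss t) ≤ exp b * (C / (2 * m) * F.diss t) := by
      have := F.diss_nonneg t
      gcongr
      linarith [hM.1]
    have h5 := mul_le_mul_of_nonneg_left (h1.trans' (sub_le_sub_left h2 _))
      (exp_pos (-F.moment t)).le
    linarith
  refine ⟨2 * exp b * (exp b * F.energy + exp b * (C / (2 * m)) * |I|), fun t ht => ?_⟩
  have h1 := sub_le_integral_of_hasDerivWithinAt_Ici hderiv (by fun_prop) hbound le_rfl ht
  rw [intervalIntegral.integral_sub (Continuous.intervalIntegrable (by fun_prop) _ _)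
    (Continuous.intervalIntegrable (by fun_prop) _ _), intervalIntegral.integral_const_mul,
    intervalIntegral.integral_const_mul] at h1
  have h2 : exp (-F.moment t) * F.temp t ≤ exp b * F.energy := by
    have := F.temp_le_energy ht
    gcongr
    · exact (F.temp_pos t).le
    · linarith [(abs_le.1 (F.abs_moment_le ht)).1]
  have h3 : 0 ≤ exp (-F.moment 0) * F.temp 0 := mul_nonneg (exp_pos _).le (F.temp_pos 0).le
  have h4 : exp b * (C / (2 * m)) * ∫ s in (0:ℝ)..t, F.diss s
      ≤ exp b * (C / (2 * m)) * |I| := by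
    gcongr
    exact (hI t ht).trans (le_abs_self I)
  have h5 : exp (-b) * ∫ s in (0:ℝ)..t, F.stress s
      ≤ exp (-b) * (2 * exp b * (exp b * F.energy + exp b * (C / (2 * m)) * |I|)) := by
    have : exp (-b) * (2 * exp b * (exp b * F.energy + exp b * (C / (2 * m)) * |I|))
        = 2 * (exp b * F.energy + exp b * (C / (2 * m)) * |I|) := by
      rw [← mul_assoc, ← mul_assoc, mul_comm (exp (-b)) 2, mul_assoc 2, ← exp_add]
      simp
    rw [this]
    linarith
  exact le_of_mul_le_mul_left h5 (exp_pos _)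

/-- The excess of the `β + 2` moment of the temperature over that of its mean. -/
noncomputable def excess (t : ℝ) : ℝ :=
  (∫ x in (0:ℝ)..1, F.θ (x, t) ^ (F.β + 2)) - F.temp t ^ (F.β + 2)

lemma hasDerivWithinAt_excess {t : ℝ} (ht : t ∈ Ici (0:ℝ)) :
    HasDerivWithinAt F.excess ((F.β + 2) * ((∫ x in (0:ℝ)..1,
        (F.θ (x, t) ^ (F.β + 1) - F.temp t ^ (F.β + 1)) * (F.σ (x, t) * F.vx (x, t)))
      - (F.β + 1) * ∫ x in (0:ℝ)..1,
        F.θ (x, t) ^ (2 * F.β) * F.θx (x, t) ^ 2 / F.u (x, t))) (Ici 0) t := by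
  have h1 := hasDerivWithinAt_integral_param (a := 1) ⟨zero_le_one, le_rfl⟩
    (f := fun x s => F.θ (x, s) ^ (F.β + 2))
    (f' := fun x s => (F.β + 2) * (F.θ (x, s) ^ (F.β + 1) * F.θt (x, s)))
    (by fun_prop) (by fun_prop)
    (fun x hx s hs => ((F.deriv_θ x hx s hs).rpow_const (Or.inl (F.θ_ne_zero _))).congr_deriv
      (by rw [show F.β + 2 - 1 = F.β + 1 by ring]; ring)) ht
  have h2 := (F.hasDerivWithinAt_temp ht).rpow_const (p := F.β + 2) (Or.inl (F.temp_pos t).ne')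
  refine (h1.sub h2).congr_deriv ?_
  have h3 := integral_eq_sub_of_hasDerivWithinAt_Icc (a := 0) (b := 1)
    (f := fun y => (F.θ (y, t) ^ (F.β + 1)) * F.q (y, t))
    (f' := fun x => F.θx (x, t) * (F.β + 1) * F.θ (x, t) ^ F.β * F.q (x, t)
      + F.θ (x, t) ^ (F.β + 1) * (F.θt (x, t) - F.σ (x, t) * F.vx (x, t)))
    (fun x hx => (((F.derivx_θ x hx t ht).rpow_const (Or.inl (F.θ_ne_zero _))).congr_deriv
      (by rw [add_sub_cancel_right])).mul (F.derivx_q x hx t ht)) (by fun_prop)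
    ⟨le_rfl, zero_le_one⟩ ⟨zero_le_one, le_rfl⟩
  simp only [F.q_zero t ht, F.q_one t ht, mul_zero, sub_self] at h3
  rw [show F.β + 2 - 1 = F.β + 1 by ring, ← intervalIntegral.integral_const_mul,
    intervalIntegral.integral_const_mul, mul_assoc, mul_comm (∫ x in (0:ℝ)..1, _), mul_assoc,
    ← mul_sub, ← intervalIntegral.integral_const_mul, ← intervalIntegral.integral_sub
      (Continuous.intervalIntegrable (by fun_prop) _ _)
      (Continuous.intervalIntegrable (by fun_prop) _ _),
    ← intervalIntegral.integral_sub
      (Continuous.intervalIntegrable (by fun_prop) _ _)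
      (Continuous.intervalIntegrable (by fun_prop (disch := simp)) _ _)]
  congr 1
  rw [← sub_eq_zero, ← intervalIntegral.integral_sub
      (Continuous.intervalIntegrable (by fun_prop) _ _)
      (Continuous.intervalIntegrable (by fun_prop (disch := simp)) _ _)]
  refine (intervalIntegral.integral_congr fun x _ => ?_).trans h3
  have h4 : F.θ (x, t) ^ (2 * F.β) = F.θ (x, t) ^ F.β * F.θ (x, t) ^ F.β := by
    rw [← rpow_add (F.θ_pos _)]; congr 1; ring
  simp only [F.q_eq, h4]
  ring

lemma sq_rpow_sub_le {x t : ℝ} (hx : x ∈ Icc (0:ℝ) 1) (ht : 0 ≤ t) :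
    (F.θ (x, t) ^ (F.β + 1) - F.temp t ^ (F.β + 1)) ^ 2 ≤ (F.β + 1) ^ 2 * F.heat t := by
  obtain ⟨y, hy, hyt⟩ := exists_eq_integral (f := fun x => F.θ (x, t)) (by fun_prop)
  change F.θ (y, t) = F.temp t at hyt
  have key := sq_sub_le_integral_mul_integral (f := fun x => F.θ (x, t) ^ (F.β + 1))
    (f' := fun x => F.θx (x, t) * (F.β + 1) * F.θ (x, t) ^ (F.β + 1 - 1))
    (b := fun x => F.θ (x, t) ^ (2 * F.β) * F.θx (x, t) ^ 2)
    (c := fun _ => (F.β + 1) ^ 2)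
    (fun x hx => (F.derivx_θ x hx t ht).rpow_const (Or.inl (F.θ_ne_zero _)))
    (by fun_prop) (by fun_prop) (by fun_prop)
    (fun x => by have := F.θ_pos (x, t); positivity) (fun x => by positivity)
    (fun x => le_of_eq (by
      have h4 : F.θ (x, t) ^ (2 * F.β) = F.θ (x, t) ^ F.β * F.θ (x, t) ^ F.β := by
        rw [← rpow_add (F.θ_pos _)]; congr 1; ring
      rw [add_sub_cancel_right, h4]
      ring)) hx hy
  simp only [hyt] at key
  rw [mul_comm]
  simpa [heat] using key

lemma exists_integral_sq_vx_div_le : ∃ C > 0, ∀ t, 0 ≤ t →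
    ∫ x in (0:ℝ)..1, F.vx (x, t) ^ 2 / F.u (x, t) ≤ C * (1 + F.stress t + F.diss t) := by
  obtain ⟨C, hC, hθ⟩ := F.exists_integral_sq_sub_temp_le
  obtain ⟨m, hm, hu⟩ := F.exists_le_u
  have hE := F.energy_pos
  refine ⟨2 + 4 / m * C + 4 / m * F.energy ^ 2, by positivity, fun t ht => ?_⟩
  have hX := F.stress_nonneg t
  have hV := F.diss_nonneg t
  have hT := F.temp_pos t
  have hTE := F.temp_le_energy ht
  calc ∫ x in (0:ℝ)..1, F.vx (x, t) ^ 2 / F.u (x, t)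
      ≤ ∫ x in (0:ℝ)..1, (2 * (F.u (x, t) * F.σ (x, t) ^ 2)
        + (4 / m * (F.θ (x, t) - F.temp t) ^ 2 + 4 / m * F.temp t ^ 2)) := by
        refine integral_mono_Icc zero_le_one (by fun_prop (disch := simp)) (by fun_prop)
          fun x hx => ?_
        have h1 := hu x hx t ht
        have h2 := F.u_pos (x, t)
        rw [F.vx_eq]
        set σ := F.σ (x, t)
        set u := F.u (x, t)
        set θ := F.θ (x, t)
        set T := F.temp t
        calc (u * σ + θ) ^ 2 / u ≤ (2 * (u * σ) ^ 2 + 2 * θ ^ 2) / u := by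
              gcongr
              nlinarith [sq_nonneg (u * σ - θ)]
          _ = 2 * (u * σ ^ 2) + 2 * θ ^ 2 / u := by field_simp
          _ ≤ 2 * (u * σ ^ 2) + 2 * θ ^ 2 / m := by gcongr
          _ ≤ 2 * (u * σ ^ 2) + 2 * (2 * (θ - T) ^ 2 + 2 * T ^ 2) / m := by
              gcongr
              nlinarith [sq_nonneg (θ - 2 * T)]
          _ = _ := by ring
    _ = 2 * F.stress t + (4 / m * (∫ x in (0:ℝ)..1, (F.θ (x, t) - F.temp t) ^ 2)
        + 4 / m * F.temp t ^ 2) := by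
        rw [intervalIntegral.integral_add, intervalIntegral.integral_add,
          intervalIntegral.integral_const_mul, intervalIntegral.integral_const_mul]
        · simp [stress]
        all_goals exact Continuous.intervalIntegrable (by fun_prop) _ _
    _ ≤ 2 * F.stress t + (4 / m * (C * F.diss t) + 4 / m * F.energy ^ 2) := by
        gcongr
        exact hθ t ht
    _ ≤ _ := by
        have h1 : 0 ≤ 2 + 2 * F.diss t := by positivity
        have h2 : 0 ≤ 4 / m * C * (1 + F.stress t) := by positivity
        have h3 : 0 ≤ 4 / m * F.energy ^ 2 * (F.stress t + F.diss t) := by positivity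
        linarith

lemma exists_deriv_excess_le : ∃ c > 0, ∃ C > 0, ∃ Y' : ℝ → ℝ, ∀ t ∈ Ici (0:ℝ),
    HasDerivWithinAt F.excess (Y' t) (Ici 0) t ∧
    Y' t ≤ C * F.stress t * (1 + F.stress t + F.diss t) - c * F.heat t := by
  obtain ⟨M, hM, hu⟩ := F.exists_u_le
  obtain ⟨C, hC, hvx⟩ := F.exists_integral_sq_vx_div_le
  have hβ := F.β_pos
  refine ⟨(F.β + 2) * ((F.β + 1) / (2 * M)), by positivity,
    (F.β + 2) * (M * (F.β + 1) / 2 * C), by positivity, _,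
    fun t ht => ⟨F.hasDerivWithinAt_excess ht, ?_⟩⟩
  have hX := F.stress_nonneg t
  have hV := F.diss_nonneg t
  have hD := F.heat_nonneg t
  have h1 : F.heat t / M
      ≤ ∫ x in (0:ℝ)..1, F.θ (x, t) ^ (2 * F.β) * F.θx (x, t) ^ 2 / F.u (x, t) := by
    rw [heat, ← intervalIntegral.integral_div]
    refine integral_mono_Icc zero_le_one (by fun_prop (disch := simp))
      (by fun_prop (disch := simp)) fun x hx => ?_
    have := F.θ_pos (x, t)
    have := F.u_pos (x, t)
    gcongr
    exact (hu x hx t ht).1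
  set g : ℝ → ℝ := fun x => F.θ (x, t) ^ (F.β + 1) - F.temp t ^ (F.β + 1) with hg
  have hgc : Continuous g := by fun_prop
  have h2 := sq_integral_le_mul (f := fun x => g x * (F.σ (x, t) * F.vx (x, t)))
    (b := fun x => F.u (x, t) * F.σ (x, t) ^ 2)
    (c := fun x => g x ^ 2 * (F.vx (x, t) ^ 2 / F.u (x, t))) (by fun_prop) (by fun_prop)
    (by fun_prop (disch := simp))
    (fun x => by have := F.u_pos (x, t); positivity)
    (fun x => by have := F.u_pos (x, t); positivity)
    (fun x => le_of_eq (by field_simp))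
  have h3 : ∫ x in (0:ℝ)..1, g x ^ 2 * (F.vx (x, t) ^ 2 / F.u (x, t))
      ≤ (F.β + 1) ^ 2 * F.heat t * (C * (1 + F.stress t + F.diss t)) := by
    calc _ ≤ ∫ x in (0:ℝ)..1, (F.β + 1) ^ 2 * F.heat t * (F.vx (x, t) ^ 2 / F.u (x, t)) := by
          refine integral_mono_Icc zero_le_one (by fun_prop (disch := simp))
            (by fun_prop (disch := simp)) fun x hx => ?_
          have := F.u_pos (x, t)
          gcongr
          exact F.sq_rpow_sub_le hx ht
      _ ≤ _ := by
          rw [intervalIntegral.integral_const_mul]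
          gcongr
          exact hvx t ht
  set a := ∫ x in (0:ℝ)..1, g x * (F.σ (x, t) * F.vx (x, t))
  set Q := F.stress t * (C * (1 + F.stress t + F.diss t)) with hQ
  have hQ0 : 0 ≤ Q := by positivity
  have h4 : a ^ 2 ≤ (F.β + 1) ^ 2 * F.heat t * Q := by
    refine h2.trans ((mul_le_mul_of_nonneg_left h3 hX).trans (le_of_eq ?_))
    rw [hQ]; ring
  have h5 : a ≤ (F.β + 1) / (2 * M) * F.heat t + M * (F.β + 1) / 2 * Q := by
    refine (le_abs_self a).trans (abs_le_of_sq_le_sq (h4.trans ?_) (by positivity))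
    have h6 : (F.β + 1) ^ 2 * F.heat t * Q
        = 4 * ((F.β + 1) / (2 * M) * F.heat t) * (M * (F.β + 1) / 2 * Q) := by field_simp; ring
    rw [h6]
    nlinarith [sq_nonneg ((F.β + 1) / (2 * M) * F.heat t - M * (F.β + 1) / 2 * Q)]
  have h7 : (F.β + 1) * (F.heat t / M) = 2 * ((F.β + 1) / (2 * M) * F.heat t) := by field_simp
  have h8 := mul_le_mul_of_nonneg_left h1 (by positivity : 0 ≤ F.β + 1)
  calc _ ≤ (F.β + 2) * (M * (F.β + 1) / 2 * Q - (F.β + 1) / (2 * M) * F.heat t) := by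
        refine mul_le_mul_of_nonneg_left ?_ (by positivity)
        linarith
    _ = _ := by rw [hQ]; ring

lemma stress_sub_stress {s t : ℝ} (hs : s ∈ Ici (0:ℝ)) (ht : t ∈ Ici (0:ℝ)) :
    F.stress s - F.stress t
      = -(∫ x in (0:ℝ)..1, (F.v (x, s) - F.v (x, t)) * (F.vt (x, s) + F.vt (x, t)))
        - (∫ x in (0:ℝ)..1, (F.θ (x, s) - F.θ (x, t)) * (F.σ (x, s) + F.σ (x, t)))
        - ∫ x in (0:ℝ)..1, (F.u (x, s) - F.u (x, t)) * (F.σ (x, s) * F.σ (x, t)) := by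
  have h := integral_eq_sub_of_hasDerivWithinAt_Icc (a := 0) (b := 1)
    (f := fun y => (F.v (y, s) - F.v (y, t)) * (F.σ (y, s) + F.σ (y, t)))
    (f' := fun x => (F.vx (x, s) - F.vx (x, t)) * (F.σ (x, s) + F.σ (x, t))
      + (F.v (x, s) - F.v (x, t)) * (F.vt (x, s) + F.vt (x, t)))
    (fun x hx => ((F.derivx_v x hx s hs).sub (F.derivx_v x hx t ht)).mul
      ((F.derivx_σ x hx s hs).add (F.derivx_σ x hx t ht))) (by fun_prop)
    ⟨le_rfl, zero_le_one⟩ ⟨zero_le_one, le_rfl⟩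
  simp only [F.σ_zero t ht, F.σ_one t ht, F.σ_zero s hs, F.σ_one s hs, add_zero, mul_zero,
    sub_zero] at h
  rw [stress, stress, ← sub_eq_zero, ← intervalIntegral.integral_neg,
    ← intervalIntegral.integral_sub, ← intervalIntegral.integral_sub,
    ← intervalIntegral.integral_sub, ← intervalIntegral.integral_sub]
  · refine (intervalIntegral.integral_congr fun x _ => ?_).trans h
    simp only [F.vx_eq]
    ring
  all_goals exact Continuous.intervalIntegrable (by fun_prop) _ _

lemma hasDerivWithinAt_stress {t : ℝ} (ht : t ∈ Ici (0:ℝ)) :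
    HasDerivWithinAt F.stress (∫ x in (0:ℝ)..1, (-2 * F.vt (x, t) ^ 2
      - 3 * (F.σ (x, t) ^ 2 * F.vx (x, t)) + 2 * (F.q (x, t) * F.vt (x, t))
      + F.u (x, t) * F.σ (x, t) ^ 2)) (Ici 0) t := by
  have h1 := hasDerivWithinAt_integral_mul_of_eq_zero
    (k := fun x s => F.v (x, s) - F.v (x, t)) (k' := fun x s => F.vt (x, s))
    (m := fun x s => F.vt (x, s) + F.vt (x, t)) (by fun_prop) (by fun_prop) (by fun_prop)
    (fun x hx s hs => (F.deriv_v x hx s hs).sub_const _) ht (fun x hx => sub_self _)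
  have h2 := hasDerivWithinAt_integral_mul_of_eq_zero
    (k := fun x s => F.θ (x, s) - F.θ (x, t)) (k' := fun x s => F.θt (x, s))
    (m := fun x s => F.σ (x, s) + F.σ (x, t)) (by fun_prop) (by fun_prop) (by fun_prop)
    (fun x hx s hs => (F.deriv_θ x hx s hs).sub_const _) ht (fun x hx => sub_self _)
  have h3 := hasDerivWithinAt_integral_mul_of_eq_zero
    (k := fun x s => F.u (x, s) - F.u (x, t)) (k' := fun x s => F.vx (x, s) - F.u (x, s))
    (m := fun x s => F.σ (x, s) * F.σ (x, t)) (by fun_prop) (by fun_prop) (by fun_prop)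
    (fun x hx s hs => (F.deriv_u x hx s hs).sub_const _) ht (fun x hx => sub_self _)
  have h4 := (((h1.neg.sub h2).sub h3).add_const (F.stress t)).congr_of_mem
    (f₁ := F.stress) (fun s hs => by
      rw [← sub_eq_iff_eq_add, F.stress_sub_stress hs ht]; rfl) ht
  refine h4.congr_deriv ?_
  have h5 := integral_eq_sub_of_hasDerivWithinAt_Icc (a := 0) (b := 1)
    (f := fun y => -2 * (F.σ (y, t) * F.q (y, t)))
    (f' := fun x => -2 * (F.vt (x, t) * F.q (x, t)
      + F.σ (x, t) * (F.θt (x, t) - F.σ (x, t) * F.vx (x, t))))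
    (fun x hx => ((F.derivx_σ x hx t ht).mul (F.derivx_q x hx t ht)).const_mul (-2)) (by fun_prop)
    ⟨le_rfl, zero_le_one⟩ ⟨zero_le_one, le_rfl⟩
  simp only [F.σ_zero t ht, F.σ_one t ht, zero_mul, mul_zero, sub_zero] at h5
  rw [← sub_eq_zero, ← intervalIntegral.integral_neg,
    ← intervalIntegral.integral_sub, ← intervalIntegral.integral_sub,
    ← intervalIntegral.integral_sub]
  · refine (intervalIntegral.integral_congr fun x _ => ?_).trans h5
    ring
  all_goals exact Continuous.intervalIntegrable (by fun_prop) _ _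

lemma exists_deriv_stress_le : ∃ m > 0, ∃ X' : ℝ → ℝ, ∀ t ∈ Ici (0:ℝ),
    HasDerivWithinAt F.stress (X' t) (Ici 0) t ∧
    X' t ≤ 9 / 4 * F.stress t ^ 2 + F.stress t + F.heat t / m := by
  obtain ⟨m, hm, hu⟩ := F.exists_le_u
  refine ⟨m ^ 2, by positivity, _, fun t ht => ⟨F.hasDerivWithinAt_stress ht, ?_⟩⟩
  have hX := F.stress_nonneg t
  set S := ∫ x in (0:ℝ)..1, F.vt (x, t) ^ 2 with hS
  have hS0 : 0 ≤ S := intervalIntegral.integral_nonneg zero_le_one fun x _ => sq_nonneg _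
  have hσ : ∀ x ∈ Icc (0:ℝ) 1, |F.σ (x, t)| ≤ √S := by
    intro x hx
    have key := sq_sub_le_integral_mul_integral (b := fun x => F.vt (x, t) ^ 2) (c := fun _ => 1)
      (fun x hx => F.derivx_σ x hx t ht) (by fun_prop) (by fun_prop) (by fun_prop)
      (fun x => sq_nonneg _) (fun _ => zero_le_one) (fun x => (mul_one _).ge) hx
      ⟨le_rfl, zero_le_one⟩
    rw [F.σ_zero t ht, sub_zero, ← hS] at key
    exact abs_le_sqrt (by simpa using key)
  calc _ ≤ ∫ x in (0:ℝ)..1, (3 * √S * (F.u (x, t) * F.σ (x, t) ^ 2) - F.vt (x, t) ^ 2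
        + F.θ (x, t) ^ (2 * F.β) * F.θx (x, t) ^ 2 / m ^ 2 + F.u (x, t) * F.σ (x, t) ^ 2) := by
        refine integral_mono_Icc zero_le_one (by fun_prop) (by fun_prop (disch := simp [hm.ne']))
          fun x hx => ?_
        have h1 : F.q (x, t) ^ 2 ≤ F.θ (x, t) ^ (2 * F.β) * F.θx (x, t) ^ 2 / m ^ 2 := by
          have h4 : F.θ (x, t) ^ (2 * F.β) = F.θ (x, t) ^ F.β * F.θ (x, t) ^ F.β := by
            rw [← rpow_add (F.θ_pos _)]; congr 1; ring
          rw [F.q_eq, div_pow, h4, mul_pow, sq (F.θ (x, t) ^ F.β)]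
          have := hu x hx t ht
          have := F.θ_pos (x, t)
          gcongr
        have h2 := hσ x hx
        have h3 := F.θ_pos (x, t)
        have h4 := F.u_pos (x, t)
        rw [F.vx_eq]
        have h5 : 0 ≤ F.u (x, t) * F.σ (x, t) ^ 2 := by positivity
        have h6 : 0 ≤ F.σ (x, t) ^ 2 * F.θ (x, t) := by positivity
        have h7 := mul_le_mul_of_nonneg_right ((neg_le_abs _).trans h2) h5
        nlinarith [sq_nonneg (F.q (x, t) - F.vt (x, t))]
    _ = 3 * √S * F.stress t - S + F.heat t / m ^ 2 + F.stress t := by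
        rw [intervalIntegral.integral_add, intervalIntegral.integral_add,
          intervalIntegral.integral_sub, intervalIntegral.integral_const_mul,
          intervalIntegral.integral_div]
        · rfl
        all_goals exact Continuous.intervalIntegrable (by fun_prop (disch := simp [hm.ne'])) _ _
    _ ≤ _ := by nlinarith [sq_nonneg (√S - 3 / 2 * F.stress t), sq_sqrt hS0]

/-- The uniform bound on the `β + 2` moment of the temperature and the accumulated heat flux. -/
lemma exists_moment_add_integral_heat_le : ∃ C > 0, ∀ T, 0 ≤ T →
    (∫ x in (0:ℝ)..1, F.θ (x, T) ^ (F.β + 2)) + ∫ t in (0:ℝ)..T, F.heat t ≤ C := by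
  obtain ⟨c, hc, C, hC, Y', hY⟩ := F.exists_deriv_excess_le
  obtain ⟨m, hm, X', hX⟩ := F.exists_deriv_stress_le
  obtain ⟨I, hI⟩ := F.exists_integral_diss_le
  obtain ⟨J, hJ⟩ := F.exists_integral_stress_le
  have hE := F.energy_pos
  have hβ := F.β_pos
  set l := m * (c / 2) with hl
  have hl0 : 0 < l := by positivity
  set a := F.energy ^ (F.β + 2) + 1 with ha
  have ha0 : 0 < a := by positivity
  set Z : ℝ → ℝ := fun t => F.excess t + l * F.stress t + a with hZ
  have hex : ∀ t, 0 ≤ t → (∫ x in (0:ℝ)..1, F.θ (x, t) ^ (F.β + 2)) + 1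
      ≤ F.excess t + a := by
    intro t ht
    have := rpow_le_rpow (F.temp_pos t).le (F.temp_le_energy ht) (by linarith : 0 ≤ F.β + 2)
    rw [excess, ha]
    linarith
  have hpos : ∀ t, 0 ≤ ∫ x in (0:ℝ)..1, F.θ (x, t) ^ (F.β + 2) := fun t =>
    intervalIntegral.integral_nonneg zero_le_one fun x _ => (rpow_pos_of_pos (F.θ_pos _) _).le
  have hZ1 : ∀ t, 0 ≤ t → 1 ≤ Z t ∧ F.stress t ≤ Z t / l ∧
      ∫ x in (0:ℝ)..1, F.θ (x, t) ^ (F.β + 2) ≤ Z t := by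
    intro t ht
    have h1 := mul_nonneg hl0.le (F.stress_nonneg t)
    rw [le_div_iff₀ hl0, hZ]
    refine ⟨?_, ?_, ?_⟩ <;> linarith [hex t ht, hpos t]
  set k := C * (1 / l + 1) + 9 / 4 + l with hk
  have hk0 : 0 < k := by positivity
  set B : ℝ → ℝ := fun t => ∫ s in (0:ℝ)..t, k * (F.stress s + F.diss s) with hB
  set K := k * (|J| + |I|) with hK
  have hBK : ∀ t, 0 ≤ t → B t ≤ K := by
    intro t ht
    simp only [hB, hK]
    rw [intervalIntegral.integral_const_mul, intervalIntegral.integral_add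
      (Continuous.intervalIntegrable (by fun_prop) _ _)
      (Continuous.intervalIntegrable (by fun_prop) _ _)]
    gcongr
    · exact (hJ t ht).trans (le_abs_self _)
    · exact (hI t ht).trans (le_abs_self _)
  have hderiv : ∀ t ∈ Ici (0:ℝ), HasDerivWithinAt (fun t => Z t * exp (-B t))
      ((Y' t + l * X' t - k * (F.stress t + F.diss t) * Z t) * exp (-B t)) (Ici 0) t := by
    intro t ht
    have hcont : Continuous fun s => k * (F.stress s + F.diss s) := by fun_prop
    have dB : HasDerivWithinAt B (k * (F.stress t + F.diss t)) (Ici 0) t :=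
      (hcont.integral_hasStrictDerivAt 0 t).hasDerivAt.hasDerivWithinAt
    exact ((((hY t ht).1.add ((hX t ht).1.const_mul l)).add_const a).mul
      dB.neg.exp).congr_deriv (by simp [hZ]; ring)
  have hbound : ∀ t ∈ Ici (0:ℝ),
      (Y' t + l * X' t - k * (F.stress t + F.diss t) * Z t) * exp (-B t)
        ≤ -(c / 2 * exp (-K)) * F.heat t := by
    intro t ht
    obtain ⟨h1, h2, -⟩ := hZ1 t ht
    have hx := F.stress_nonneg t
    have hv := F.diss_nonneg t
    have hd := F.heat_nonneg t
    have h3 := (hY t ht).2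
    have h4 := mul_le_mul_of_nonneg_left (hX t ht).2 hl0.le
    have h5 : l * (F.heat t / m) = c / 2 * F.heat t := by rw [hl]; field_simp
    have h6 : F.stress t ≤ F.stress t * Z t := le_mul_of_one_le_right hx h1
    have h7 : l * F.stress t ^ 2 ≤ F.stress t * Z t := by
      rw [le_div_iff₀ hl0] at h2
      nlinarith
    have h8 : F.stress t * (1 + F.stress t + F.diss t)
        ≤ (1 / l + 1) * ((F.stress t + F.diss t) * Z t) := by
      have e1 := mul_le_mul_of_nonneg_right h2 (add_nonneg hx hv)
      have e2 : 0 ≤ F.diss t * Z t := mul_nonneg hv (zero_le_one.trans h1)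
      have e3 : Z t / l * (F.stress t + F.diss t) = 1 / l * ((F.stress t + F.diss t) * Z t) := by
        ring
      linarith
    have h9 := mul_le_mul_of_nonneg_left h8 hC.le
    have h10 : 0 ≤ (9 / 4 + l) * (F.diss t * Z t) :=
      mul_nonneg (by positivity) (mul_nonneg hv (zero_le_one.trans h1))
    have h11 := mul_le_mul_of_nonneg_left h6 hl0.le
    have h12 : Y' t + l * X' t - k * (F.stress t + F.diss t) * Z t ≤ -(c / 2 * F.heat t) := by
      rw [hk]
      linarith
    have h13 : exp (-K) * (c / 2 * F.heat t) ≤ exp (-B t) * (c / 2 * F.heat t) := by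
      gcongr
      exact hBK t ht
    have h14 := mul_le_mul_of_nonneg_right h12 (exp_pos (-B t)).le
    linarith
  have hZ0 : 0 < Z 0 := zero_lt_one.trans_le (hZ1 0 le_rfl).1
  set P := exp K * Z 0 with hP
  have hP0 : 0 < P := by positivity
  refine ⟨P + P / (c / 2), by positivity, fun T hT => ?_⟩
  have h1 := sub_le_integral_of_hasDerivWithinAt_Ici hderiv (by fun_prop) hbound le_rfl hT
  have hB0 : B 0 = 0 := by simp [hB]
  rw [intervalIntegral.integral_const_mul, hB0, neg_zero, exp_zero, mul_one] at h1
  obtain ⟨h2, -, h3⟩ := hZ1 T hT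
  have h4 : exp (-K) * Z T ≤ exp (-B T) * Z T := by
    gcongr
    exact hBK T hT
  set D := ∫ t in (0:ℝ)..T, F.heat t
  have h5 : Z T + c / 2 * D ≤ P := by
    have h6 : exp (-K) * (Z T + c / 2 * D) ≤ exp (-K) * P := by
      rw [hP, ← mul_assoc, ← exp_add, neg_add_cancel, exp_zero, one_mul]
      linarith
    exact le_of_mul_le_mul_left h6 (exp_pos _)
  have hD0 : 0 ≤ D := intervalIntegral.integral_nonneg hT fun t _ => F.heat_nonneg t
  have h6 : D ≤ P / (c / 2) := by
    rw [le_div_iff₀ (by positivity)]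
    linarith
  have h7 : 0 ≤ c / 2 * D := by positivity
  linarith

end StressFreeFlow

/-- The nearest point of the space-time domain `[0,1] × [0,∞)`. -/
noncomputable def clamp (p : ℝ × ℝ) : ℝ × ℝ := (max 0 (min p.1 1), max 0 p.2)

lemma clamp_mem (p : ℝ × ℝ) : clamp p ∈ Icc (0:ℝ) 1 ×ˢ Ici (0:ℝ) :=
  ⟨⟨le_max_left _ _, max_le zero_le_one (min_le_right _ _)⟩, le_max_left 0 p.2⟩

lemma clamp_of_mem {x t : ℝ} (hx : x ∈ Icc (0:ℝ) 1) (ht : t ∈ Ici (0:ℝ)) :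
    clamp (x, t) = (x, t) := by
  rw [clamp, min_eq_left hx.2, max_eq_right hx.1, max_eq_right (mem_Ici.1 ht)]

/-- Continuous extension from the space-time domain by composition with the projection. -/
noncomputable def clampExtend (f : ℝ → ℝ → ℝ)
    (hf : ContinuousOn (Function.uncurry f) (Icc 0 1 ×ˢ Ici 0)) : C(ℝ × ℝ, ℝ) where
  toFun p := f (clamp p).1 (clamp p).2
  continuous_toFun := hf.comp_continuous (f := clamp) (by unfold clamp; fun_prop) clamp_mem

lemma clampExtend_apply {f : ℝ → ℝ → ℝ}
    (hf : ContinuousOn (Function.uncurry f) (Icc 0 1 ×ˢ Ici 0)) (p : ℝ × ℝ) :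
    clampExtend f hf p = f (clamp p).1 (clamp p).2 := rfl

lemma clampExtend_of_mem {f : ℝ → ℝ → ℝ}
    (hf : ContinuousOn (Function.uncurry f) (Icc 0 1 ×ˢ Ici 0)) {x t : ℝ}
    (hx : x ∈ Icc (0:ℝ) 1) (ht : t ∈ Ici (0:ℝ)) : clampExtend f hf (x, t) = f x t := by
  rw [clampExtend_apply, clamp_of_mem hx ht]

lemma hasDerivWithinAt_clampExtend_time {f : ℝ → ℝ → ℝ}
    (hf : ContinuousOn (Function.uncurry f) (Icc 0 1 ×ˢ Ici 0)) {x t d d' : ℝ}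
    (hx : x ∈ Icc (0:ℝ) 1) (ht : t ∈ Ici (0:ℝ))
    (h : HasDerivWithinAt (fun s => f x s) d (Ici 0) t) (hd : d' = d) :
    HasDerivWithinAt (fun s => clampExtend f hf (x, s)) d' (Ici 0) t :=
  hd ▸ h.congr_of_mem (fun _ hs => clampExtend_of_mem hf hx hs) ht

lemma hasDerivWithinAt_clampExtend_space {f : ℝ → ℝ → ℝ}
    (hf : ContinuousOn (Function.uncurry f) (Icc 0 1 ×ˢ Ici 0)) {x t d d' : ℝ}
    (hx : x ∈ Icc (0:ℝ) 1) (ht : t ∈ Ici (0:ℝ))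
    (h : HasDerivWithinAt (fun y => f y t) d (Icc 0 1) x) (hd : d' = d) :
    HasDerivWithinAt (fun y => clampExtend f hf (y, t)) d' (Icc 0 1) x :=
  hd ▸ h.congr_of_mem (fun _ hy => clampExtend_of_mem hf hy ht) hx

namespace NSSol

variable (S : NSSol)

lemma continuousOn_stress : ContinuousOn
    (Function.uncurry fun x t => (S.vx x t - S.θ x t) / S.u x t) (Icc 0 1 ×ˢ Ici 0) :=
  (S.hvx_cont.sub S.hθ_cont).div S.hu_cont fun p hp => (S.hu_pos p.1 hp.1 p.2 hp.2).ne'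

lemma continuousOn_flux : ContinuousOn
    (Function.uncurry fun x t => S.θ x t ^ S.β * S.θx x t / S.u x t) (Icc 0 1 ×ˢ Ici 0) :=
  ((S.hθ_cont.rpow_const fun p hp => Or.inl (S.hθ_pos p.1 hp.1 p.2 hp.2).ne').mul
    S.hθx_cont).div S.hu_cont fun p hp => (S.hu_pos p.1 hp.1 p.2 hp.2).ne'

/-- The extension of a classical solution to the whole plane. -/
noncomputable def toFlow : StressFreeFlow where
  β := S.β
  β_pos := S.hβ
  u := clampExtend S.u S.hu_cont
  v := clampExtend S.v S.hv_cont
  θ := clampExtend S.θ S.hθ_cont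
  vx := clampExtend S.vx S.hvx_cont
  vt := clampExtend S.vt S.hvt_cont
  θx := clampExtend S.θx S.hθx_cont
  θt := clampExtend S.θt S.hθt_cont
  σ := clampExtend _ S.continuousOn_stress
  q := clampExtend _ S.continuousOn_flux
  u_pos p := S.hu_pos _ (clamp_mem p).1 _ (clamp_mem p).2
  θ_pos p := S.hθ_pos _ (clamp_mem p).1 _ (clamp_mem p).2
  vx_eq p := by
    have := S.hu_pos _ (clamp_mem p).1 _ (clamp_mem p).2
    simp only [clampExtend_apply]
    field_simp
    ring
  q_eq _ := rfl
  deriv_u x hx t ht := hasDerivWithinAt_clampExtend_time S.hu_cont hx ht (S.hut x hx t ht) (by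
    rw [clampExtend_of_mem _ hx ht, clampExtend_of_mem _ hx ht, ← S.mass x hx t ht]; ring)
  deriv_v x hx t ht := hasDerivWithinAt_clampExtend_time S.hv_cont hx ht (S.hvt x hx t ht)
    (clampExtend_of_mem _ hx ht)
  deriv_θ x hx t ht := hasDerivWithinAt_clampExtend_time S.hθ_cont hx ht (S.hθt x hx t ht)
    (clampExtend_of_mem _ hx ht)
  derivx_v x hx t ht := hasDerivWithinAt_clampExtend_space S.hv_cont hx ht (S.hvx x hx t ht)
    (clampExtend_of_mem _ hx ht)
  derivx_θ x hx t ht := hasDerivWithinAt_clampExtend_space S.hθ_cont hx ht (S.hθx x hx t ht)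
    (clampExtend_of_mem _ hx ht)
  derivx_σ x hx t ht := hasDerivWithinAt_clampExtend_space S.continuousOn_stress hx ht
    (S.momentum x hx t ht) (clampExtend_of_mem _ hx ht)
  derivx_q x hx t ht := hasDerivWithinAt_clampExtend_space S.continuousOn_flux hx ht
    (S.energyEq x hx t ht) (by
      have := S.hu_pos x hx t ht
      rw [clampExtend_of_mem _ hx ht, clampExtend_of_mem _ hx ht, clampExtend_of_mem _ hx ht]
      field_simp
      ring)
  σ_zero t ht := (clampExtend_of_mem _ ⟨le_rfl, zero_le_one⟩ ht).trans (S.bc0 t ht)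
  σ_one t ht := (clampExtend_of_mem _ ⟨zero_le_one, le_rfl⟩ ht).trans (S.bc1 t ht)
  q_zero t ht := (clampExtend_of_mem _ ⟨le_rfl, zero_le_one⟩ ht).trans (by simp [S.bcθ0 t ht])
  q_one t ht := (clampExtend_of_mem _ ⟨zero_le_one, le_rfl⟩ ht).trans (by simp [S.bcθ1 t ht])

end NSSol

/-- Uniform bound `∫₀¹ θ^{β+2}(·,T) dx + ∫₀ᵀ∫₀¹ θ^{2β} θ_x² dx dt ≤ C`. -/
theorem theta_beta_plus_two_bound (S : NSSol) :
    ∃ C > (0:ℝ), ∀ T > (0:ℝ),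
      (∫ x in (0:ℝ)..1, S.θ x T ^ (S.β + 2))
        + (∫ t in (0:ℝ)..T, ∫ x in (0:ℝ)..1, S.θ x t ^ (2 * S.β) * (S.θx x t) ^ 2)
        ≤ C := by
  obtain ⟨C, hC, h⟩ := S.toFlow.exists_moment_add_integral_heat_le
  refine ⟨C, hC, fun T hT => (le_of_eq ?_).trans (h T hT.le)⟩
  congr 1
  · refine intervalIntegral.integral_congr fun x hx => ?_
    rw [uIcc_of_le zero_le_one] at hx
    exact congrArg (· ^ (S.β + 2)) (clampExtend_of_mem S.hθ_cont hx hT.le).symm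
  · refine intervalIntegral.integral_congr fun t ht => ?_
    rw [uIcc_of_le hT.le] at ht
    refine intervalIntegral.integral_congr fun x hx => ?_
    rw [uIcc_of_le zero_le_one] at hx
    exact congrArg₂ (fun a b => a ^ (2 * S.β) * b ^ 2)
      (clampExtend_of_mem S.hθ_cont hx ht.1).symm (clampExtend_of_mem S.hθx_cont hx ht.1).symm
end

section
/- There exists a positive constant C depending only on β and the initial data such that for every T > 0: ∫₀ᵀ max_{x∈[0,1]} (w_x + u − θ)²(x,t) dt ≤ C and ∫₀ᵀ max_{x∈[0,1]} (w_x + u − θ)⁴(x,t) dt ≤ C. -/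
open MeasureTheory Real Set Filter Topology

/-- Joint continuity on the space-time domain `[0,1] × [0,∞)`. -/
def JointCont (f : ℝ → ℝ → ℝ) : Prop :=
  ContinuousOn (fun p : ℝ × ℝ => f p.1 p.2) (Icc 0 1 ×ˢ Ici 0)

namespace JointCont

variable {f g ft : ℝ → ℝ → ℝ}

theorem add (hf : JointCont f) (hg : JointCont g) : JointCont (fun x t => f x t + g x t) :=
  ContinuousOn.add hf hg

theorem sub (hf : JointCont f) (hg : JointCont g) : JointCont (fun x t => f x t - g x t) :=
  ContinuousOn.sub hf hg

theorem mul (hf : JointCont f) (hg : JointCont g) : JointCont (fun x t => f x t * g x t) :=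
  ContinuousOn.mul hf hg

theorem pow (hf : JointCont f) (n : ℕ) : JointCont (fun x t => f x t ^ n) :=
  ContinuousOn.pow hf n

theorem const (c : ℝ) : JointCont (fun _ _ => c) := continuousOn_const

theorem div (hf : JointCont f) (hg : JointCont g)
    (h : ∀ x ∈ Icc (0:ℝ) 1, ∀ t ∈ Ici (0:ℝ), 0 < g x t) :
    JointCont (fun x t => f x t / g x t) :=
  ContinuousOn.div hf hg fun p hp => (h p.1 hp.1 p.2 hp.2).ne'

theorem rpow (hf : JointCont f) (h : ∀ x ∈ Icc (0:ℝ) 1, ∀ t ∈ Ici (0:ℝ), 0 < f x t) (r : ℝ) :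
    JointCont (fun x t => f x t ^ r) :=
  ContinuousOn.rpow_const hf fun p hp => Or.inl (h p.1 hp.1 p.2 hp.2).ne'

theorem log (hf : JointCont f) (h : ∀ x ∈ Icc (0:ℝ) 1, ∀ t ∈ Ici (0:ℝ), 0 < f x t) :
    JointCont (fun x t => Real.log (f x t)) :=
  ContinuousOn.log hf fun p hp => (h p.1 hp.1 p.2 hp.2).ne'

theorem fst : JointCont (fun x _ => x) := continuousOn_fst

/-- Freezing the time variable. -/
theorem freeze (hf : JointCont f) {t : ℝ} (ht : 0 ≤ t) : JointCont (fun x _ => f x t) :=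
  ContinuousOn.comp hf (f := fun p : ℝ × ℝ => (p.1, t)) (by fun_prop) fun _ hp => ⟨hp.1, ht⟩

theorem slice (hf : JointCont f) {t : ℝ} (ht : 0 ≤ t) :
    ContinuousOn (fun x => f x t) (Icc 0 1) :=
  ContinuousOn.comp hf (f := fun x : ℝ => (x, t)) (by fun_prop) fun _ hx => ⟨hx, ht⟩

theorem slice_time (hf : JointCont f) {x : ℝ} (hx : x ∈ Icc (0:ℝ) 1) :
    ContinuousOn (fun t => f x t) (Ici 0) :=
  ContinuousOn.comp hf (f := fun t : ℝ => (x, t)) (by fun_prop) fun _ ht => ⟨hx, ht⟩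

theorem intervalIntegrable (hf : JointCont f) {t b : ℝ} (ht : 0 ≤ t) (hb : b ∈ Icc (0:ℝ) 1) :
    IntervalIntegrable (fun x => f x t) volume 0 b :=
  ((hf.slice ht).mono (by rw [uIcc_of_le hb.1]; exact Icc_subset_Icc_right hb.2)).intervalIntegrable

theorem exists_bound (hf : JointCont f) (T : ℝ) :
    ∃ B, 0 ≤ B ∧ ∀ x ∈ Icc (0:ℝ) 1, ∀ t ∈ Icc 0 T, |f x t| ≤ B := by
  obtain ⟨B, hB⟩ := 
    (isCompact_Icc.prod (isCompact_Icc (a := (0:ℝ)) (b := T))).exists_bound_of_continuousOn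
    (ContinuousOn.mono hf (prod_mono le_rfl (Icc_subset_Ici_self)))
  exact ⟨max B 0, le_max_right _ _, fun x hx t ht => (hB (x, t) ⟨hx, ht⟩).trans (le_max_left _ _)⟩

theorem continuousOn_integral (hf : JointCont f) {b : ℝ} (hb : b ∈ Icc (0:ℝ) 1) :
    ContinuousOn (fun t => ∫ x in (0:ℝ)..b, f x t) (Ici 0) := by
  have hc : Continuous (fun p : ℝ × ℝ => f (max 0 (min p.2 1)) (max p.1 0)) :=
    ContinuousOn.comp_continuous hf (f := fun p : ℝ × ℝ => (max 0 (min p.2 1), max p.1 0))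
      (by fun_prop) fun p => ⟨⟨le_max_left _ _, max_le zero_le_one (min_le_right _ _)⟩,
        show (0:ℝ) ≤ max p.1 0 from le_max_right _ _⟩
  have h := intervalIntegral.continuous_parametric_intervalIntegral_of_continuous' (μ := volume)
    (f := fun t x => f (max 0 (min x 1)) (max t 0)) hc 0 b
  refine h.continuousOn.congr fun t ht => ?_
  refine intervalIntegral.integral_congr fun x hx => ?_
  rw [uIcc_of_le hb.1] at hx
  have h1 : max 0 (min x 1) = x := by
    rw [min_eq_left (hx.2.trans hb.2), max_eq_right hx.1]
  have h2 : max t 0 = t := max_eq_left ht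
  simp only [h1, h2]

/-- Passage to the limit in integrals of difference quotients in time. -/
theorem tendsto_integral_slope (hg : JointCont g) (hf : JointCont f) (hft : JointCont ft)
    (hd : ∀ x ∈ Icc (0:ℝ) 1, ∀ t ∈ Ici (0:ℝ),
      HasDerivWithinAt (fun s => f x s) (ft x t) (Ici 0) t)
    {t b : ℝ} (ht : 0 < t) (hb : b ∈ Icc (0:ℝ) 1) :
    Tendsto (fun s => ∫ x in (0:ℝ)..b, g x s * slope (fun r => f x r) t s) (𝓝[≠] t)
      (𝓝 (∫ x in (0:ℝ)..b, g x t * ft x t)) := by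
  obtain ⟨Bg, hBg0, hBg⟩ := hg.exists_bound (t + 1)
  obtain ⟨Bf, hBf0, hBf⟩ := hft.exists_bound (t + 1)
  have hsub : ∀ x ∈ uIoc 0 b, x ∈ Icc (0:ℝ) 1 := fun x hx => by
    rw [uIoc_of_le hb.1] at hx; exact ⟨hx.1.le, hx.2.trans hb.2⟩
  have hev : ∀ᶠ s in 𝓝[≠] t, s ∈ Icc 0 (t + 1) :=
    mem_nhdsWithin_of_mem_nhds (Icc_mem_nhds ht (by linarith))
  refine intervalIntegral.tendsto_integral_filter_of_dominated_convergence
    (fun _ => Bg * Bf) ?_ ?_ intervalIntegrable_const ?_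
  · filter_upwards [hev] with s hs
    have hc : ContinuousOn (fun x => g x s * slope (fun r => f x r) t s) (Icc 0 1) := by
      simp only [slope_def_field]
      exact (hg.slice hs.1).mul (((hf.slice hs.1).sub (hf.slice ht.le)).div_const _)
    refine (hc.mono ?_).aestronglyMeasurable measurableSet_uIoc
    exact fun x hx => hsub x hx
  · filter_upwards [hev, self_mem_nhdsWithin] with s hs hne
    refine ae_of_all _ fun x hx => ?_
    have hx := hsub x hx
    have h1 : |f x s - f x t| ≤ Bf * |s - t| :=
      (convex_Icc 0 (t + 1)).norm_image_sub_le_of_norm_hasDerivWithin_le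
        (fun r hr => (hd x hx r hr.1).mono Icc_subset_Ici_self)
        (fun r hr => hBf x hx r hr) ⟨ht.le, by linarith⟩ hs
    have h2 : 0 < |s - t| := abs_pos.2 (sub_ne_zero.2 hne)
    rw [norm_mul, slope_def_field, norm_div]
    refine mul_le_mul (hBg x hx s hs) ?_ (by positivity) hBg0
    exact (div_le_iff₀ h2).2 h1
  · refine ae_of_all _ fun x hx => ?_
    have hx := hsub x hx
    have h1 : Tendsto (fun s => g x s) (𝓝[≠] t) (𝓝 (g x t)) :=
      ((hg.slice_time hx).continuousAt (Ici_mem_nhds ht)).tendsto.mono_left nhdsWithin_le_nhds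
    exact h1.mul (hasDerivAt_iff_tendsto_slope.1 ((hd x hx t ht.le).hasDerivAt (Ici_mem_nhds ht)))

/-- Differentiation under the integral sign. -/
theorem hasDerivAt_integral (hf : JointCont f) (hft : JointCont ft)
    (hd : ∀ x ∈ Icc (0:ℝ) 1, ∀ t ∈ Ici (0:ℝ),
      HasDerivWithinAt (fun s => f x s) (ft x t) (Ici 0) t)
    {t b : ℝ} (ht : 0 < t) (hb : b ∈ Icc (0:ℝ) 1) :
    HasDerivAt (fun s => ∫ x in (0:ℝ)..b, f x s) (∫ x in (0:ℝ)..b, ft x t) t := by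
  rw [hasDerivAt_iff_tendsto_slope]
  have h := (const 1).tendsto_integral_slope hf hft hd ht hb
  simp only [one_mul] at h
  refine h.congr' ?_
  filter_upwards [mem_nhdsWithin_of_mem_nhds (Ici_mem_nhds ht)] with s hs
  simp only [slope_def_field]
  rw [intervalIntegral.integral_div,
    intervalIntegral.integral_sub (hf.intervalIntegrable hs hb) (hf.intervalIntegrable ht.le hb)]

end JointCont

theorem ContinuousOn.intervalIntegrable_unit {f : ℝ → ℝ} (hf : ContinuousOn f (Icc 0 1)) :
    IntervalIntegrable f volume 0 1 :=
  ContinuousOn.intervalIntegrable (by rwa [uIcc_of_le zero_le_one])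

theorem integral_unit_mono {f g : ℝ → ℝ} (hf : ContinuousOn f (Icc 0 1))
    (hg : ContinuousOn g (Icc 0 1)) (h : ∀ x ∈ Icc (0:ℝ) 1, f x ≤ g x) :
    ∫ x in (0:ℝ)..1, f x ≤ ∫ x in (0:ℝ)..1, g x :=
  intervalIntegral.integral_mono_on zero_le_one hf.intervalIntegrable_unit
    hg.intervalIntegrable_unit h

theorem integral_unit_nonneg {f : ℝ → ℝ} (h : ∀ x ∈ Icc (0:ℝ) 1, 0 ≤ f x) :
    0 ≤ ∫ x in (0:ℝ)..1, f x :=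
  intervalIntegral.integral_nonneg zero_le_one h

theorem integral_congr_unit {f g : ℝ → ℝ} (h : ∀ x ∈ Icc (0:ℝ) 1, f x = g x) :
    ∫ x in (0:ℝ)..1, f x = ∫ x in (0:ℝ)..1, g x :=
  intervalIntegral.integral_congr (by rwa [uIcc_of_le zero_le_one])

theorem integral_deriv_Icc {f f' : ℝ → ℝ} {a b : ℝ} (ha : 0 ≤ a) (hab : a ≤ b) (hb : b ≤ 1)
    (hd : ∀ x ∈ Icc (0:ℝ) 1, HasDerivWithinAt f (f' x) (Icc 0 1) x)
    (hc : ContinuousOn f' (Icc 0 1)) :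
    ∫ x in a..b, f' x = f b - f a := by
  have hsub : Icc a b ⊆ Icc 0 1 := Icc_subset_Icc ha hb
  refine intervalIntegral.integral_eq_sub_of_hasDerivAt_of_le hab
    (fun x hx => (hd x (hsub hx)).continuousWithinAt.mono hsub) (fun x hx => ?_)
    (hc.mono (by rwa [uIcc_of_le hab])).intervalIntegrable
  exact (hd x (hsub (Ioo_subset_Icc_self hx))).hasDerivAt
    (Icc_mem_nhds (ha.trans_lt hx.1) (hx.2.trans_le hb))

/-- The Cauchy–Schwarz inequality for continuous functions on `[0,1]`. -/
theorem sq_integral_mul_le {a b : ℝ → ℝ} (ha : ContinuousOn a (Icc 0 1))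
    (hb : ContinuousOn b (Icc 0 1)) :
    (∫ x in (0:ℝ)..1, a x * b x) ^ 2
      ≤ (∫ x in (0:ℝ)..1, a x ^ 2) * ∫ x in (0:ℝ)..1, b x ^ 2 := by
  have key : ∀ r : ℝ, 0 ≤ (∫ x in (0:ℝ)..1, a x ^ 2) * (r * r)
      + 2 * (∫ x in (0:ℝ)..1, a x * b x) * r + ∫ x in (0:ℝ)..1, b x ^ 2 := fun r => by
    have h1 : 0 ≤ ∫ x in (0:ℝ)..1, (r * r * a x ^ 2 + 2 * r * (a x * b x) + b x ^ 2) :=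
      integral_unit_nonneg fun x _ => by nlinarith [sq_nonneg (r * a x + b x)]
    rw [intervalIntegral.integral_add, intervalIntegral.integral_add,
      intervalIntegral.integral_const_mul, intervalIntegral.integral_const_mul] at h1
    · linarith
    all_goals exact ContinuousOn.intervalIntegrable_unit (by fun_prop)
  have := discrim_le_zero key
  rw [discrim] at this
  nlinarith

/-- Oscillation of a function whose squared derivative is dominated by a product. -/
theorem sq_sub_le_of_sq_deriv_le {f f' A B : ℝ → ℝ}
    (hd : ∀ x ∈ Icc (0:ℝ) 1, HasDerivWithinAt f (f' x) (Icc 0 1) x)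
    (hc : ContinuousOn f' (Icc 0 1)) (hA : ContinuousOn A (Icc 0 1))
    (hB : ContinuousOn B (Icc 0 1)) (hA0 : ∀ x ∈ Icc (0:ℝ) 1, 0 ≤ A x)
    (hB0 : ∀ x ∈ Icc (0:ℝ) 1, 0 ≤ B x) (h : ∀ x ∈ Icc (0:ℝ) 1, f' x ^ 2 ≤ A x * B x)
    {x y : ℝ} (hx : x ∈ Icc (0:ℝ) 1) (hy : y ∈ Icc (0:ℝ) 1) :
    (f x - f y) ^ 2 ≤ (∫ x in (0:ℝ)..1, A x) * ∫ x in (0:ℝ)..1, B x := by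
  wlog hxy : y ≤ x generalizing x y
  · rw [← neg_sub, neg_sq]
    exact this hy hx (le_of_not_ge hxy)
  have hsub : Icc y x ⊆ Icc 0 1 := Icc_subset_Icc hy.1 hx.2
  have h1 : |f x - f y| ≤ ∫ z in (0:ℝ)..1, √(A z) * √(B z) := by
    rw [← integral_deriv_Icc hy.1 hxy hx.2 hd hc]
    have hAB : IntervalIntegrable (fun z => √(A z) * √(B z)) volume 0 1 :=
      (hA.sqrt.mul hB.sqrt).intervalIntegrable_unit
    calc |∫ z in y..x, f' z| ≤ ∫ z in y..x, |f' z| :=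
          intervalIntegral.abs_integral_le_integral_abs hxy
      _ ≤ ∫ z in y..x, √(A z) * √(B z) := by
          refine intervalIntegral.integral_mono_on hxy
            (hc.abs.mono (by rwa [uIcc_of_le hxy])).intervalIntegrable
            (hAB.mono_set (by rwa [uIcc_of_le hxy, uIcc_of_le zero_le_one])) fun z hz => ?_
          rw [← Real.sqrt_mul (hA0 z (hsub hz))]
          exact Real.abs_le_sqrt (h z (hsub hz))
      _ ≤ ∫ z in (0:ℝ)..1, √(A z) * √(B z) :=
          intervalIntegral.integral_mono_interval hy.1 hxy hx.2
            (ae_of_all _ fun z => by positivity) hAB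
  calc (f x - f y) ^ 2 = |f x - f y| ^ 2 := (sq_abs _).symm
    _ ≤ (∫ z in (0:ℝ)..1, √(A z) * √(B z)) ^ 2 := by gcongr
    _ ≤ (∫ z in (0:ℝ)..1, √(A z) ^ 2) * ∫ z in (0:ℝ)..1, √(B z) ^ 2 :=
        sq_integral_mul_le hA.sqrt hB.sqrt
    _ = _ := by
        rw [integral_congr_unit fun z hz => Real.sq_sqrt (hA0 z hz),
          integral_congr_unit fun z hz => Real.sq_sqrt (hB0 z hz)]

/-- A continuous function on `[0,1]` attains its mean value. -/
theorem exists_eq_integral_unit {f : ℝ → ℝ} (hf : ContinuousOn f (Icc 0 1)) :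
    ∃ x ∈ Icc (0:ℝ) 1, f x = ∫ x in (0:ℝ)..1, f x := by
  obtain ⟨a, ha, hmin⟩ := isCompact_Icc.exists_isMinOn (nonempty_Icc.2 zero_le_one) hf
  obtain ⟨b, hb, hmax⟩ := isCompact_Icc.exists_isMaxOn (nonempty_Icc.2 zero_le_one) hf
  have h1 : f a ≤ ∫ x in (0:ℝ)..1, f x := by
    simpa using integral_unit_mono (continuousOn_const (c := f a)) hf fun x hx => hmin hx
  have h2 : ∫ x in (0:ℝ)..1, f x ≤ f b := by
    simpa using integral_unit_mono hf (continuousOn_const (c := f b)) fun x hx => hmax hx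
  exact isPreconnected_Icc.intermediate_value ha hb hf ⟨h1, h2⟩

theorem antitoneOn_Ici_of_hasDerivAt {f f' : ℝ → ℝ} (hc : ContinuousOn f (Ici 0))
    (hd : ∀ t > 0, HasDerivAt f (f' t) t) (h : ∀ t > 0, f' t ≤ 0) : AntitoneOn f (Ici 0) := by
  refine antitoneOn_of_deriv_nonpos (convex_Ici 0) hc (fun t ht => ?_) fun t ht => ?_
  · rw [interior_Ici] at ht
    exact (hd t ht).differentiableAt.differentiableWithinAt
  · rw [interior_Ici] at ht
    rw [(hd t ht).deriv]
    exact h t ht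

namespace NSSol

variable (S : NSSol)

/-- The stress `(v_x - θ)/u`. -/
noncomputable def stress (x t : ℝ) : ℝ := (S.vx x t - S.θ x t) / S.u x t

/-- The heat flux `θ^β θ_x/u`. -/
noncomputable def flux (x t : ℝ) : ℝ := S.θ x t ^ S.β * S.θx x t / S.u x t

/-- The entropy functional, whose time derivative is the dissipation `V`. -/
noncomputable def entropy (t : ℝ) : ℝ :=
  ∫ x in (0:ℝ)..1, (Real.log (S.θ x t) - (1 - x) * S.v x t)

theorem jointCont_u : JointCont S.u := S.hu_cont
theorem jointCont_v : JointCont S.v := S.hv_cont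
theorem jointCont_θ : JointCont S.θ := S.hθ_cont
theorem jointCont_ut : JointCont S.ut := S.hut_cont
theorem jointCont_vx : JointCont S.vx := S.hvx_cont
theorem jointCont_vt : JointCont S.vt := S.hvt_cont
theorem jointCont_θx : JointCont S.θx := S.hθx_cont
theorem jointCont_θt : JointCont S.θt := S.hθt_cont

theorem jointCont_stress : JointCont S.stress :=
  (S.jointCont_vx.sub S.jointCont_θ).div S.jointCont_u S.hu_pos

theorem jointCont_flux : JointCont S.flux :=
  ((S.jointCont_θ.rpow S.hθ_pos S.β).mul S.jointCont_θx).div S.jointCont_u S.hu_pos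

variable {S} {x t : ℝ}

theorem vx_eq (hx : x ∈ Icc (0:ℝ) 1) (ht : t ∈ Ici (0:ℝ)) :
    S.vx x t = S.u x t * S.stress x t + S.θ x t := by
  have := S.hu_pos x hx t ht
  rw [stress]; field_simp; ring

theorem stress_zero (ht : t ∈ Ici (0:ℝ)) : S.stress 0 t = 0 := S.bc0 t ht
theorem stress_one (ht : t ∈ Ici (0:ℝ)) : S.stress 1 t = 0 := S.bc1 t ht

theorem flux_zero (ht : t ∈ Ici (0:ℝ)) : S.flux 0 t = 0 := by simp [flux, S.bcθ0 t ht]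
theorem flux_one (ht : t ∈ Ici (0:ℝ)) : S.flux 1 t = 0 := by simp [flux, S.bcθ1 t ht]

theorem hasDeriv_stress (hx : x ∈ Icc (0:ℝ) 1) (ht : t ∈ Ici (0:ℝ)) :
    HasDerivWithinAt (fun y => S.stress y t) (S.vt x t) (Icc 0 1) x := S.momentum x hx t ht

theorem hasDeriv_flux (hx : x ∈ Icc (0:ℝ) 1) (ht : t ∈ Ici (0:ℝ)) :
    HasDerivWithinAt (fun y => S.flux y t) (S.θt x t - S.stress x t * S.vx x t) (Icc 0 1) x := by
  have := S.hu_pos x hx t ht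
  refine (S.energyEq x hx t ht).congr_deriv ?_
  rw [stress]; field_simp; ring

theorem integral_energy (ht : t ∈ Ici (0:ℝ)) :
    ∫ x in (0:ℝ)..1, (S.v x t ^ 2 / 2 + S.θ x t) = S.E₀ := by
  have hJ : JointCont (fun x t => S.v x t ^ 2 / 2 + S.θ x t) :=
    (((S.jointCont_v.pow 2).mul (.const (1 / 2))).add S.jointCont_θ).congr
      fun p _ => by simp only; ring
  have hJt : JointCont (fun x t => S.v x t * S.vt x t + S.θt x t) :=
    (S.jointCont_v.mul S.jointCont_vt).add S.jointCont_θt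
  have hd : ∀ t > 0, HasDerivAt (fun t => ∫ x in (0:ℝ)..1, (S.v x t ^ 2 / 2 + S.θ x t)) 0 t := by
    intro t ht
    have h := hJ.hasDerivAt_integral hJt (fun x hx t ht => by
      refine ((((S.hvt x hx t ht).pow 2).div_const 2).add (S.hθt x hx t ht)).congr_deriv ?_
      simp; ring) ht (b := 1) (by simp)
    convert h using 1
    rw [integral_deriv_Icc (f := fun x => S.v x t * S.stress x t + S.flux x t) le_rfl zero_le_one
      le_rfl (fun x hx => ?_) (hJt.slice ht.le)]
    · simp [stress_zero ht.le, stress_one ht.le, flux_zero ht.le, flux_one ht.le]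
    · refine (((S.hvx x hx t ht.le).mul (hasDeriv_stress hx ht.le)).add
        (hasDeriv_flux hx ht.le)).congr_deriv ?_
      ring
  have hc := hJ.continuousOn_integral (b := 1) (by simp)
  have h1 := antitoneOn_Ici_of_hasDerivAt hc hd (fun _ _ => le_rfl)
  have h2 := antitoneOn_Ici_of_hasDerivAt hc.neg (fun t ht => (hd t ht).neg) (by simp)
  have h3 := h1 self_mem_Ici ht ht
  have h4 := h2 self_mem_Ici ht ht
  simp only [Pi.neg_apply, neg_le_neg_iff] at h4
  exact le_antisymm h3 h4

theorem integral_θ_le (ht : t ∈ Ici (0:ℝ)) : ∫ x in (0:ℝ)..1, S.θ x t ≤ S.E₀ := by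
  rw [← integral_energy ht]
  have h1 := S.jointCont_v.slice ht
  have h2 := S.jointCont_θ.slice ht
  exact integral_unit_mono h2 (by fun_prop) fun x _ => by nlinarith [sq_nonneg (S.v x t)]

theorem integral_v_sq_le (ht : t ∈ Ici (0:ℝ)) : ∫ x in (0:ℝ)..1, S.v x t ^ 2 ≤ 2 * S.E₀ := by
  rw [← integral_energy ht, ← intervalIntegral.integral_const_mul]
  have h1 := S.jointCont_v.slice ht
  have h2 := S.jointCont_θ.slice ht
  exact integral_unit_mono (by fun_prop) (by fun_prop) fun x hx => by
    linarith [S.hθ_pos x hx t ht]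

theorem integral_abs_v_le (ht : t ∈ Ici (0:ℝ)) :
    ∫ x in (0:ℝ)..1, |S.v x t| ≤ 1 + S.E₀ := by
  have h1 := S.jointCont_v.slice ht
  have h : ∫ x in (0:ℝ)..1, |S.v x t| ≤ ∫ x in (0:ℝ)..1, (1 + 1 / 2 * S.v x t ^ 2) :=
    integral_unit_mono (by fun_prop) (by fun_prop) fun x _ => by
      rw [← sq_abs (S.v x t)]; nlinarith [sq_nonneg (|S.v x t| - 1)]
  rw [intervalIntegral.integral_add _root_.intervalIntegrable_const
    (ContinuousOn.intervalIntegrable_unit (by fun_prop)),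
    intervalIntegral.integral_const_mul] at h
  have := integral_v_sq_le (S := S) ht
  simp at h
  linarith

theorem E₀_pos : 0 < S.E₀ := by
  have h0 : (0:ℝ) ∈ Ici (0:ℝ) := self_mem_Ici
  refine lt_of_lt_of_le ?_ (integral_θ_le h0)
  obtain ⟨x, hx, h⟩ := exists_eq_integral_unit (S.jointCont_θ.slice h0)
  rw [← h]
  exact S.hθ_pos x hx 0 h0

theorem jointCont_dissipation : JointCont (fun x t =>
    S.θ x t ^ S.β * (S.θx x t) ^ 2 / (S.u x t * (S.θ x t) ^ 2)
      + (S.vx x t - S.θ x t) ^ 2 / (S.u x t * S.θ x t)) :=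
  ((((S.jointCont_θ.rpow S.hθ_pos S.β).mul (S.jointCont_θx.pow 2)).div
    (S.jointCont_u.mul (S.jointCont_θ.pow 2))
      fun x hx t ht => mul_pos (S.hu_pos x hx t ht) (pow_pos (S.hθ_pos x hx t ht) 2))).add
    (((S.jointCont_vx.sub S.jointCont_θ).pow 2).div (S.jointCont_u.mul S.jointCont_θ)
      fun x hx t ht => mul_pos (S.hu_pos x hx t ht) (S.hθ_pos x hx t ht))

theorem V_nonneg (ht : t ∈ Ici (0:ℝ)) : 0 ≤ S.V t :=
  integral_unit_nonneg fun x hx => by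
    have := S.hu_pos x hx t ht
    have := S.hθ_pos x hx t ht
    positivity

theorem jointCont_entropy : JointCont (fun x t => Real.log (S.θ x t) - (1 - x) * S.v x t) :=
  (S.jointCont_θ.log S.hθ_pos).sub (((JointCont.const 1).sub .fst).mul S.jointCont_v)

theorem continuousOn_entropy : ContinuousOn S.entropy (Ici 0) :=
  jointCont_entropy.continuousOn_integral (by simp)

theorem hasDerivAt_entropy (ht : 0 < t) : HasDerivAt S.entropy (S.V t) t := by
  have ht' : t ∈ Ici (0:ℝ) := ht.le
  have hJt : JointCont (fun x t => S.θt x t / S.θ x t - (1 - x) * S.vt x t) :=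
    (S.jointCont_θt.div S.jointCont_θ S.hθ_pos).sub
      (((JointCont.const 1).sub .fst).mul S.jointCont_vt)
  have h := jointCont_entropy.hasDerivAt_integral hJt (fun x hx t ht =>
    ((S.hθt x hx t ht).log (S.hθ_pos x hx t ht).ne').sub ((S.hvt x hx t ht).const_mul (1 - x)))
    ht (b := 1) (by simp)
  refine h.congr_deriv (Eq.symm ?_)
  have hD := (S.jointCont_dissipation.slice ht').intervalIntegrable_unit
  rw [V, ← sub_eq_zero, ← intervalIntegral.integral_sub hD
    (hJt.slice ht').intervalIntegrable_unit]
  refine (integral_deriv_Icc (f := fun x => (1 - x) * S.stress x t - S.flux x t / S.θ x t) le_rfl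
    zero_le_one le_rfl (fun x hx => ?_) ((jointCont_dissipation.sub hJt).slice ht')).trans ?_
  · have hu := S.hu_pos x hx t ht'
    have hθ := S.hθ_pos x hx t ht'
    refine (((((hasDerivAt_id x).const_sub 1).hasDerivWithinAt).mul (hasDeriv_stress hx ht')).sub
      ((hasDeriv_flux hx ht').div (S.hθx x hx t ht') hθ.ne')).congr_deriv ?_
    simp only [id, stress, flux]
    field_simp
    ring
  · simp [stress_zero ht', flux_zero ht', flux_one ht']

theorem entropy_monotoneOn : MonotoneOn S.entropy (Ici 0) := by
  have := antitoneOn_Ici_of_hasDerivAt continuousOn_entropy.neg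
    (fun t ht => (hasDerivAt_entropy (S := S) ht).neg)
    (fun t ht => neg_nonpos.2 (V_nonneg (mem_Ici.2 ht.le)))
  simpa using this.neg

theorem integral_entropy_eq (ht : t ∈ Ici (0:ℝ)) :
    |S.entropy t - ∫ x in (0:ℝ)..1, Real.log (S.θ x t)| ≤ 1 + S.E₀ := by
  have hv := S.jointCont_v.slice ht
  have hl := (S.jointCont_θ.log S.hθ_pos).slice ht
  rw [entropy, intervalIntegral.integral_sub hl.intervalIntegrable_unit
    (ContinuousOn.intervalIntegrable_unit (by fun_prop)), sub_sub_cancel_left, abs_neg]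
  refine (intervalIntegral.abs_integral_le_integral_abs zero_le_one).trans
    (le_trans ?_ (integral_abs_v_le ht))
  refine integral_unit_mono (by fun_prop) (by fun_prop) fun x hx => ?_
  rw [abs_mul, abs_of_nonneg (sub_nonneg.2 hx.2)]
  nlinarith [abs_nonneg (S.v x t), hx.1]

theorem entropy_le (ht : t ∈ Ici (0:ℝ)) : S.entropy t ≤ 1 + 2 * S.E₀ := by
  have h1 := (abs_le.1 (integral_entropy_eq (S := S) ht)).2
  have h2 : ∫ x in (0:ℝ)..1, Real.log (S.θ x t) ≤ ∫ x in (0:ℝ)..1, S.θ x t :=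
    integral_unit_mono ((S.jointCont_θ.log S.hθ_pos).slice ht) (S.jointCont_θ.slice ht)
      fun x hx => Real.log_le_self (S.hθ_pos x hx t ht).le
  linarith [integral_θ_le (S := S) ht]

theorem entropy_ge (ht : t ∈ Ici (0:ℝ)) : S.entropy 0 ≤ S.entropy t :=
  entropy_monotoneOn self_mem_Ici ht ht

/-- Some point of each time slice has temperature bounded below uniformly in time. -/
theorem exists_le_θ (ht : t ∈ Ici (0:ℝ)) :
    ∃ x ∈ Icc (0:ℝ) 1, Real.exp (S.entropy 0 - (1 + S.E₀)) ≤ S.θ x t := by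
  obtain ⟨x, hx, h⟩ := exists_eq_integral_unit ((S.jointCont_θ.log S.hθ_pos).slice ht)
  refine ⟨x, hx, ?_⟩
  rw [← Real.le_log_iff_exp_le (S.hθ_pos x hx t ht), h]
  linarith [(abs_le.1 (integral_entropy_eq (S := S) ht)).2, entropy_ge (S := S) ht]

end NSSol

theorem antitoneOn_Icc_of_hasDerivAt {f f' : ℝ → ℝ} {a b : ℝ} (hc : ContinuousOn f (Icc a b))
    (hd : ∀ t ∈ Ioo a b, HasDerivAt f (f' t) t) (h : ∀ t ∈ Ioo a b, f' t ≤ 0) :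
    AntitoneOn f (Icc a b) := by
  refine antitoneOn_of_deriv_nonpos (convex_Icc a b) hc (fun t ht => ?_) fun t ht => ?_
  · rw [interior_Icc] at ht
    exact (hd t ht).differentiableAt.differentiableWithinAt
  · rw [interior_Icc] at ht
    rw [(hd t ht).deriv]
    exact h t ht

namespace NSSol

variable {S : NSSol} {x y t m : ℝ}

theorem hasDeriv_θ_rpow (k : ℝ) (hx : x ∈ Icc (0:ℝ) 1) (ht : t ∈ Ici (0:ℝ)) :
    HasDerivWithinAt (fun y => S.θ y t ^ k) (k * S.θ x t ^ (k - 1) * S.θx x t) (Icc 0 1) x := by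
  refine ((S.hθx x hx t ht).rpow_const (p := k) (Or.inl (S.hθ_pos x hx t ht).ne')).congr_deriv ?_
  ring

theorem jointCont_conduction : JointCont (fun x t =>
    S.θ x t ^ S.β * (S.θx x t) ^ 2 / (S.u x t * (S.θ x t) ^ 2)) :=
  ((S.jointCont_θ.rpow S.hθ_pos S.β).mul (S.jointCont_θx.pow 2)).div
    (S.jointCont_u.mul (S.jointCont_θ.pow 2))
      fun x hx t ht => mul_pos (S.hu_pos x hx t ht) (pow_pos (S.hθ_pos x hx t ht) 2)

theorem bound_nonneg (hm : ∀ x ∈ Icc (0:ℝ) 1, S.u x t ≤ m) (ht : t ∈ Ici (0:ℝ)) : 0 ≤ m :=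
  (S.hu_pos 0 (by simp) t ht).le.trans (hm 0 (by simp))

/-- The oscillation of `θ^((β+1)/2)` is controlled by the dissipation. -/
theorem sq_sub_θ_rpow_le (ht : t ∈ Ici (0:ℝ)) (hm : ∀ x ∈ Icc (0:ℝ) 1, S.u x t ≤ m)
    (hx : x ∈ Icc (0:ℝ) 1) (hy : y ∈ Icc (0:ℝ) 1) :
    (S.θ x t ^ ((S.β + 1) / 2) - S.θ y t ^ ((S.β + 1) / 2)) ^ 2
      ≤ ((S.β + 1) / 2) ^ 2 * S.E₀ * m * S.V t := by
  set k := (S.β + 1) / 2 with hk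
  have hθc := S.jointCont_θ.slice ht
  have hm0 := bound_nonneg hm ht
  have hA := (S.jointCont_conduction.slice ht)
  have hpos : ∀ x ∈ Icc (0:ℝ) 1,
      0 ≤ S.θ x t ^ S.β * (S.θx x t) ^ 2 / (S.u x t * (S.θ x t) ^ 2) := fun x hx => by
    have := S.hu_pos x hx t ht
    have := S.hθ_pos x hx t ht
    positivity
  have h := sq_sub_le_of_sq_deriv_le (B := fun x => k ^ 2 * m * S.θ x t)
    (fun x hx => hasDeriv_θ_rpow k hx ht)
    (((((JointCont.const k).mul (S.jointCont_θ.rpow S.hθ_pos (k - 1))).mul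
      S.jointCont_θx)).slice ht) hA (by fun_prop) hpos (fun x hx => by
        have := S.hθ_pos x hx t ht
        positivity) (fun x hx => by
        have hu := S.hu_pos x hx t ht
        have hθ := S.hθ_pos x hx t ht
        have h1 : (S.θ x t ^ (k - 1)) ^ 2 * S.θ x t = S.θ x t ^ S.β := by
          rw [← Real.rpow_natCast, ← Real.rpow_mul hθ.le, ← Real.rpow_add_one hθ.ne']
          congr 1
          push_cast
          rw [hk]; ring
        have h2 : S.θ x t ^ S.β * (S.θx x t) ^ 2 / (S.u x t * (S.θ x t) ^ 2)
            * (k ^ 2 * m * S.θ x t)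
            = (k * S.θ x t ^ (k - 1) * S.θx x t) ^ 2 * (m / S.u x t) := by
          rw [← h1]; field_simp
        rw [h2]
        exact le_mul_of_one_le_right (sq_nonneg _) ((one_le_div hu).2 (hm x hx))) hx hy
  refine h.trans ?_
  have h1 : ∫ x in (0:ℝ)..1, S.θ x t ^ S.β * (S.θx x t) ^ 2 / (S.u x t * (S.θ x t) ^ 2) ≤ S.V t :=
    integral_unit_mono hA (S.jointCont_dissipation.slice ht) fun x hx => by
      have := S.hu_pos x hx t ht
      have := S.hθ_pos x hx t ht
      exact le_add_of_nonneg_right (by positivity)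
  have h2 : ∫ x in (0:ℝ)..1, k ^ 2 * m * S.θ x t ≤ k ^ 2 * m * S.E₀ := by
    rw [intervalIntegral.integral_const_mul]
    exact mul_le_mul_of_nonneg_left (integral_θ_le ht) (by positivity)
  calc _ ≤ S.V t * (k ^ 2 * m * S.E₀) :=
        mul_le_mul h1 h2 (integral_unit_nonneg fun x hx => by
          have := S.hθ_pos x hx t ht
          positivity) (V_nonneg ht)
    _ = _ := by ring

theorem θ_rpow_half_sq (hx : x ∈ Icc (0:ℝ) 1) (ht : t ∈ Ici (0:ℝ)) :
    (S.θ x t ^ ((S.β + 1) / 2)) ^ 2 = S.θ x t ^ (S.β + 1) := by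
  rw [← Real.rpow_natCast, ← Real.rpow_mul (S.hθ_pos x hx t ht).le]
  congr 1
  push_cast; ring

theorem θ_rpow_le (ht : t ∈ Ici (0:ℝ)) (hm : ∀ x ∈ Icc (0:ℝ) 1, S.u x t ≤ m)
    (hx : x ∈ Icc (0:ℝ) 1) :
    S.θ x t ^ (S.β + 1)
      ≤ 2 * S.E₀ ^ (S.β + 1) + 2 * ((S.β + 1) / 2) ^ 2 * S.E₀ * m * S.V t := by
  obtain ⟨y, hy, h⟩ := exists_eq_integral_unit (S.jointCont_θ.slice ht)
  have h1 := sq_sub_θ_rpow_le ht hm hx hy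
  have h2 : S.θ y t ^ (S.β + 1) ≤ S.E₀ ^ (S.β + 1) :=
    Real.rpow_le_rpow (S.hθ_pos y hy t ht).le (h.trans_le (integral_θ_le ht))
      (by linarith [S.hβ])
  rw [← θ_rpow_half_sq hx ht]
  rw [← θ_rpow_half_sq hy ht] at h2
  nlinarith [sq_nonneg (S.θ x t ^ ((S.β + 1) / 2) - 2 * S.θ y t ^ ((S.β + 1) / 2))]

theorem θ_le_one_add_rpow (hx : x ∈ Icc (0:ℝ) 1) (ht : t ∈ Ici (0:ℝ)) :
    S.θ x t ≤ 1 + S.θ x t ^ (S.β + 1) := by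
  have hθ := S.hθ_pos x hx t ht
  rcases le_total (S.θ x t) 1 with h | h
  · linarith [Real.rpow_nonneg hθ.le (S.β + 1)]
  · linarith [Real.self_le_rpow_of_one_le h (by linarith [S.hβ] : 1 ≤ S.β + 1)]

variable (S) in
/-- The Lagrangian integrating factor applied to the specific volume. -/
noncomputable def scaledVolume (x t : ℝ) : ℝ :=
  S.u x t * Real.exp (t - ∫ ξ in (0:ℝ)..x, S.v ξ t)

theorem abs_integral_v_le (hx : x ∈ Icc (0:ℝ) 1) (ht : t ∈ Ici (0:ℝ)) :
    |∫ ξ in (0:ℝ)..x, S.v ξ t| ≤ 1 + S.E₀ := by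
  have hc := (S.jointCont_v.slice ht).abs
  refine (intervalIntegral.abs_integral_le_integral_abs hx.1).trans
    (le_trans ?_ (integral_abs_v_le ht))
  exact intervalIntegral.integral_mono_interval le_rfl hx.1 hx.2
    (ae_of_all _ fun z => abs_nonneg _) hc.intervalIntegrable_unit

theorem hasDerivAt_scaledVolume (hx : x ∈ Icc (0:ℝ) 1) (ht : 0 < t) :
    HasDerivAt (S.scaledVolume x)
      (S.θ x t * Real.exp (t - ∫ ξ in (0:ℝ)..x, S.v ξ t)) t := by
  have h1 := (S.hut x hx t ht.le).hasDerivAt (Ici_mem_nhds ht)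
  have h2 := S.jointCont_v.hasDerivAt_integral S.jointCont_vt S.hvt ht hx
  rw [integral_deriv_Icc le_rfl hx.1 hx.2 (fun x hx => hasDeriv_stress hx ht.le)
    (S.jointCont_vt.slice ht.le), stress_zero ht.le, sub_zero] at h2
  refine (h1.mul ((hasDerivAt_id t).sub h2).exp).congr_deriv ?_
  have h3 := S.mass x hx t ht.le
  rw [vx_eq hx ht.le] at h3
  simp only [id, Pi.sub_apply]
  linear_combination Real.exp (t - ∫ ξ in (0:ℝ)..x, S.v ξ t) * h3

theorem continuousOn_scaledVolume (hx : x ∈ Icc (0:ℝ) 1) :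
    ContinuousOn (S.scaledVolume x) (Ici 0) :=
  (S.jointCont_u.slice_time hx).mul
    (continuousOn_id.sub (S.jointCont_v.continuousOn_integral hx)).rexp

theorem exp_integral_le (hx : x ∈ Icc (0:ℝ) 1) (ht : t ∈ Ici (0:ℝ)) :
    Real.exp (t - ∫ ξ in (0:ℝ)..x, S.v ξ t) ≤ Real.exp (1 + S.E₀) * Real.exp t := by
  rw [← Real.exp_add]
  exact Real.exp_le_exp.2 (by linarith [(abs_le.1 (abs_integral_v_le (S := S) hx ht)).1])

theorem le_exp_integral (hx : x ∈ Icc (0:ℝ) 1) (ht : t ∈ Ici (0:ℝ)) :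
    Real.exp t ≤ Real.exp (1 + S.E₀) * Real.exp (t - ∫ ξ in (0:ℝ)..x, S.v ξ t) := by
  rw [← Real.exp_add]
  exact Real.exp_le_exp.2 (by linarith [(abs_le.1 (abs_integral_v_le (S := S) hx ht)).2])

variable (S) in
/-- Uniform upper bound for the specific volume. -/
theorem exists_u_le : ∃ m > 0, ∀ x ∈ Icc (0:ℝ) 1, ∀ t ∈ Ici (0:ℝ), S.u x t ≤ m := by
  have hE := S.E₀_pos
  have hβ := S.hβ
  obtain ⟨U, hU0, hU⟩ := S.jointCont_u.exists_bound 0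
  set e := Real.exp (1 + S.E₀) with he
  have he0 : 0 < e := Real.exp_pos _
  set a := 1 + 2 * S.E₀ ^ (S.β + 1) with ha
  set b := 2 * ((S.β + 1) / 2) ^ 2 * S.E₀ with hb
  have ha0 : 0 < a := by positivity
  have hb0 : 0 < b := by positivity
  set l := 2 * b * e ^ 2 with hl
  have hl0 : 0 < l := by positivity
  refine ⟨2 * e ^ 2 * (U + a) * Real.exp (l * (1 + 2 * S.E₀ - S.entropy 0)), by positivity,
    fun x₀ hx₀ T hT => ?_⟩
  have hK : IsCompact (Icc (0:ℝ) 1 ×ˢ Icc (0:ℝ) T) := isCompact_Icc.prod isCompact_Icc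
  have hsub : Icc (0:ℝ) 1 ×ˢ Icc (0:ℝ) T ⊆ Icc 0 1 ×ˢ Ici 0 := prod_mono le_rfl Icc_subset_Ici_self
  have hcont : ContinuousOn (fun p : ℝ × ℝ => S.u p.1 p.2 * Real.exp (-(l * S.entropy p.2)))
      (Icc (0:ℝ) 1 ×ˢ Icc (0:ℝ) T) := by
    have hL : ContinuousOn (fun p : ℝ × ℝ => S.entropy p.2) (Icc (0:ℝ) 1 ×ˢ Icc (0:ℝ) T) :=
      (continuousOn_entropy (S := S)).comp continuousOn_snd fun p hp => hp.2.1
    exact (ContinuousOn.mono S.jointCont_u hsub).mul (continuousOn_const.mul hL).neg.rexp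
  obtain ⟨⟨x, t⟩, ⟨hx, htT⟩, hmax⟩ := hK.exists_isMaxOn ⟨(0, 0), by simp, by simpa using hT⟩ hcont
  simp only at hx htT
  set M := S.u x t * Real.exp (-(l * S.entropy t)) with hM
  have ht : t ∈ Ici (0:ℝ) := htT.1
  have hM0 : 0 < M := mul_pos (S.hu_pos x hx t ht) (Real.exp_pos _)
  have hle : ∀ y ∈ Icc (0:ℝ) 1, ∀ s ∈ Icc 0 T, S.u y s ≤ M * Real.exp (l * S.entropy s) := by
    intro y hy s hs
    have h : S.u y s * Real.exp (-(l * S.entropy s)) ≤ M := hmax (show (y, s) ∈ _ from ⟨hy, hs⟩)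
    rwa [Real.exp_neg, ← div_eq_mul_inv, div_le_iff₀ (Real.exp_pos _)] at h
  have hut : S.u x t = M * Real.exp (l * S.entropy t) := by
    rw [hM, mul_assoc, ← Real.exp_add]; simp
  have hanti : AntitoneOn (fun s => S.scaledVolume x s
      - e * (a * Real.exp s + b * M / l * Real.exp (s + l * S.entropy s))) (Icc 0 t) := by
    have hI : Icc 0 t ⊆ Ici 0 := Icc_subset_Ici_self
    have hcL := (continuousOn_entropy (S := S)).mono hI
    refine antitoneOn_Icc_of_hasDerivAt (f' := fun s =>
        S.θ x s * Real.exp (s - ∫ ξ in (0:ℝ)..x, S.v ξ s)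
        - e * (a * Real.exp s + b * M / l * (Real.exp (s + l * S.entropy s) * (1 + l * S.V s))))
      (((continuousOn_scaledVolume hx).mono hI).sub (by fun_prop)) (fun s hs => ?_)
      fun s hs => ?_
    · exact (hasDerivAt_scaledVolume hx hs.1).sub ((((Real.hasDerivAt_exp s).const_mul a).add
        (((hasDerivAt_id s).add ((hasDerivAt_entropy hs.1).const_mul l)).exp.const_mul
          (b * M / l))).const_mul e)
    · have hs0 : s ∈ Ici (0:ℝ) := hs.1.le
      have hθ0 := S.hθ_pos x hx s hs0
      have hV := V_nonneg (S := S) hs0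
      have hm := fun y hy => hle y hy s ⟨hs.1.le, hs.2.le.trans htT.2⟩
      have h1 : S.θ x s ≤ a + b * (M * Real.exp (l * S.entropy s)) * S.V s := by
        have h2 := θ_rpow_le hs0 hm hx
        have h3 := θ_le_one_add_rpow (S := S) hx hs0
        rw [ha, hb, mul_assoc _ (M * _)]
        rw [mul_assoc _ (M * _)] at h2
        linarith
      have h2 : S.θ x s * Real.exp (s - ∫ ξ in (0:ℝ)..x, S.v ξ s)
          ≤ (a + b * (M * Real.exp (l * S.entropy s)) * S.V s) * (e * Real.exp s) :=
        mul_le_mul h1 (exp_integral_le hx hs0) (Real.exp_pos _).le (by positivity)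
      have h3 : e * (a * Real.exp s
            + b * M / l * (Real.exp (s + l * S.entropy s) * (1 + l * S.V s)))
          = (a + b * (M * Real.exp (l * S.entropy s)) * S.V s) * (e * Real.exp s)
            + e * (b * M / l * Real.exp (s + l * S.entropy s)) := by
        rw [Real.exp_add]; field_simp; ring
      have h4 : 0 ≤ e * (b * M / l * Real.exp (s + l * S.entropy s)) := by positivity
      linarith
  have h1 := hanti (left_mem_Icc.2 ht) (right_mem_Icc.2 ht) ht
  have h2 : S.scaledVolume x 0 ≤ U * e := by
    have h3 := exp_integral_le (S := S) hx self_mem_Ici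
    rw [Real.exp_zero, mul_one] at h3
    exact mul_le_mul ((le_abs_self _).trans (hU x hx 0 (by simp))) h3 (Real.exp_pos _).le hU0
  have h3 : S.u x t * Real.exp t ≤ e * S.scaledVolume x t := by
    have := mul_le_mul_of_nonneg_left (le_exp_integral (S := S) hx ht) (S.hu_pos x hx t ht).le
    rw [scaledVolume]; linarith
  have h4 : 1 ≤ Real.exp t := Real.one_le_exp ht
  have h5 : 0 ≤ e * (a * Real.exp 0 + b * M / l * Real.exp (0 + l * S.entropy 0)) := by positivity
  simp only at h1
  have h6 : S.u x t * Real.exp t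
      ≤ e * (U * e * Real.exp t
        + e * (a * Real.exp t + b * M / l * Real.exp (t + l * S.entropy t))) := by
    refine h3.trans (mul_le_mul_of_nonneg_left ?_ he0.le)
    have : U * e ≤ U * e * Real.exp t := le_mul_of_one_le_right (by positivity) h4
    linarith
  have h7 : M * Real.exp (l * S.entropy t) ≤ 2 * e ^ 2 * (U + a) := by
    rw [hut, Real.exp_add] at h6
    have h8 : e * (U * e * Real.exp t
        + e * (a * Real.exp t + b * M / l * (Real.exp t * Real.exp (l * S.entropy t))))
        = (e ^ 2 * (U + a) + M * Real.exp (l * S.entropy t) / 2) * Real.exp t := by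
      have h9 : e ^ 2 * (b * M / l) = M / 2 := by rw [hl]; field_simp
      linear_combination (Real.exp t * Real.exp (l * S.entropy t)) * h9
    rw [h8] at h6
    linarith [le_of_mul_le_mul_right h6 (Real.exp_pos t)]
  have h9 : M ≤ 2 * e ^ 2 * (U + a) * Real.exp (-(l * S.entropy 0)) := by
    calc M = M * Real.exp (l * S.entropy t) * Real.exp (-(l * S.entropy t)) := by
          rw [mul_assoc, ← Real.exp_add]; simp
      _ ≤ _ := mul_le_mul h7 (Real.exp_le_exp.2 (neg_le_neg
          (mul_le_mul_of_nonneg_left (entropy_ge ht) hl0.le))) (Real.exp_pos _).le (by positivity)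
  calc S.u x₀ T ≤ M * Real.exp (l * S.entropy T) := hle x₀ hx₀ T ⟨hT, le_rfl⟩
    _ ≤ (2 * e ^ 2 * (U + a) * Real.exp (-(l * S.entropy 0)))
        * Real.exp (l * (1 + 2 * S.E₀)) :=
        mul_le_mul h9 (Real.exp_le_exp.2 (mul_le_mul_of_nonneg_left (entropy_le hT) hl0.le))
          (Real.exp_pos _).le (by positivity)
    _ = _ := by
        rw [mul_assoc, ← Real.exp_add]
        ring_nf

theorem exists_le_θ_sub_V (hm0 : 0 < m)
    (hm : ∀ x ∈ Icc (0:ℝ) 1, ∀ t ∈ Ici (0:ℝ), S.u x t ≤ m) :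
    ∃ c > 0, ∃ D > 0, ∀ x ∈ Icc (0:ℝ) 1, ∀ t ∈ Ici (0:ℝ), c * (1 - D * S.V t) ≤ S.θ x t := by
  have hE := S.E₀_pos
  have hβ := S.hβ
  set k := (S.β + 1) / 2 with hk
  have hk0 : 0 < k := by positivity
  set b := k ^ 2 * S.E₀ * m with hb
  have hb0 : 0 < b := by positivity
  set d := Real.exp (S.entropy 0 - (1 + S.E₀)) ^ k / 2 with hd
  have hd0 : 0 < d := by positivity
  refine ⟨d ^ (1 / k), by positivity, b / d ^ 2, by positivity, fun x hx t ht => ?_⟩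
  have hθ := S.hθ_pos x hx t ht
  rcases le_total (b / d ^ 2 * S.V t) 1 with h | h
  · obtain ⟨y, hy, hτ⟩ := exists_le_θ (S := S) ht
    have h1 : 2 * d ≤ S.θ y t ^ k := by
      rw [hd, mul_div_cancel₀ _ two_ne_zero]
      exact Real.rpow_le_rpow (Real.exp_pos _).le hτ hk0.le
    have h2 := sq_sub_θ_rpow_le ht (fun x hx => hm x hx t ht) hx hy
    rw [← hk, ← hb] at h2
    rw [div_mul_eq_mul_div, div_le_one (by positivity)] at h
    have h3 := (abs_le_of_sq_le_sq' (h2.trans h) hd0.le).1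
    have h4 : d ≤ S.θ x t ^ k := by linarith
    have h5 : d ^ (1 / k) ≤ S.θ x t := by
      have := Real.rpow_le_rpow hd0.le h4 (by positivity : 0 ≤ 1 / k)
      rwa [← Real.rpow_mul hθ.le, mul_one_div_cancel hk0.ne', Real.rpow_one] at this
    refine le_trans (mul_le_of_le_one_right (by positivity) ?_) h5
    have := V_nonneg (S := S) ht
    have : 0 ≤ b / d ^ 2 * S.V t := by positivity
    linarith
  · exact (mul_nonpos_of_nonneg_of_nonpos (by positivity) (by linarith)).trans hθ.le

variable (S) in
/-- Uniform positive lower bound for the specific volume. -/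
theorem exists_le_u : ∃ n > 0, ∀ x ∈ Icc (0:ℝ) 1, ∀ t ∈ Ici (0:ℝ), n ≤ S.u x t := by
  obtain ⟨m, hm0, hm⟩ := S.exists_u_le
  obtain ⟨c, hc0, D, hD0, hθ⟩ := exists_le_θ_sub_V hm0 hm
  set T := D * (1 + 2 * S.E₀ - S.entropy 0) + 1 with hT
  have hT0 : 0 < T := by
    have := entropy_le (S := S) (self_mem_Ici (a := (0:ℝ)))
    have : 0 ≤ D * (1 + 2 * S.E₀ - S.entropy 0) := mul_nonneg hD0.le (by linarith)
    linarith
  obtain ⟨B, hB0, hB⟩ := ((JointCont.const 1).div S.jointCont_u S.hu_pos).exists_bound T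
  set e := Real.exp (1 + S.E₀) with he
  have he0 : 0 < e := Real.exp_pos _
  refine ⟨min (1 / (B + 1)) (c / (e ^ 2 * Real.exp T)), by positivity, fun x hx t ht => ?_⟩
  have hu := S.hu_pos x hx t ht
  rcases le_total t T with htT | htT
  · refine (min_le_left _ _).trans ?_
    have h := (le_abs_self _).trans (hB x hx t ⟨ht, htT⟩)
    rw [div_le_iff₀ hu] at h
    rw [div_le_iff₀ (by positivity)]
    linarith
  · refine (min_le_right _ _).trans ?_
    have hr : t - T ∈ Ici (0:ℝ) := sub_nonneg.2 htT
    set g := Real.exp (t - T) / e with hg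
    have hg0 : 0 < g := by positivity
    have hI : Icc (t - T) t ⊆ Ici 0 := fun s hs => le_trans hr hs.1
    have hanti : AntitoneOn (fun s => g * c * (s - D * S.entropy s) - S.scaledVolume x s)
        (Icc (t - T) t) := by
      have hcL := (continuousOn_entropy (S := S)).mono hI
      refine antitoneOn_Icc_of_hasDerivAt (f' := fun s => g * c * (1 - D * S.V s)
          - S.θ x s * Real.exp (s - ∫ ξ in (0:ℝ)..x, S.v ξ s))
        (ContinuousOn.sub (by fun_prop) ((continuousOn_scaledVolume hx).mono hI)) (fun s hs => ?_)
        fun s hs => ?_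
      · have hs0 : 0 < s := lt_of_le_of_lt hr hs.1
        exact (((hasDerivAt_id s).sub ((hasDerivAt_entropy hs0).const_mul D)).const_mul
          (g * c)).sub (hasDerivAt_scaledVolume hx hs0)
      · have hs0 : s ∈ Ici (0:ℝ) := (lt_of_le_of_lt hr hs.1).le
        have h1 : g ≤ Real.exp (s - ∫ ξ in (0:ℝ)..x, S.v ξ s) := by
          rw [hg, div_le_iff₀ he0, mul_comm]
          exact (Real.exp_le_exp.2 hs.1.le).trans (le_exp_integral hx hs0)
        have h2 : g * (c * (1 - D * S.V s)) ≤ g * S.θ x s :=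
          mul_le_mul_of_nonneg_left (hθ x hx s hs0) hg0.le
        have h3 := mul_le_mul_of_nonneg_left h1 (S.hθ_pos x hx s hs0).le
        linarith
    have hle : t - T ≤ t := by linarith
    have h1 := hanti (left_mem_Icc.2 hle) (right_mem_Icc.2 hle) hle
    simp only at h1
    have h2 : 0 ≤ S.scaledVolume x (t - T) :=
      mul_nonneg (S.hu_pos x hx _ hr).le (Real.exp_pos _).le
    have h3 : D * (S.entropy t - S.entropy (t - T)) ≤ T - 1 := by
      rw [hT, add_sub_cancel_right]
      exact mul_le_mul_of_nonneg_left (sub_le_sub (entropy_le ht) (entropy_ge hr)) hD0.le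
    have h4 : g * c * 1 ≤ S.scaledVolume x t := by
      have := mul_le_mul_of_nonneg_left (show 1 ≤ T - D * (S.entropy t - S.entropy (t - T)) by
        linarith) (mul_pos hg0 hc0).le
      linarith
    have h5 : S.scaledVolume x t ≤ S.u x t * (e * Real.exp t) :=
      mul_le_mul_of_nonneg_left (exp_integral_le hx ht) hu.le
    have h6 : c / (e ^ 2 * Real.exp T) * (e * Real.exp t) = g * c * 1 := by
      rw [hg, Real.exp_sub]; field_simp
    exact le_of_mul_le_mul_right (h6.trans_le (h4.trans h5)) (by positivity)

end NSSol

/-- A Grönwall estimate with an absorbed dissipation term. -/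
theorem gronwall_dissipation {G G' N V ψ : ℝ → ℝ} {a c B : ℝ} (ha : 0 ≤ a) (hc : 0 ≤ c)
    (hG : ContinuousOn G (Ici 0)) (hN : ContinuousOn N (Ici 0)) (hψ : ContinuousOn ψ (Ici 0))
    (hG' : ∀ t > 0, HasDerivAt G (G' t) t) (hψ' : ∀ t > 0, HasDerivAt ψ (V t) t)
    (h : ∀ t > 0, G' t ≤ -(a * N t) + c * V t * G t) (hB : ∀ t ∈ Ici (0:ℝ), ψ t ≤ B)
    (hG0 : ∀ t ∈ Ici (0:ℝ), 0 ≤ G t) (hN0 : ∀ t ∈ Ici (0:ℝ), 0 ≤ N t) {T : ℝ} (hT : 0 ≤ T) :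
    G T + a * ∫ t in (0:ℝ)..T, N t ≤ G 0 * Real.exp (c * (B - ψ 0)) := by
  have hM : Continuous fun t => N (max t 0) :=
    hN.comp_continuous (by fun_prop) fun t => le_max_right t 0
  have hanti : AntitoneOn (fun t => G t * Real.exp (-(c * ψ t))
      + a * Real.exp (-(c * B)) * ∫ s in (0:ℝ)..t, N (max s 0)) (Ici 0) := by
    have hI : Continuous fun t => ∫ s in (0:ℝ)..t, N (max s 0) :=
      intervalIntegral.continuous_primitive (fun a b => hM.intervalIntegrable a b) 0
    refine antitoneOn_Ici_of_hasDerivAt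
      (f' := fun t => G' t * Real.exp (-(c * ψ t))
        + G t * (Real.exp (-(c * ψ t)) * -(c * V t)) + a * Real.exp (-(c * B)) * N (max t 0))
      ((hG.mul (continuousOn_const.mul hψ).neg.rexp).add
        (continuousOn_const.mul hI.continuousOn)) (fun t ht => ?_) fun t ht => ?_
    · exact ((hG' t ht).mul ((hψ' t ht).const_mul c).neg.exp).add
        ((intervalIntegral.integral_hasDerivAt_right (hM.intervalIntegrable 0 t)
          (hM.stronglyMeasurableAtFilter _ _) hM.continuousAt).const_mul _)
    · rw [max_eq_left ht.le]
      have h1 := mul_le_mul_of_nonneg_right (h t ht) (Real.exp_pos (-(c * ψ t))).le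
      have h2 : Real.exp (-(c * B)) ≤ Real.exp (-(c * ψ t)) :=
        Real.exp_le_exp.2 (neg_le_neg (mul_le_mul_of_nonneg_left (hB t ht.le) hc))
      have h3 := mul_le_mul_of_nonneg_left h2 (mul_nonneg ha (hN0 t ht.le))
      linarith
  have h1 := hanti self_mem_Ici (mem_Ici.2 hT) hT
  have h2 : ∫ s in (0:ℝ)..T, N (max s 0) = ∫ s in (0:ℝ)..T, N s :=
    intervalIntegral.integral_congr fun s hs => by
      rw [uIcc_of_le hT] at hs
      simp only [max_eq_left hs.1]
  simp only [intervalIntegral.integral_same, mul_zero, add_zero, h2] at h1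
  have h3 : G T * Real.exp (-(c * B)) ≤ G T * Real.exp (-(c * ψ T)) :=
    mul_le_mul_of_nonneg_left (Real.exp_le_exp.2
      (neg_le_neg (mul_le_mul_of_nonneg_left (hB T hT) hc))) (hG0 T hT)
  have h4 : G 0 * Real.exp (c * (B - ψ 0)) * Real.exp (-(c * B)) = G 0 * Real.exp (-(c * ψ 0)) := by
    rw [mul_assoc, ← Real.exp_add]; ring_nf
  refine le_of_mul_le_mul_right ?_ (Real.exp_pos (-(c * B)))
  rw [h4]
  linarith

namespace NSSol

variable {S : NSSol} {x y t s m n : ℝ}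

variable (S) in
/-- The weighted squared `L²` norm of the stress. -/
noncomputable def stressEnergy (t : ℝ) : ℝ := ∫ x in (0:ℝ)..1, S.u x t * S.stress x t ^ 2

variable (S) in
/-- The squared `L²` norm of the acceleration. -/
noncomputable def accelSq (t : ℝ) : ℝ := ∫ x in (0:ℝ)..1, S.vt x t ^ 2

variable (S) in
/-- The weighted squared `L²` norm of the heat flux. -/
noncomputable def fluxSq (t : ℝ) : ℝ := ∫ x in (0:ℝ)..1, S.u x t * S.flux x t ^ 2

variable (S) in
/-- The thermal functional, measuring the deviation of the temperature from its mean. -/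
noncomputable def thermal (t : ℝ) : ℝ :=
  ((∫ x in (0:ℝ)..1, S.θ x t ^ (S.β + 2)) - (∫ x in (0:ℝ)..1, S.θ x t) ^ (S.β + 2)) / (S.β + 2)

theorem accelSq_nonneg : 0 ≤ S.accelSq t := integral_unit_nonneg fun _ _ => sq_nonneg _

theorem fluxSq_nonneg (ht : t ∈ Ici (0:ℝ)) : 0 ≤ S.fluxSq t :=
  integral_unit_nonneg fun x hx => mul_nonneg (S.hu_pos x hx t ht).le (sq_nonneg _)

theorem stressEnergy_nonneg (ht : t ∈ Ici (0:ℝ)) : 0 ≤ S.stressEnergy t :=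
  integral_unit_nonneg fun x hx => mul_nonneg (S.hu_pos x hx t ht).le (sq_nonneg _)

theorem jointCont_stressEnergy : JointCont (fun x t => S.u x t * S.stress x t ^ 2) :=
  S.jointCont_u.mul (S.jointCont_stress.pow 2)

theorem stressEnergy_sub (hs : s ∈ Ici (0:ℝ)) (ht : t ∈ Ici (0:ℝ)) :
    S.stressEnergy s - S.stressEnergy t
      = -(∫ x in (0:ℝ)..1, (S.vt x s + S.vt x t) * (S.v x s - S.v x t))
        - (∫ x in (0:ℝ)..1, (S.stress x s + S.stress x t) * (S.θ x s - S.θ x t))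
        - ∫ x in (0:ℝ)..1, S.stress x s * S.stress x t * (S.u x s - S.u x t) := by
  have hus := S.jointCont_u.slice hs
  have hut := S.jointCont_u.slice ht
  have hvs := S.jointCont_v.slice hs
  have hvt := S.jointCont_v.slice ht
  have hθs := S.jointCont_θ.slice hs
  have hθt := S.jointCont_θ.slice ht
  have hσs := S.jointCont_stress.slice hs
  have hσt := S.jointCont_stress.slice ht
  have has := S.jointCont_vt.slice hs
  have hat := S.jointCont_vt.slice ht
  have h : ∫ x in (0:ℝ)..1, (S.u x s * S.stress x s ^ 2 - S.u x t * S.stress x t ^ 2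
      + (S.vt x s + S.vt x t) * (S.v x s - S.v x t)
      + (S.stress x s + S.stress x t) * (S.θ x s - S.θ x t)
      + S.stress x s * S.stress x t * (S.u x s - S.u x t)) = 0 := by
    refine (integral_deriv_Icc
      (f := fun x => (S.stress x s + S.stress x t) * (S.v x s - S.v x t)) le_rfl
      zero_le_one le_rfl (fun x hx => ?_) (by fun_prop)).trans ?_
    · refine (((hasDeriv_stress hx hs).add (hasDeriv_stress hx ht)).mul
        ((S.hvx x hx s hs).sub (S.hvx x hx t ht))).congr_deriv ?_
      rw [vx_eq hx hs, vx_eq hx ht]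
      simp only [Pi.add_apply, Pi.sub_apply]
      ring
    · simp [stress_zero hs, stress_zero ht, stress_one hs, stress_one ht]
  rw [intervalIntegral.integral_add, intervalIntegral.integral_add, intervalIntegral.integral_add,
    intervalIntegral.integral_sub] at h
  · rw [stressEnergy, stressEnergy]
    linarith
  all_goals exact ContinuousOn.intervalIntegrable_unit (by fun_prop)

theorem hasDerivAt_stressEnergy (ht : 0 < t) :
    HasDerivAt S.stressEnergy (-(2 * S.accelSq t)
      + ∫ x in (0:ℝ)..1, (6 * S.stress x t * S.vt x t * S.v x t + 2 * S.vt x t * S.flux x t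
        + S.u x t * S.stress x t ^ 2)) t := by
  have ht' : t ∈ Ici (0:ℝ) := ht.le
  have h1 := (S.jointCont_vt.add (S.jointCont_vt.freeze ht')).tendsto_integral_slope
    S.jointCont_v S.jointCont_vt S.hvt ht (b := 1) (by simp)
  have h2 := (S.jointCont_stress.add (S.jointCont_stress.freeze ht')).tendsto_integral_slope
    S.jointCont_θ S.jointCont_θt S.hθt ht (b := 1) (by simp)
  have h3 := (S.jointCont_stress.mul (S.jointCont_stress.freeze ht')).tendsto_integral_slope
    S.jointCont_u S.jointCont_ut S.hut ht (b := 1) (by simp)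
  have h4 := (h1.neg.sub h2).sub h3
  refine HasDerivAt.congr_deriv (hasDerivAt_iff_tendsto_slope.2 (h4.congr' ?_)) ?_
  · filter_upwards [mem_nhdsWithin_of_mem_nhds (Ici_mem_nhds ht)] with s hs
    simp only [slope_def_field]
    rw [stressEnergy_sub hs ht', sub_div, sub_div, neg_div]
    simp only [← intervalIntegral.integral_div, mul_div_assoc]
  have hu := S.jointCont_u.slice ht'
  have hut := S.jointCont_ut.slice ht'
  have hv := S.jointCont_v.slice ht'
  have hθt := S.jointCont_θt.slice ht'
  have hσ := S.jointCont_stress.slice ht'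
  have ha := S.jointCont_vt.slice ht'
  have hq := S.jointCont_flux.slice ht'
  have h : ∫ x in (0:ℝ)..1, ((S.vt x t + S.vt x t) * S.vt x t
      + (S.stress x t + S.stress x t) * S.θt x t + S.stress x t * S.stress x t * S.ut x t
      - 2 * S.vt x t ^ 2
      + (6 * S.stress x t * S.vt x t * S.v x t + 2 * S.vt x t * S.flux x t
        + S.u x t * S.stress x t ^ 2)) = 0 := by
    refine (integral_deriv_Icc (f := fun x => 2 * S.stress x t * S.flux x t
      + 3 * S.stress x t ^ 2 * S.v x t) le_rfl
      zero_le_one le_rfl (fun x hx => ?_) (by fun_prop)).trans ?_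
    · have hσ' := hasDeriv_stress (S := S) hx ht'
      refine (((hσ'.const_mul 2).mul (hasDeriv_flux hx ht')).add
        (((hσ'.pow 2).const_mul 3).mul (S.hvx x hx t ht'))).congr_deriv ?_
      simp only [Pi.pow_apply]
      linear_combination (-S.stress x t ^ 2) * S.mass x hx t ht'
    · simp [stress_zero ht', stress_one ht']
  rw [intervalIntegral.integral_add, intervalIntegral.integral_sub, intervalIntegral.integral_add,
    intervalIntegral.integral_add, intervalIntegral.integral_const_mul] at h
  · rw [accelSq]
    linarith
  all_goals exact ContinuousOn.intervalIntegrable_unit (by fun_prop)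

theorem integral_stress_sq_le (hn0 : 0 < n) (hn : ∀ x ∈ Icc (0:ℝ) 1, n ≤ S.u x t)
    (ht : t ∈ Ici (0:ℝ)) : ∫ x in (0:ℝ)..1, S.stress x t ^ 2 ≤ S.stressEnergy t / n := by
  have hu := S.jointCont_u.slice ht
  have hσ := S.jointCont_stress.slice ht
  rw [le_div_iff₀ hn0, ← intervalIntegral.integral_mul_const]
  exact integral_unit_mono (by fun_prop) (by fun_prop) fun x hx => by
    rw [mul_comm]
    exact mul_le_mul_of_nonneg_right (hn x hx) (sq_nonneg _)

theorem stress_sq_le (ht : t ∈ Ici (0:ℝ)) (hx : x ∈ Icc (0:ℝ) 1) :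
    S.stress x t ^ 2 ≤ S.accelSq t := by
  have h := sq_sub_le_of_sq_deriv_le (B := fun _ => 1) (fun x hx => hasDeriv_stress (S := S) hx ht)
    (S.jointCont_vt.slice ht) ((S.jointCont_vt.pow 2).slice ht) continuousOn_const
    (fun x _ => sq_nonneg _) (fun _ _ => zero_le_one) (fun x _ => by simp) hx
    (y := 0) (by simp)
  rw [stress_zero ht] at h
  simpa [accelSq] using h

theorem stress_pow_four_le (hn0 : 0 < n) (hn : ∀ x ∈ Icc (0:ℝ) 1, n ≤ S.u x t)
    (ht : t ∈ Ici (0:ℝ)) (hx : x ∈ Icc (0:ℝ) 1) :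
    S.stress x t ^ 4 ≤ 4 * (S.stressEnergy t / n) * S.accelSq t := by
  have hσ := S.jointCont_stress.slice ht
  have ha := S.jointCont_vt.slice ht
  have h := sq_sub_le_of_sq_deriv_le (A := fun x => 4 * S.stress x t ^ 2)
    (B := fun x => S.vt x t ^ 2)
    (fun x hx => (hasDeriv_stress (S := S) hx ht).pow 2)
    (by fun_prop) (by fun_prop) (by fun_prop)
    (fun x _ => by positivity) (fun x _ => by positivity)
    (fun x _ => le_of_eq (by simp; ring)) hx (y := 0) (by simp)
  simp only [Pi.pow_apply, stress_zero ht] at h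
  rw [intervalIntegral.integral_const_mul] at h
  calc S.stress x t ^ 4 = (S.stress x t ^ 2 - 0 ^ 2) ^ 2 := by ring
    _ ≤ _ := h
    _ ≤ _ := mul_le_mul_of_nonneg_right (mul_le_mul_of_nonneg_left
      (integral_stress_sq_le hn0 hn ht) (by norm_num)) accelSq_nonneg

/-- Differential inequality for the stress energy. -/
theorem deriv_stressEnergy_le (hn0 : 0 < n) (hn : ∀ x ∈ Icc (0:ℝ) 1, n ≤ S.u x t)
    (ht : t ∈ Ici (0:ℝ)) :
    -(2 * S.accelSq t)
      + ∫ x in (0:ℝ)..1, (6 * S.stress x t * S.vt x t * S.v x t + 2 * S.vt x t * S.flux x t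
        + S.u x t * S.stress x t ^ 2)
      ≤ -(S.accelSq t / 2) + 2 / n * S.fluxSq t
        + (1 + 2 * (36 * S.E₀) ^ 2 / n) * S.stressEnergy t := by
  have hE := S.E₀_pos
  have hu := S.jointCont_u.slice ht
  have hv := S.jointCont_v.slice ht
  have hσ := S.jointCont_stress.slice ht
  have ha := S.jointCont_vt.slice ht
  have hq := S.jointCont_flux.slice ht
  have hN := accelSq_nonneg (S := S) (t := t)
  have hF := stressEnergy_nonneg (S := S) ht
  obtain ⟨z, hz, hmax⟩ := isCompact_Icc.exists_isMaxOn (nonempty_Icc.2 zero_le_one) (hσ.pow 2)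
  set r := S.stress z t ^ 2 with hr
  have h1 : ∫ x in (0:ℝ)..1, (6 * S.stress x t * S.vt x t * S.v x t
      + 2 * S.vt x t * S.flux x t + S.u x t * S.stress x t ^ 2)
      ≤ ∫ x in (0:ℝ)..1, (S.vt x t ^ 2 + 18 * r * S.v x t ^ 2
        + 2 / n * (S.u x t * S.flux x t ^ 2) + S.u x t * S.stress x t ^ 2) := by
    refine integral_unit_mono (by fun_prop) (by fun_prop) fun x hx => ?_
    have h2 : S.stress x t ^ 2 ≤ r := hmax hx
    have h3 := mul_le_mul_of_nonneg_right h2 (sq_nonneg (S.v x t))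
    have h4 : S.flux x t ^ 2 ≤ 1 / n * (S.u x t * S.flux x t ^ 2) := by
      rw [one_div, inv_mul_eq_div, le_div_iff₀ hn0, mul_comm]
      exact mul_le_mul_of_nonneg_right (hn x hx) (sq_nonneg _)
    have h5 : 2 / n * (S.u x t * S.flux x t ^ 2) = 2 * (1 / n * (S.u x t * S.flux x t ^ 2)) := by
      ring
    nlinarith [sq_nonneg (6 * (S.stress x t * S.v x t) - S.vt x t),
      sq_nonneg (2 * S.flux x t - S.vt x t)]
  set J := ∫ x in (0:ℝ)..1, (6 * S.stress x t * S.vt x t * S.v x t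
      + 2 * S.vt x t * S.flux x t + S.u x t * S.stress x t ^ 2)
  rw [intervalIntegral.integral_add, intervalIntegral.integral_add, intervalIntegral.integral_add,
    intervalIntegral.integral_const_mul, intervalIntegral.integral_const_mul] at h1
  · have hr0 : 0 ≤ r := sq_nonneg _
    have h2 := mul_le_mul_of_nonneg_left (integral_v_sq_le (S := S) ht)
      (by positivity : 0 ≤ 18 * r)
    have h3 : 36 * S.E₀ * r ≤ S.accelSq t / 2 + 2 * (36 * S.E₀) ^ 2 / n * S.stressEnergy t := by
      refine (abs_le_of_sq_le_sq' ?_ (by positivity)).2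
      have h4 := stress_pow_four_le hn0 hn ht hz
      have h5 : (36 * S.E₀ * r) ^ 2
          ≤ (36 * S.E₀) ^ 2 * (4 * (S.stressEnergy t / n) * S.accelSq t) := by
        calc (36 * S.E₀ * r) ^ 2 = (36 * S.E₀) ^ 2 * S.stress z t ^ 4 := by rw [hr]; ring
          _ ≤ _ := mul_le_mul_of_nonneg_left h4 (sq_nonneg _)
      refine h5.trans ?_
      have h6 : 2 * (36 * S.E₀) ^ 2 / n * S.stressEnergy t
          = 2 * (36 * S.E₀) ^ 2 * (S.stressEnergy t / n) := by ring
      rw [h6]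
      nlinarith [sq_nonneg (S.accelSq t / 2 - 2 * (36 * S.E₀) ^ 2 * (S.stressEnergy t / n))]
    rw [← accelSq, ← fluxSq, ← stressEnergy] at h1
    linarith
  all_goals exact ContinuousOn.intervalIntegrable_unit (by fun_prop)

theorem hasDerivAt_thermal (ht : 0 < t) :
    HasDerivAt S.thermal (-((S.β + 1) * S.fluxSq t)
      + ∫ x in (0:ℝ)..1, S.stress x t * S.vx x t
        * (S.θ x t ^ (S.β + 1) - (∫ y in (0:ℝ)..1, S.θ y t) ^ (S.β + 1))) t := by
  have ht' : t ∈ Ici (0:ℝ) := ht.le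
  have hβ := S.hβ
  have hJ := S.jointCont_θ.rpow S.hθ_pos (S.β + 2)
  have hJt : JointCont (fun x t => (S.β + 2) * S.θ x t ^ (S.β + 1) * S.θt x t) :=
    ((JointCont.const (S.β + 2)).mul (S.jointCont_θ.rpow S.hθ_pos (S.β + 1))).mul S.jointCont_θt
  have h1 := hJ.hasDerivAt_integral hJt (fun x hx t ht => by
    refine ((S.hθt x hx t ht).rpow_const (p := S.β + 2)
      (Or.inl (S.hθ_pos x hx t ht).ne')).congr_deriv ?_
    rw [show S.β + 2 - 1 = S.β + 1 by ring]; ring) ht (b := 1) (by simp)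
  have h2 := S.jointCont_θ.hasDerivAt_integral S.jointCont_θt S.hθt ht (b := 1) (by simp)
  have h3 := (h1.sub (h2.rpow_const (p := S.β + 2) (Or.inr (by linarith)))).div_const (S.β + 2)
  refine h3.congr_deriv ?_
  set Θ := ∫ y in (0:ℝ)..1, S.θ y t
  rw [show S.β + 2 - 1 = S.β + 1 by ring]
  have hu := S.jointCont_u.slice ht'
  have hθ := (S.jointCont_θ.rpow S.hθ_pos (S.β + 1)).slice ht'
  have hθt := S.jointCont_θt.slice ht'
  have hvx := S.jointCont_vx.slice ht'
  have hσ := S.jointCont_stress.slice ht'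
  have hq := S.jointCont_flux.slice ht'
  have h : ∫ x in (0:ℝ)..1, (S.θ x t ^ (S.β + 1) * S.θt x t - Θ ^ (S.β + 1) * S.θt x t
      + (S.β + 1) * (S.u x t * S.flux x t ^ 2)
      - S.stress x t * S.vx x t * (S.θ x t ^ (S.β + 1) - Θ ^ (S.β + 1))) = 0 := by
    refine (integral_deriv_Icc
      (f := fun x => S.flux x t * (S.θ x t ^ (S.β + 1) - Θ ^ (S.β + 1))) le_rfl
      zero_le_one le_rfl (fun x hx => ?_) (by fun_prop)).trans ?_
    · refine ((hasDeriv_flux hx ht').mul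
        ((hasDeriv_θ_rpow (S.β + 1) hx ht').sub_const _)).congr_deriv ?_
      have h4 : S.θ x t ^ (S.β + 1 - 1) * S.θx x t = S.u x t * S.flux x t := by
        have := S.hu_pos x hx t ht'
        rw [flux, add_sub_cancel_right]; field_simp
      linear_combination (S.β + 1) * S.flux x t * h4
    · simp [flux_zero ht', flux_one ht']
  rw [intervalIntegral.integral_sub, intervalIntegral.integral_add, intervalIntegral.integral_sub,
    intervalIntegral.integral_const_mul, intervalIntegral.integral_const_mul, ← fluxSq] at h
  · have h5 : ∫ x in (0:ℝ)..1, (S.β + 2) * S.θ x t ^ (S.β + 1) * S.θt x t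
        = (S.β + 2) * ∫ x in (0:ℝ)..1, S.θ x t ^ (S.β + 1) * S.θt x t := by
      rw [← intervalIntegral.integral_const_mul]
      simp only [mul_assoc]
    rw [h5, div_eq_iff (by linarith)]
    linear_combination (S.β + 2) * h
  all_goals exact ContinuousOn.intervalIntegrable_unit (by fun_prop)

/-- Differential inequality for the thermal functional. -/
theorem deriv_thermal_le (hn0 : 0 < n) (hn : ∀ x ∈ Icc (0:ℝ) 1, n ≤ S.u x t)
    (hm : ∀ x ∈ Icc (0:ℝ) 1, S.u x t ≤ m) (ht : t ∈ Ici (0:ℝ)) {P : ℝ}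
    (hP : ∀ x ∈ Icc (0:ℝ) 1, S.θ x t ^ (S.β + 1) ≤ P) :
    -((S.β + 1) * S.fluxSq t) + ∫ x in (0:ℝ)..1, S.stress x t * S.vx x t
        * (S.θ x t ^ (S.β + 1) - (∫ y in (0:ℝ)..1, S.θ y t) ^ (S.β + 1))
      ≤ -(S.fluxSq t / 2)
        + (P + (1 + P) * ((S.β + 1) ^ 2 * m * S.E₀ / 2) / n) * S.stressEnergy t := by
  have hE := S.E₀_pos
  have hβ := S.hβ
  set k := S.β + 1 with hk
  have hk0 : 0 < k := by positivity
  have hm0 : 0 < m := hn0.trans_le ((hn 0 (by simp)).trans (hm 0 (by simp)))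
  obtain ⟨y, hy, hΘ⟩ := exists_eq_integral_unit (S.jointCont_θ.slice ht)
  rw [← hΘ]
  have hQ := fluxSq_nonneg (S := S) ht
  have hF := stressEnergy_nonneg (S := S) ht
  have hu := S.jointCont_u.slice ht
  have hθ := S.jointCont_θ.slice ht
  have hθk := (S.jointCont_θ.rpow S.hθ_pos k).slice ht
  have hvx := S.jointCont_vx.slice ht
  have hσ := S.jointCont_stress.slice ht
  have hq := S.jointCont_flux.slice ht
  have hd : ∀ x ∈ Icc (0:ℝ) 1, (S.θ x t ^ k - S.θ y t ^ k) ^ 2 ≤ k ^ 2 * m * S.fluxSq t := by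
    intro x hx
    have h1 := sq_sub_le_of_sq_deriv_le (A := fun x => k ^ 2 * S.u x t)
      (B := fun x => S.u x t * S.flux x t ^ 2) (fun x hx => hasDeriv_θ_rpow (S := S) k hx ht)
      (((((JointCont.const k).mul (S.jointCont_θ.rpow S.hθ_pos (k - 1))).mul
        S.jointCont_θx)).slice ht) (by fun_prop) (by fun_prop)
      (fun x hx => mul_nonneg (sq_nonneg _) (S.hu_pos x hx t ht).le)
      (fun x hx => mul_nonneg (S.hu_pos x hx t ht).le (sq_nonneg _))
      (fun x hx => le_of_eq (by
        have h4 : S.θ x t ^ (k - 1) * S.θx x t = S.u x t * S.flux x t := by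
          have := S.hu_pos x hx t ht
          rw [flux, hk, add_sub_cancel_right]; field_simp
        rw [mul_assoc, h4]; ring)) hx hy
    refine h1.trans (mul_le_mul_of_nonneg_right ?_ hQ)
    simpa using integral_unit_mono (g := fun _ => k ^ 2 * m) (by fun_prop) (by fun_prop)
      fun x hx => mul_le_mul_of_nonneg_left (hm x hx) (sq_nonneg k)
  have hθ1 : ∀ x ∈ Icc (0:ℝ) 1, S.θ x t ≤ 1 + P := fun x hx =>
    (θ_le_one_add_rpow hx ht).trans (by linarith [hP x hx])
  have hP0 : 0 ≤ P := (Real.rpow_nonneg (S.hθ_pos y hy t ht).le k).trans (hP y hy)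
  set R := k ^ 2 * m * S.E₀ with hR
  have hR0 : 0 < R := by positivity
  have h1 : ∫ x in (0:ℝ)..1, S.stress x t * S.vx x t * (S.θ x t ^ k - S.θ y t ^ k)
      ≤ ∫ x in (0:ℝ)..1, ((P + (1 + P) * (R / 2) / n) * (S.u x t * S.stress x t ^ 2)
        + 1 / (2 * S.E₀) * S.fluxSq t * S.θ x t) := by
    refine integral_unit_mono (by fun_prop) (by fun_prop) fun x hx => ?_
    have hθ0 := S.hθ_pos x hx t ht
    have hu0 := S.hu_pos x hx t ht
    set d := S.θ x t ^ k - S.θ y t ^ k with hdd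
    have hdP : d ≤ P := by
      linarith [hP x hx, Real.rpow_nonneg (S.hθ_pos y hy t ht).le k]
    rw [vx_eq hx ht]
    have h2 : S.u x t * S.stress x t ^ 2 * d ≤ S.u x t * S.stress x t ^ 2 * P :=
      mul_le_mul_of_nonneg_left hdP (by positivity)
    have h3 : S.stress x t * d ≤ R / 2 * S.stress x t ^ 2 + 1 / (2 * R) * d ^ 2 := by
      have : R / 2 * S.stress x t ^ 2 + 1 / (2 * R) * d ^ 2 - S.stress x t * d
          = (R * S.stress x t - d) ^ 2 / (2 * R) := by field_simp; ring
      have : 0 ≤ (R * S.stress x t - d) ^ 2 / (2 * R) := by positivity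
      linarith
    have h4 : 1 / (2 * R) * d ^ 2 ≤ 1 / (2 * S.E₀) * S.fluxSq t := by
      have : 1 / (2 * S.E₀) * S.fluxSq t = 1 / (2 * R) * (k ^ 2 * m * S.fluxSq t) := by
        rw [hR]; field_simp
      rw [this]
      exact mul_le_mul_of_nonneg_left (hd x hx) (by positivity)
    have h5 : S.stress x t * d * S.θ x t
        ≤ R / 2 * S.stress x t ^ 2 * S.θ x t + 1 / (2 * S.E₀) * S.fluxSq t * S.θ x t := by
      have := mul_le_mul_of_nonneg_right (h3.trans (add_le_add_right h4 _)) hθ0.le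
      linarith
    have h6 : R / 2 * S.stress x t ^ 2 * S.θ x t
        ≤ (1 + P) * (R / 2) / n * (S.u x t * S.stress x t ^ 2) := by
      have e1 : R / 2 * S.stress x t ^ 2 * S.θ x t ≤ R / 2 * S.stress x t ^ 2 * (1 + P) :=
        mul_le_mul_of_nonneg_left (hθ1 x hx) (by positivity)
      have e2 : 1 ≤ S.u x t / n := (one_le_div hn0).2 (hn x hx)
      have e3 : R / 2 * S.stress x t ^ 2 * (1 + P) * 1
          ≤ R / 2 * S.stress x t ^ 2 * (1 + P) * (S.u x t / n) :=
        mul_le_mul_of_nonneg_left e2 (by positivity)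
      have e4 : R / 2 * S.stress x t ^ 2 * (1 + P) * (S.u x t / n)
          = (1 + P) * (R / 2) / n * (S.u x t * S.stress x t ^ 2) := by ring
      linarith
    linarith
  rw [intervalIntegral.integral_add, intervalIntegral.integral_const_mul,
    intervalIntegral.integral_const_mul, ← stressEnergy] at h1
  · have h2 : 1 / (2 * S.E₀) * S.fluxSq t * (∫ x in (0:ℝ)..1, S.θ x t) ≤ S.fluxSq t / 2 := by
      have : S.fluxSq t / 2 = 1 / (2 * S.E₀) * S.fluxSq t * S.E₀ := by field_simp
      rw [this]
      exact mul_le_mul_of_nonneg_left (integral_θ_le ht) (by positivity)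
    have h3 : S.fluxSq t ≤ k * S.fluxSq t := le_mul_of_one_le_left hQ (by linarith)
    linarith
  all_goals exact ContinuousOn.intervalIntegrable_unit (by fun_prop)

theorem stressEnergy_le_mul_V (ht : t ∈ Ici (0:ℝ)) {P : ℝ}
    (hP : ∀ x ∈ Icc (0:ℝ) 1, S.θ x t ^ (S.β + 1) ≤ P) :
    S.stressEnergy t ≤ (1 + P) * S.V t := by
  rw [stressEnergy, V, ← intervalIntegral.integral_const_mul]
  refine integral_unit_mono (jointCont_stressEnergy.slice ht)
    (((JointCont.const (1 + P)).mul S.jointCont_dissipation).slice ht) fun x hx => ?_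
  have hu := S.hu_pos x hx t ht
  have hθ := S.hθ_pos x hx t ht
  have h1 : S.θ x t ≤ 1 + P := (θ_le_one_add_rpow hx ht).trans (by linarith [hP x hx])
  have h2 : 0 ≤ S.θ x t ^ S.β * (S.θx x t) ^ 2 / (S.u x t * (S.θ x t) ^ 2) := by positivity
  calc S.u x t * S.stress x t ^ 2
      = S.θ x t * ((S.vx x t - S.θ x t) ^ 2 / (S.u x t * S.θ x t)) := by
        rw [stress]; field_simp
    _ ≤ _ := mul_le_mul h1 (le_add_of_nonneg_left h2) (by positivity) (by linarith)

theorem continuousOn_thermal : ContinuousOn S.thermal (Ici 0) :=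
  (((S.jointCont_θ.rpow S.hθ_pos (S.β + 2)).continuousOn_integral (b := 1) (by simp)).sub
    ((S.jointCont_θ.continuousOn_integral (b := 1) (by simp)).rpow_const
      fun _ _ => Or.inr (by linarith [S.hβ]))).div_const _

theorem neg_le_thermal (ht : t ∈ Ici (0:ℝ)) :
    -(S.E₀ ^ (S.β + 2) / (S.β + 2)) ≤ S.thermal t := by
  have hβ := S.hβ
  rw [thermal, ← neg_div]
  refine div_le_div_of_nonneg_right ?_ (by linarith)
  have h1 : 0 ≤ ∫ x in (0:ℝ)..1, S.θ x t ^ (S.β + 2) :=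
    integral_unit_nonneg fun x hx => Real.rpow_nonneg (S.hθ_pos x hx t ht).le _
  have h2 : (∫ x in (0:ℝ)..1, S.θ x t) ^ (S.β + 2) ≤ S.E₀ ^ (S.β + 2) :=
    Real.rpow_le_rpow (integral_unit_nonneg fun x hx => (S.hθ_pos x hx t ht).le)
      (integral_θ_le ht) (by linarith)
  linarith

variable (S) in
theorem continuousOn_accelSq : ContinuousOn S.accelSq (Ici 0) :=
  (S.jointCont_vt.pow 2).continuousOn_integral (by simp)

variable (S) in
/-- Uniform bounds for the stress energy and for the time integral of the acceleration. -/
theorem exists_stressEnergy_le : ∃ C > 0, ∀ T ∈ Ici (0:ℝ),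
    S.stressEnergy T ≤ C ∧ ∫ t in (0:ℝ)..T, S.accelSq t ≤ C := by
  obtain ⟨m, hm0, hm⟩ := S.exists_u_le
  obtain ⟨n, hn0, hn⟩ := S.exists_le_u
  have hE := S.E₀_pos
  have hβ := S.hβ
  set p := 2 * S.E₀ ^ (S.β + 1) with hp
  set b := 2 * ((S.β + 1) / 2) ^ 2 * S.E₀ * m with hb
  set R := (S.β + 1) ^ 2 * m * S.E₀ / 2 with hR
  have hp0 : 0 < p := by positivity
  have hb0 : 0 < b := by positivity
  have hR0 : 0 < R := by positivity
  set K := n / 4 with hK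
  have hK0 : 0 < K := by positivity
  set a₀ := 1 + p + b with ha₀
  set a₁ := K * (1 + 2 * (36 * S.E₀) ^ 2 / n) + a₀ * (1 + R / n) with ha₁
  have ha₀0 : 0 < a₀ := by positivity
  have ha₁0 : 0 < a₁ := by positivity
  set c := a₁ * (2 + 4 * a₀) * (1 + 1 / K) with hc
  have hc0 : 0 < c := by positivity
  set g := 1 + S.E₀ ^ (S.β + 2) / (S.β + 2) with hg
  have hGlow : ∀ t ∈ Ici (0:ℝ), 1 + K * S.stressEnergy t
      ≤ K * S.stressEnergy t + S.thermal t + g := fun t ht => by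
    linarith [neg_le_thermal (S := S) ht]
  have hFK : ∀ t ∈ Ici (0:ℝ), 0 ≤ K * S.stressEnergy t := fun t ht =>
    mul_nonneg hK0.le (stressEnergy_nonneg ht)
  have key := fun T (hT : (0:ℝ) ≤ T) => gronwall_dissipation
    (G := fun t => K * S.stressEnergy t + S.thermal t + g) (N := S.accelSq) (V := S.V)
    (ψ := S.entropy) (a := K / 2) (c := c) (B := 1 + 2 * S.E₀) (by positivity) hc0.le
    (((continuousOn_const.mul (jointCont_stressEnergy.continuousOn_integral (by simp))).add
      continuousOn_thermal).add continuousOn_const)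
    S.continuousOn_accelSq continuousOn_entropy
    (fun t ht => (((hasDerivAt_stressEnergy (S := S) ht).const_mul K).add
      (hasDerivAt_thermal ht)).add_const g)
    (fun t ht => hasDerivAt_entropy ht)
    (fun t ht => ?_) (fun t ht => entropy_le ht)
    (fun t ht => by linarith [hGlow t ht, hFK t ht]) (fun t ht => accelSq_nonneg) hT
  · set G₀ := (K * S.stressEnergy 0 + S.thermal 0 + g) *
      Real.exp (c * (1 + 2 * S.E₀ - S.entropy 0)) with hG₀
    have hG₀0 : 0 < G₀ :=
      mul_pos (by linarith [hGlow 0 self_mem_Ici, hFK 0 self_mem_Ici]) (Real.exp_pos _)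
    refine ⟨G₀ / K + G₀ / (K / 2), by positivity, fun T hT => ?_⟩
    have h1 := key T hT
    have h2 := hGlow T hT
    have h3 := hFK T hT
    have h4 : 0 ≤ ∫ t in (0:ℝ)..T, S.accelSq t :=
      intervalIntegral.integral_nonneg hT fun _ _ => accelSq_nonneg
    have h5 : 0 ≤ K / 2 * ∫ t in (0:ℝ)..T, S.accelSq t := by positivity
    have h6 : S.stressEnergy T ≤ G₀ / K := by
      rw [le_div_iff₀ hK0]; linarith
    have h7 : ∫ t in (0:ℝ)..T, S.accelSq t ≤ G₀ / (K / 2) := by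
      rw [le_div_iff₀ (by positivity)]; linarith
    have h8 : 0 ≤ G₀ / K := by positivity
    have h9 : 0 ≤ G₀ / (K / 2) := by positivity
    constructor <;> linarith
  · have ht' : t ∈ Ici (0:ℝ) := mem_Ici.2 (le_of_lt ht)
    have hV := V_nonneg (S := S) ht'
    have hF := stressEnergy_nonneg (S := S) ht'
    have hP : ∀ x ∈ Icc (0:ℝ) 1, S.θ x t ^ (S.β + 1) ≤ p + b * S.V t := fun x hx =>
      θ_rpow_le ht' (fun x hx => hm x hx t ht') hx
    have h1 := deriv_stressEnergy_le hn0 (fun x hx => hn x hx t ht') ht'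
    have h2 := deriv_thermal_le hn0 (fun x hx => hn x hx t ht') (fun x hx => hm x hx t ht') ht' hP
    have h3 := stressEnergy_le_mul_V ht' hP
    rw [← hR] at h2
    set F := S.stressEnergy t
    have h4 : 1 + (p + b * S.V t) ≤ a₀ * (1 + S.V t) := by
      have : 0 ≤ (1 + p) * S.V t := by positivity
      rw [ha₀]; linarith
    have h5 : K * (1 + 2 * (36 * S.E₀) ^ 2 / n)
        + (p + b * S.V t + (1 + (p + b * S.V t)) * R / n) ≤ a₁ * (1 + S.V t) := by
      have e1 : (1 + (p + b * S.V t)) * R / n ≤ a₀ * (1 + S.V t) * R / n := by gcongr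
      have e2 : 0 ≤ K * (1 + 2 * (36 * S.E₀) ^ 2 / n) * S.V t := by positivity
      have e3 : a₁ * (1 + S.V t) = K * (1 + 2 * (36 * S.E₀) ^ 2 / n)
          + K * (1 + 2 * (36 * S.E₀) ^ 2 / n) * S.V t + a₀ * (1 + S.V t)
          + a₀ * (1 + S.V t) * R / n := by rw [ha₁]; ring
      linarith
    have h6 : (1 + S.V t) * F ≤ (2 + 4 * a₀) * (S.V t * (1 + F)) := by
      have hVF : 0 ≤ S.V t * F := by positivity
      have e0 : 0 ≤ a₀ * (S.V t * F) := by positivity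
      rcases le_total (S.V t) 1 with hV1 | hV1
      · have e1 : F ≤ 2 * a₀ * S.V t := by
          refine h3.trans (mul_le_mul_of_nonneg_right (h4.trans ?_) hV)
          nlinarith
        linarith
      · have e1 : F ≤ S.V t * F := le_mul_of_one_le_left hF hV1
        have e2 : 0 ≤ a₀ * S.V t := by positivity
        linarith
    have h7 : 1 + F ≤ (1 + 1 / K) * (K * F + S.thermal t + g) := by
      have e1 := hGlow t ht'
      have e2 : F = 1 / K * (K * F) := by field_simp
      have e3 : 1 / K * (K * F) ≤ 1 / K * (K * F + S.thermal t + g) :=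
        mul_le_mul_of_nonneg_left (by linarith) (by positivity)
      have e4 := hFK t ht'
      linarith
    have h8 : a₁ * ((1 + S.V t) * F) ≤ c * S.V t * (K * F + S.thermal t + g) := by
      calc a₁ * ((1 + S.V t) * F) ≤ a₁ * ((2 + 4 * a₀) * (S.V t * (1 + F))) := by gcongr
        _ ≤ a₁ * ((2 + 4 * a₀) * (S.V t * ((1 + 1 / K) * (K * F + S.thermal t + g)))) := by
          gcongr
        _ = _ := by rw [hc]; ring
    have h9 := mul_le_mul_of_nonneg_left h1 hK0.le
    have h10 := mul_le_mul_of_nonneg_right h5 hF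
    have h11 : K * (2 / n * S.fluxSq t) = S.fluxSq t / 2 := by
      rw [hK]; field_simp; ring
    linarith

/-- Integrating a pointwise-in-time bound of a supremum. -/
theorem integral_sSup_le {f : ℝ → ℝ → ℝ} {N : ℝ → ℝ} {c C T : ℝ} (hc : 0 ≤ c) (hC : 0 ≤ C)
    (hT : 0 ≤ T) (hN : ContinuousOn N (Ici 0)) (hI : ∫ t in (0:ℝ)..T, N t ≤ C)
    (h : ∀ t ∈ Ici (0:ℝ), ∀ x ∈ Icc (0:ℝ) 1, f x t ≤ c * N t) :
    ∫ t in (0:ℝ)..T, sSup ((fun x => f x t) '' Icc (0:ℝ) 1) ≤ c * C := by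
  by_cases hi : IntervalIntegrable (fun t => sSup ((fun x => f x t) '' Icc (0:ℝ) 1)) volume 0 T
  · have hNi : IntervalIntegrable N volume 0 T :=
      (hN.mono (by rw [uIcc_of_le hT]; exact Icc_subset_Ici_self)).intervalIntegrable
    refine (intervalIntegral.integral_mono_on hT hi (hNi.const_mul c) fun t ht => ?_).trans ?_
    · refine csSup_le ((nonempty_Icc.2 zero_le_one).image _) ?_
      rintro _ ⟨x, hx, rfl⟩
      exact h t ht.1 x hx
    · rw [intervalIntegral.integral_const_mul]
      exact mul_le_mul_of_nonneg_left hI hc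
  · rw [intervalIntegral.integral_undef hi]
    positivity

end NSSol

/-- Time-integrability of the sup-norm of `w_x + u − θ = v_x − θ`, squared and
to the fourth power. -/
theorem stress_supnorm_time_integrable (S : NSSol) :
    ∃ C > (0:ℝ), ∀ T > (0:ℝ),
      (∫ t in (0:ℝ)..T, sSup ((fun x => (S.vx x t - S.θ x t) ^ 2) '' Icc (0:ℝ) 1)) ≤ C ∧
      (∫ t in (0:ℝ)..T, sSup ((fun x => (S.vx x t - S.θ x t) ^ 4) '' Icc (0:ℝ) 1)) ≤ C := by
  obtain ⟨m, hm0, hm⟩ := S.exists_u_le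
  obtain ⟨n, hn0, hn⟩ := S.exists_le_u
  obtain ⟨C, hC0, hC⟩ := S.exists_stressEnergy_le
  have hσ : ∀ x ∈ Icc (0:ℝ) 1, ∀ t ∈ Ici (0:ℝ), S.vx x t - S.θ x t = S.u x t * S.stress x t :=
    fun x hx t ht => by rw [NSSol.vx_eq hx ht]; ring
  refine ⟨m ^ 2 * C + m ^ 4 * (4 * (C / n)) * C, by positivity, fun T hT => ⟨?_, ?_⟩⟩
  · refine (NSSol.integral_sSup_le (c := m ^ 2) (by positivity) hC0.le hT.le
      S.continuousOn_accelSq (hC T hT.le).2 fun t ht x hx => ?_).trans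
      (le_add_of_nonneg_right (by positivity))
    rw [hσ x hx t ht, mul_pow]
    exact mul_le_mul (pow_le_pow_left₀ (S.hu_pos x hx t ht).le (hm x hx t ht) 2)
      (NSSol.stress_sq_le ht hx) (sq_nonneg _) (by positivity)
  · refine (NSSol.integral_sSup_le (c := m ^ 4 * (4 * (C / n))) (by positivity) hC0.le hT.le
      S.continuousOn_accelSq (hC T hT.le).2 fun t ht x hx => ?_).trans
      (le_add_of_nonneg_left (by positivity))
    rw [hσ x hx t ht, mul_pow, mul_assoc]
    refine mul_le_mul (pow_le_pow_left₀ (S.hu_pos x hx t ht).le (hm x hx t ht) 4)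
      ((NSSol.stress_pow_four_le hn0 (fun x hx => hn x hx t ht) ht hx).trans ?_)
      (by positivity) (by positivity)
    have := NSSol.accelSq_nonneg (S := S) (t := t)
    have := (hC t ht).1
    gcongr
end
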